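/- arXiv:1512.09096 — 6 statements merged into one kernel-verified Lean document; each statement's English description precedes it below -/
import Mathlib

section
/- Let F be a field of characteristic 0, let s be a solvable Lie subalgebra of gl(n,F), and let A ∈ s. Assume that there exist S, N ∈ s with A = S + N, S semisimple and N nilpotent (it is not assumed that S and N commute). Then the semisimple summand A_s and the nilpotent summand A_n of the Jordan–Chevalley decomposition of A both belong to s. -/
attribute [local instance 100] LieRing.ofAssociativeRing

/-- A square matrix over a field is *semisimple* if its minimal polynomial is squarefree. -/
def Matrix.IsSemisimpleJC {F : Type*} [Field F] {n : ℕ}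
    (A : Matrix (Fin n) (Fin n) F) : Prop :=
  Squarefree (minpoly F A)

set_option linter.unusedSectionVars false

namespace JCAux

open LieModule LieAlgebra

lemma nilp_of_sub {K V : Type*} [Field K] [AddCommGroup V] [Module K V] (f : Module.End K V)
    (W : Submodule K V) (h0 : ∀ w ∈ W, f w = 0) (k : ℕ) (hk : ∀ v, (f ^ k) v ∈ W) :
    IsNilpotent f := by
  refine ⟨k + 1, ?_⟩
  ext v
  rw [pow_succ']
  exact h0 _ (hk v)

lemma closed_case {K L : Type*} [Field K] [CharZero K] [IsAlgClosed K] [LieRing L]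
    [LieAlgebra K L] [IsSolvable L] (d : ℕ) :
    ∀ (V : Type*) [AddCommGroup V] [Module K V] [FiniteDimensional K V] [LieRingModule L V]
      [LieModule K L V], Module.finrank K V = d →
      (∀ x y : L, IsNilpotent (toEnd K L V x) → IsNilpotent (toEnd K L V y) →
        IsNilpotent (toEnd K L V (x + y))) ∧ (∀ x y : L, IsNilpotent (toEnd K L V ⁅x, y⁆)) := by
  induction d using Nat.strong_induction_on with
  | _ d ih =>
  intro V _ _ _ _ _ hd
  rcases subsingleton_or_nontrivial V with hV | hV
  · have : ∀ f : Module.End K V, IsNilpotent f := fun f => by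
      rw [Subsingleton.elim f 0]; exact IsNilpotent.zero
    exact ⟨fun _ _ _ _ => this _, fun _ _ => this _⟩
  obtain ⟨χ, hχ⟩ := exists_nontrivial_weightSpace_of_isSolvable K L V
  obtain ⟨⟨v, hv⟩, hv0⟩ := exists_ne (0 : weightSpace V χ)
  rw [mem_weightSpace] at hv
  have hv0 : v ≠ 0 := fun h => hv0 (Subtype.ext h)
  let W : LieSubmodule K L V :=
    { (K ∙ v) with
      lie_mem := by
        intro x m hm
        obtain ⟨c, rfl⟩ := Submodule.mem_span_singleton.1 hm
        rw [lie_smul, hv]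
        exact Submodule.smul_mem _ _ (Submodule.smul_mem _ _ (Submodule.mem_span_singleton_self v)) }
  have hvW : v ∈ W := Submodule.mem_span_singleton_self v
  have hW : ∀ w ∈ W, ∃ c : K, w = c • v := fun w hw => by
    obtain ⟨c, hc⟩ := Submodule.mem_span_singleton.1 hw
    exact ⟨c, hc.symm⟩
  have hfr : Module.finrank K (V ⧸ W) < d := by
    rw [← hd]
    have h1 := Submodule.finrank_quotient_add_finrank (W : Submodule K V)
    have h2 : 0 < Module.finrank K (W : Submodule K V) := by
      have : Nontrivial (W : Submodule K V) := ⟨⟨v, hvW⟩, 0, fun h => hv0 (congrArg Subtype.val h)⟩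
      exact Module.finrank_pos
    have h3 : Module.finrank K (V ⧸ W) = Module.finrank K (V ⧸ (W : Submodule K V)) := rfl
    omega
  have : FiniteDimensional K (V ⧸ W) :=
    inferInstanceAs (FiniteDimensional K (V ⧸ (W : Submodule K V)))
  obtain ⟨ih1, ih2⟩ := ih _ hfr (V ⧸ W) rfl
  have hpow : ∀ (x : L) (k : ℕ) (u : V), (LieSubmodule.Quotient.mk (((toEnd K L V x) ^ k) u) : V ⧸ W)
      = ((toEnd K L (V ⧸ W) x) ^ k) (LieSubmodule.Quotient.mk u) := by
    intro x k
    induction k with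
    | zero => intro u; rfl
    | succ k ihk =>
      intro u
      rw [pow_succ, pow_succ, Module.End.mul_apply, Module.End.mul_apply, ihk]
      rfl
  have hdown : ∀ x : L, IsNilpotent (toEnd K L V x) → IsNilpotent (toEnd K L (V ⧸ W) x) := by
    rintro x ⟨k, hk⟩
    refine ⟨k, ?_⟩
    ext u
    obtain ⟨u, rfl⟩ := LieSubmodule.Quotient.surjective_mk' W u
    change ((toEnd K L (V ⧸ W) x) ^ k) (LieSubmodule.Quotient.mk u) = 0
    rw [← hpow, hk]
    rfl
  have hchi : ∀ x : L, IsNilpotent (toEnd K L V x) → χ x = 0 := by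
    rintro x ⟨k, hk⟩
    have : ∀ k : ℕ, ((toEnd K L V x) ^ k) v = (χ x) ^ k • v := by
      intro k
      induction k with
      | zero => simp
      | succ k ihk =>
        rw [pow_succ, Module.End.mul_apply, toEnd_apply_apply, hv, map_smul, ihk, smul_smul,
          pow_succ']
    have h := this k
    rw [hk, LinearMap.zero_apply] at h
    rcases smul_eq_zero.1 h.symm with h | h
    · exact (IsReduced.eq_zero _ ⟨k, h⟩)
    · exact absurd h hv0
  have hup : ∀ x : L, χ x = 0 → IsNilpotent (toEnd K L (V ⧸ W) x) → IsNilpotent (toEnd K L V x) := by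
    rintro x hx ⟨k, hk⟩
    refine nilp_of_sub _ (W : Submodule K V) ?_ k ?_
    · intro w hw
      obtain ⟨c, rfl⟩ := hW w hw
      rw [map_smul, toEnd_apply_apply, hv, hx, zero_smul, smul_zero]
    · intro u
      have := hpow x k u
      rw [hk] at this
      exact (LieSubmodule.Quotient.mk_eq_zero (N := W)).1 this
  refine ⟨fun x y hx hy => hup _ ?_ (ih1 x y (hdown x hx) (hdown y hy)), fun x y => hup _ ?_ (ih2 x y)⟩
  · rw [map_add, hchi x hx, hchi y hy, add_zero]
  · have h : ⁅⁅x, y⁆, v⁆ = χ ⁅x, y⁆ • v := hv _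
    rw [lie_lie, hv, hv, lie_smul, lie_smul, hv, hv, smul_smul, smul_smul, mul_comm, sub_self] at h
    rcases smul_eq_zero.1 h.symm with h | h
    · exact h
    · exact absurd h hv0

open scoped TensorProduct in
lemma field_case {F L V : Type*} [Field F] [CharZero F] [LieRing L]
    [LieAlgebra F L] [IsSolvable L] [AddCommGroup V] [Module F V] [FiniteDimensional F V]
    [LieRingModule L V] [LieModule F L V] :
      (∀ x y : L, IsNilpotent (toEnd F L V x) → IsNilpotent (toEnd F L V y) →
        IsNilpotent (toEnd F L V (x + y))) ∧ (∀ x y : L, IsNilpotent (toEnd F L V ⁅x, y⁆)) := by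
  let K := AlgebraicClosure F
  have : CharZero K := charZero_of_injective_algebraMap (algebraMap F K).injective
  have key : ∀ x : L, IsNilpotent (toEnd K (K ⊗[F] L) (K ⊗[F] V) (1 ⊗ₜ x)) ↔
      IsNilpotent (toEnd F L V x) := by
    intro x
    have hinj : Function.Injective (Module.End.baseChangeHom F K V) :=
      LinearMap.baseChangeHom_injective F V K
    rw [← IsNilpotent.map_iff hinj, toEnd_baseChange]
    rfl
  obtain ⟨h1, h2⟩ := closed_case (K := K) (L := K ⊗[F] L) _ (K ⊗[F] V) rfl
  refine ⟨fun x y hx hy => ?_, fun x y => ?_⟩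
  · rw [← key] at hx hy ⊢
    rw [TensorProduct.tmul_add]
    exact h1 _ _ hx hy
  · rw [← key]
    have := h2 (1 ⊗ₜ x) (1 ⊗ₜ y)
    rwa [ExtendScalars.bracket_tmul, one_mul] at this

section
variable {F E : Type*} [Field F] [CharZero F] [Ring E] [Algebra F E] [FiniteDimensional F E]

lemma alg_case (s : LieSubalgebra F E) [IsSolvable s] :
    (∀ x ∈ s, ∀ y ∈ s, IsNilpotent x → IsNilpotent y → IsNilpotent (x + y)) ∧
    (∀ x ∈ s, ∀ y ∈ s, IsNilpotent ⁅x, y⁆) := by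
  let f : s →ₗ⁅F⁆ Module.End F E := (Algebra.lmul F E).toLieHom.comp s.incl
  obtain ⟨h1, h2⟩ := field_case (F := F) (L := f.range) (V := E)
  have hinj : Function.Injective (Algebra.lmul F E) := Algebra.lmul_injective
  have key : ∀ x : s, IsNilpotent (toEnd F f.range E ⟨f x, x, rfl⟩) ↔ IsNilpotent (x : E) := by
    intro x
    rw [← IsNilpotent.map_iff hinj]
    rfl
  refine ⟨fun x hx y hy hxn hyn => ?_, fun x hx y hy => ?_⟩
  · have a := (key ⟨x, hx⟩).2 hxn
    have b := (key ⟨y, hy⟩).2 hyn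
    refine (key (⟨x, hx⟩ + ⟨y, hy⟩)).1 ?_
    have e : (⟨f ((⟨x, hx⟩ : s) + ⟨y, hy⟩), (⟨x, hx⟩ : s) + ⟨y, hy⟩, rfl⟩ : f.range) =
        (⟨f ⟨x, hx⟩, ⟨x, hx⟩, rfl⟩ : f.range) + (⟨f ⟨y, hy⟩, ⟨y, hy⟩, rfl⟩ : f.range) :=
      Subtype.ext (map_add f _ _)
    rw [e]
    exact h1 _ _ a b
  · refine (key ⁅(⟨x, hx⟩ : s), (⟨y, hy⟩ : s)⁆).1 ?_
    have h := h2 ⟨f ⟨x, hx⟩, ⟨x, hx⟩, rfl⟩ ⟨f ⟨y, hy⟩, ⟨y, hy⟩, rfl⟩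
    have e : (⟨f ⁅(⟨x, hx⟩ : s), ⟨y, hy⟩⁆, ⁅(⟨x, hx⟩ : s), ⟨y, hy⟩⁆, rfl⟩ : f.range) =
        ⁅(⟨f ⟨x, hx⟩, ⟨x, hx⟩, rfl⟩ : f.range), (⟨f ⟨y, hy⟩, ⟨y, hy⟩, rfl⟩ : f.range)⁆ :=
      Subtype.ext (f.map_lie _ _)
    rw [e]
    exact h

/-- The lower central chain of a subspace under bracket. -/
def chain (p : Submodule F E) : ℕ → Submodule F E
  | 0 => p
  | k + 1 => Submodule.span F {z | ∃ x ∈ p, ∃ y ∈ chain p k, ⁅x, y⁆ = z}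

lemma chain_lie (p : Submodule F E) (k : ℕ) {x y : E} (hx : x ∈ p) (hy : y ∈ chain p k) :
    ⁅x, y⁆ ∈ chain p (k + 1) :=
  Submodule.subset_span ⟨x, hx, y, hy, rfl⟩

lemma chain_stable (p : Submodule F E) (a : E) (ha : ∀ x ∈ p, ⁅a, x⁆ ∈ p) (k : ℕ) :
    ∀ y ∈ chain p k, ⁅a, y⁆ ∈ chain p k := by
  induction k with
  | zero => exact ha
  | succ k ih =>
    intro y hy
    induction hy using Submodule.span_induction with
    | mem z hz =>
      obtain ⟨x, hx, y, hy, rfl⟩ := hz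
      rw [leibniz_lie]
      exact add_mem (chain_lie p k (ha x hx) hy) (chain_lie p k hx (ih y hy))
    | zero => rw [lie_zero]; exact zero_mem _
    | add u v _ _ hu hv => rw [lie_add]; exact add_mem hu hv
    | smul c u _ hu => rw [lie_smul]; exact Submodule.smul_mem _ _ hu

lemma chain_succ_le (p : Submodule F E) (hp : ∀ x ∈ p, ∀ y ∈ p, ⁅x, y⁆ ∈ p) (k : ℕ) :
    chain p (k + 1) ≤ chain p k := by
  refine Submodule.span_le.2 ?_
  rintro _ ⟨x, hx, y, hy, rfl⟩
  exact chain_stable p x (hp x hx) k y hy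

lemma ad_nilp (Y : E) (hY : IsNilpotent Y) : IsNilpotent (LieAlgebra.ad F E Y) := by
  rw [LieAlgebra.ad_eq_lmul_left_sub_lmul_right]
  have hl : IsNilpotent (LinearMap.mulLeft F Y) := by rwa [LinearMap.isNilpotent_mulLeft_iff]
  have hr : IsNilpotent (LinearMap.mulRight F Y) := by rwa [LinearMap.isNilpotent_mulRight_iff]
  exact (LinearMap.commute_mulLeft_right (R := F) Y Y).isNilpotent_sub hl hr

lemma chain_bot (p : Submodule F E) (hp : ∀ x ∈ p, ∀ y ∈ p, ⁅x, y⁆ ∈ p)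
    (hnil : ∀ x ∈ p, IsNilpotent x) : ∃ m, chain p m = ⊥ := by
  let q : LieSubalgebra F E := { p with lie_mem' := fun {x y} hx hy => hp x hx y hy }
  have hq : LieRing.IsNilpotent q := by
    rw [LieAlgebra.isNilpotent_iff_forall (R := F)]
    rintro ⟨x, hx⟩
    apply LieSubalgebra.isNilpotent_ad_of_isNilpotent_ad q (x := ⟨x, hx⟩)
    exact ad_nilp x (hnil x hx)
  obtain ⟨m, hm⟩ := (LieModule.isNilpotent_iff F q q).1 hq
  refine ⟨m, ?_⟩
  have hle : ∀ k, ∀ y ∈ chain p k, ∃ z : q, z ∈ lowerCentralSeries F q q k ∧ (z : E) = y := by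
    intro k
    induction k with
    | zero => exact fun y hy => ⟨⟨y, hy⟩, by simp, rfl⟩
    | succ k ih =>
      intro y hy
      induction hy using Submodule.span_induction with
      | mem z hz =>
        obtain ⟨x, hx, y, hy, rfl⟩ := hz
        obtain ⟨w, hw, rfl⟩ := ih y hy
        refine ⟨⁅(⟨x, hx⟩ : q), w⁆, ?_, rfl⟩
        rw [LieModule.lowerCentralSeries_succ]
        exact LieSubmodule.lie_mem_lie (LieSubmodule.mem_top _) hw
      | zero => exact ⟨0, zero_mem _, rfl⟩
      | add u v _ _ hu hv =>
        obtain ⟨a, ha, rfl⟩ := hu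
        obtain ⟨b, hb, rfl⟩ := hv
        exact ⟨a + b, add_mem ha hb, rfl⟩
      | smul c u _ hu =>
        obtain ⟨a, ha, rfl⟩ := hu
        exact ⟨c • a, Submodule.smul_mem _ c ha, rfl⟩
  rw [eq_bot_iff]
  intro y hy
  obtain ⟨z, hz, rfl⟩ := hle m y hy
  rw [hm, LieSubmodule.mem_bot] at hz
  rw [hz]
  exact zero_mem _

open Polynomial in
/-- Fitting splitting for an operator with squarefree minimal polynomial on a stable subspace. -/
lemma split {V : Type*} [AddCommGroup V] [Module F V] (D : Module.End F V) (p : F[X])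
    (hp : Squarefree p) (hpD : aeval D p = 0) (q : Submodule F V) (hq : ∀ x ∈ q, D x ∈ q) (x : V)
    (hx : x ∈ q) : ∃ y ∈ q, ∃ z ∈ q, x = z + D y ∧ D z = 0 := by
  have hpoly : ∀ r : F[X], ∀ v ∈ q, aeval D r v ∈ q := by
    intro r v hv
    induction r using Polynomial.induction_on' with
    | add a b ha hb => rw [map_add, LinearMap.add_apply]; exact add_mem ha hb
    | monomial k c =>
      rw [aeval_monomial, Module.End.mul_apply, Module.algebraMap_end_apply]
      refine Submodule.smul_mem _ _ ?_
      induction k with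
      | zero => exact hv
      | succ k ih => rw [pow_succ', Module.End.mul_apply]; exact hq _ ih
  have : ∃ r : F[X], IsCoprime X r ∧ aeval D (X * r) = 0 := by
    by_cases h : X ∣ p
    · obtain ⟨r, rfl⟩ := h
      refine ⟨r, ?_, hpD⟩
      rw [Polynomial.irreducible_X.coprime_iff_not_dvd]
      rintro ⟨t, rfl⟩
      exact Polynomial.irreducible_X.not_isUnit (hp X ⟨t, by ring⟩)
    · refine ⟨p, ?_, by rw [map_mul, hpD, mul_zero]⟩
      rwa [Polynomial.irreducible_X.coprime_iff_not_dvd]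
  obtain ⟨r, ⟨a, b, hab⟩, hr⟩ := this
  refine ⟨aeval D a x, hpoly a x hx, aeval D (b * r) x, hpoly _ x hx, ?_, ?_⟩
  · have h : aeval D (X * a + b * r) x = x := by
      rw [mul_comm X a, hab, map_one, Module.End.one_apply]
    rw [map_add, map_mul (aeval D) X, aeval_X, LinearMap.add_apply, Module.End.mul_apply,
      add_comm] at h
    exact h.symm
  · have : D (aeval D (b * r) x) = aeval D (b * (X * r)) x := by
      rw [show b * (X * r) = X * (b * r) by ring, map_mul (aeval D) X, aeval_X]
      rfl
    rw [this, map_mul, hr, mul_zero, LinearMap.zero_apply]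

lemma ad_semisimple (S : E) (hS : Squarefree (minpoly F S)) :
    (LieAlgebra.ad F E S).IsSemisimple := by
  rw [LieAlgebra.ad_eq_lmul_left_sub_lmul_right]
  have hl : Module.End.IsSemisimple (LinearMap.mulLeft F S) := by
    refine Module.End.isSemisimple_of_squarefree_aeval_eq_zero hS ?_
    have : LinearMap.mulLeft F S = Algebra.lmul F E S := rfl
    rw [this, Polynomial.aeval_algHom_apply, minpoly.aeval, map_zero]
  have hr : Module.End.IsSemisimple (LinearMap.mulRight F S) := by
    refine Module.End.isSemisimple_of_squarefree_aeval_eq_zero hS ?_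
    have h : ∀ r : Polynomial F, Polynomial.aeval (LinearMap.mulRight F S) r =
        LinearMap.mulRight F (Polynomial.aeval S r) := by
      intro r
      induction r using Polynomial.induction_on' with
      | add a b ha hb => rw [map_add, ha, hb, map_add]; ext; simp [mul_add]
      | monomial k c =>
        ext x
        simp [Polynomial.aeval_monomial, LinearMap.pow_mulRight, Module.algebraMap_end_apply,
          ← Algebra.smul_def]
    rw [h, minpoly.aeval]; simp
  exact Module.End.IsSemisimple.sub_of_commute (LinearMap.commute_mulLeft_right (R := F) S S) hl hr

variable [Module ℚ E]

lemma exp_expand (D : Module.End F E) (hD : IsNilpotent D) (q : Submodule F E)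
    (hq : ∀ x ∈ q, D x ∈ q) (x : E) (hx : D (D x) ∈ q) :
    ∃ r ∈ q, IsNilpotent.exp D x = x + D x + r := by
  obtain ⟨k, hk⟩ := hD
  have hk2 : D ^ (k + 2) = 0 := by rw [pow_add, hk, zero_mul]
  rw [IsNilpotent.exp_eq_sum hk2, Finset.sum_range_succ', Finset.sum_range_succ']
  refine ⟨∑ i ∈ Finset.range k, (((i + 1 + 1).factorial : ℚ)⁻¹) • (D ^ (i + 1 + 1)) x, ?_, ?_⟩
  · refine Submodule.sum_mem _ fun i hi => ?_
    clear hi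
    rw [← Rat.cast_smul_eq_qsmul F]
    refine Submodule.smul_mem _ _ ?_
    induction i with
    | zero => exact hx
    | succ i ih => rw [pow_succ']; exact hq _ ih
  · simp
    abel

lemma exp_stable (D : Module.End F E) (hD : IsNilpotent D) (q : Submodule F E)
    (hq : ∀ x ∈ q, D x ∈ q) (x : E) (hx : x ∈ q) : IsNilpotent.exp D x ∈ q := by
  obtain ⟨r, hr, h⟩ := exp_expand D hD q hq x (hq _ (hq _ hx))
  rw [h]
  exact add_mem (add_mem hx (hq _ hx)) hr

lemma exists_equiv (Y : E) (hY : IsNilpotent Y) : ∃ φ : E ≃ₐ[F] E,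
    (∀ x, φ x = IsNilpotent.exp (LieAlgebra.ad F E Y) x) ∧
    (∀ x, φ.symm x = IsNilpotent.exp (-LieAlgebra.ad F E Y) x) := by
  have hD : IsNilpotent (LieAlgebra.ad F E Y) := ad_nilp _ hY
  have h1 := IsNilpotent.exp_mul_exp_neg_self hD
  have h2 := IsNilpotent.exp_neg_mul_exp_self hD
  let e : E ≃ₗ[F] E := LinearEquiv.ofLinearMap (IsNilpotent.exp (LieAlgebra.ad F E Y))
    (IsNilpotent.exp (-LieAlgebra.ad F E Y)) h1 h2
  have hmul : ∀ x y, e (x * y) = e x * e y := by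
    intro x y
    refine Module.End.exp_mul_of_derivation F E _ ?_ hD x y
    intro x y
    simp only [LieAlgebra.ad_apply, LieRing.of_associative_ring_bracket]
    noncomm_ring
  have hone : e 1 = 1 := by
    have := hmul (e.symm 1) 1
    rw [mul_one, e.apply_symm_apply, one_mul] at this
    exact this.symm
  exact ⟨AlgEquiv.ofLinearEquiv e hone hmul, fun x => rfl, fun x => rfl⟩

/-- The induction: the decomposition descends along the chain. -/
lemma main_ind (s : LieSubalgebra F E) (p : Submodule F E) (hps : p ≤ s.toSubmodule)
    (hp : ∀ x ∈ s, ∀ y ∈ p, ⁅x, y⁆ ∈ p) (hnil : ∀ x ∈ p, IsNilpotent x)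
    (S : E) (hS : S ∈ s) (hSs : Squarefree (minpoly F S)) (m : ℕ) (hm : chain p m = ⊥) (j : ℕ) :
    ∀ k, k + j = m → ∀ Z ∈ p, ⁅S, Z⁆ = 0 → ∀ M ∈ chain p k,
      ∃ As An : E, S + Z + M = As + An ∧ Squarefree (minpoly F As) ∧ IsNilpotent An ∧
        Commute As An ∧ As ∈ s ∧ An ∈ s := by
  have hpp : ∀ x ∈ p, ∀ y ∈ p, ⁅x, y⁆ ∈ p := fun x hx y hy => hp x (hps hx) y hy
  have hle : ∀ k, chain p k ≤ p := by
    intro k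
    induction k with
    | zero => exact le_rfl
    | succ k ih => exact (chain_succ_le p hpp k).trans ih
  induction j with
  | zero =>
    intro k hk Z hZ hSZ M hM
    rw [add_zero] at hk
    rw [hk, hm, Submodule.mem_bot] at hM
    refine ⟨S, Z, by rw [hM, add_zero], hSs, hnil Z hZ, ?_, hS, hps hZ⟩
    rw [LieRing.of_associative_ring_bracket, sub_eq_zero] at hSZ
    exact hSZ
  | succ j ih =>
    intro k hk Z hZ hSZ M hM
    obtain ⟨Y, hY, M0, hM0, hMe, hSM0⟩ := split (LieAlgebra.ad F E S) _
      (ad_semisimple S hSs).minpoly_squarefree (minpoly.aeval _ _) (chain p k)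
      (chain_stable p S (hp S hS) k) M hM
    rw [LieAlgebra.ad_apply] at hMe hSM0
    have hYp : Y ∈ p := hle k hY
    have hYs : Y ∈ s := hps hYp
    have hMp : M ∈ p := hle k hM
    have hYn := hnil Y hYp
    have hD : IsNilpotent (LieAlgebra.ad F E Y) := ad_nilp _ hYn
    obtain ⟨φ, h1, h2⟩ := exists_equiv (F := F) Y hYn
    have hZM : ⁅Y, Z + M⁆ ∈ chain p (k + 1) := by
      rw [← lie_skew]
      exact neg_mem (chain_lie p k (add_mem hZ hMp) hY)
    have hYS : ⁅Y, S⁆ ∈ chain p k := by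
      rw [← lie_skew]
      exact neg_mem (chain_stable p S (hp S hS) k Y hY)
    have hYA : ⁅Y, S + Z + M⁆ ∈ chain p k := by
      rw [add_assoc, lie_add]
      exact add_mem hYS (chain_succ_le p hpp k hZM)
    obtain ⟨r, hr, hre⟩ := exp_expand (LieAlgebra.ad F E Y) hD (chain p (k + 1))
      (chain_stable p Y (hpp Y hYp) (k + 1)) (S + Z + M) (chain_lie p k hYp hYA)
    obtain ⟨As, An, hA, hAs, hAn, hc, hAss, hAns⟩ := ih (k + 1) (by omega) (Z + M0)
      (add_mem hZ (hle k hM0)) (by rw [lie_add, hSZ, hSM0, add_zero]) (⁅Y, Z + M⁆ + r)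
      (add_mem hZM hr)
    have hφ : φ (S + Z + M) = As + An := by
      rw [← hA, h1, hre, LieAlgebra.ad_apply, add_assoc S Z M, lie_add, ← lie_skew Y S]
      have e : M - ⁅S, Y⁆ = M0 := by rw [hMe, add_sub_cancel_right]
      rw [← e]
      abel
    have hstab : ∀ x ∈ s, φ.symm x ∈ s := by
      intro x hx
      rw [h2]
      refine exp_stable _ hD.neg s.toSubmodule ?_ x hx
      intro x hx
      rw [LinearMap.neg_apply]
      exact neg_mem (s.lie_mem hYs hx)
    refine ⟨φ.symm As, φ.symm An, ?_, ?_, hAn.map φ.symm, hc.map φ.symm, hstab _ hAss, hstab _ hAns⟩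
    · rw [← map_add, ← hφ, AlgEquiv.symm_apply_apply]
    · rwa [minpoly.algEquiv_eq]

lemma main (s : LieSubalgebra F E) [IsSolvable s] (S N : E) (hS : S ∈ s) (hN : N ∈ s)
    (hSs : Squarefree (minpoly F S)) (hNn : IsNilpotent N) :
    ∃ As An : E, S + N = As + An ∧ Squarefree (minpoly F As) ∧ IsNilpotent An ∧
        Commute As An ∧ As ∈ s ∧ An ∈ s := by
  obtain ⟨h1, h2⟩ := alg_case s
  let p : Submodule F E :=
    { carrier := {x | x ∈ s ∧ IsNilpotent x}
      add_mem' := fun {a b} ha hb => ⟨add_mem ha.1 hb.1, h1 a ha.1 b hb.1 ha.2 hb.2⟩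
      zero_mem' := ⟨zero_mem _, IsNilpotent.zero⟩
      smul_mem' := fun c x hx => ⟨s.smul_mem c hx.1, hx.2.smul c⟩ }
  have hp : ∀ x ∈ s, ∀ y ∈ p, ⁅x, y⁆ ∈ p := fun x hx y hy => ⟨s.lie_mem hx hy.1, h2 x hx y hy.1⟩
  obtain ⟨m, hm⟩ := chain_bot p (fun x hx y hy => hp x hx.1 y hy) (fun x hx => hx.2)
  have := main_ind s p (fun x hx => hx.1) hp (fun x hx => hx.2) S hS hSs m hm m 0 (by omega) 0
    (zero_mem _) (lie_zero _) N ⟨hN, hNn⟩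
  rwa [add_zero] at this

end
end JCAux

/-- **Theorem 1 (Cagliero–Szechtman).**
Let `s` be a solvable Lie subalgebra of `gl(n, F)` (where `F` has characteristic `0`) and let
`A ∈ s`.  If there exist `S, N ∈ s` with `A = S + N`, `S` semisimple and `N` nilpotent (not
assumed to commute), then the semisimple and nilpotent summands of the Jordan–Chevalley
decomposition of `A` belong to `s`. -/
theorem jordan_chevalley_summands_mem_of_solvable
    {F : Type*} [Field F] [CharZero F] {n : ℕ}
    (s : LieSubalgebra F (Matrix (Fin n) (Fin n) F))
    [LieAlgebra.IsSolvable s]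
    (A : Matrix (Fin n) (Fin n) F) (hA : A ∈ s)
    (S N : Matrix (Fin n) (Fin n) F) (hS : S ∈ s) (hN : N ∈ s)
    (hsum : A = S + N) (hSss : S.IsSemisimpleJC) (hNnil : IsNilpotent N) :
    ∃ As An : Matrix (Fin n) (Fin n) F,
      A = As + An ∧ As.IsSemisimpleJC ∧ IsNilpotent An ∧ Commute As An ∧
      As ∈ s ∧ An ∈ s := by
  subst hsum
  exact JCAux.main s S N hS hN hSss hNnil
end

section
/- Let F be a field of characteristic 0, let s be a solvable Lie subalgebra of gl(n,F), and let A ∈ s. Then the semisimple and nilpotent summands of the Jordan–Chevalley decomposition of A belong to s if and only if there exist S, N ∈ s such that S is semisimple, N is nilpotent and A = S + N. -/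
attribute [local instance 100] LieRing.ofAssociativeRing

/-- Invariant flag obtained by iterating the theorem of Lie -/
theorem JC.exists_flag {K L : Type*} [Field K] [IsAlgClosed K] [CharZero K] [LieRing L]
    [LieAlgebra K L] [LieAlgebra.IsSolvable L] (d : ℕ) :
    ∀ (V : Type _) [AddCommGroup V] [Module K V] [LieRingModule L V] [LieModule K L V]
    [Module.Finite K V], Module.finrank K V = d →
    ∃ W : ℕ → LieSubmodule K L V, W 0 = ⊥ ∧ W d = ⊤ ∧ (∀ i, W i ≤ W (i+1)) ∧
      ∀ x : L, IsNilpotent (LieModule.toEnd K L V x) → ∀ i, ∀ v ∈ W (i+1), ⁅x, v⁆ ∈ W i := by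
  induction d with
  | zero =>
    intro V _ _ _ _ _ h
    have : Subsingleton V := Module.finrank_zero_iff.mp h
    exact ⟨fun _ => ⊥, rfl, Subsingleton.elim _ _, fun _ => le_rfl, fun x _ i v _ => by
      rw [Subsingleton.elim ⁅x, v⁆ 0]; exact zero_mem _⟩
  | succ d ih =>
    intro V _ _ _ _ _ h
    have : Nontrivial V := Module.nontrivial_of_finrank_pos (R := K) (by omega)
    obtain ⟨χ, hχ⟩ := LieModule.exists_nontrivial_weightSpace_of_isSolvable K L V
    obtain ⟨⟨v, hv⟩, hv0⟩ := exists_ne (0 : LieModule.weightSpace V χ)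
    rw [LieModule.mem_weightSpace] at hv
    have hv0 : v ≠ 0 := by simpa using hv0
    let N : LieSubmodule K L V :=
      { toSubmodule := K ∙ v
        lie_mem := by
          intro x m hm
          obtain ⟨c, rfl⟩ := Submodule.mem_span_singleton.mp hm
          rw [lie_smul, hv]
          exact Submodule.smul_mem _ _ (Submodule.smul_mem _ _ (Submodule.mem_span_singleton_self v)) }
    have hq : Module.finrank K (V ⧸ N) = d := by
      have h1 := Submodule.finrank_quotient_add_finrank (K ∙ v)
      rw [finrank_span_singleton hv0, h] at h1
      have : Module.finrank K (V ⧸ N) = Module.finrank K (V ⧸ (K ∙ v)) := rfl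
      omega
    obtain ⟨W, h0, hd, hm, hn⟩ := ih (V ⧸ N) hq
    refine ⟨fun i => Nat.casesOn i ⊥ (fun j => (W j).comap (LieSubmodule.Quotient.mk' N)), rfl, ?_, ?_, ?_⟩
    · ext w; simp [hd]
    · rintro (_ | i)
      · exact bot_le
      · exact fun w hw => hm i hw
    · rintro x hx (_ | i) w hw
      · simp only [h0, LieSubmodule.mem_comap, LieSubmodule.mem_bot] at hw
        have hw' : w ∈ N := (LieSubmodule.Quotient.mk_eq_zero' ).mp hw
        obtain ⟨c, rfl⟩ := Submodule.mem_span_singleton.mp hw'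
        have : χ x = 0 := by
          obtain ⟨k, hk⟩ := hx
          have hp : ∀ k, ((LieModule.toEnd K L V x) ^ k) v = (χ x) ^ k • v := by
            intro k
            induction k with
            | zero => simp
            | succ k ih => rw [pow_succ', Module.End.mul_apply, ih]; simp [hv, smul_smul, pow_succ]
          have := hp k
          rw [hk] at this
          exact eq_zero_of_pow_eq_zero ((smul_eq_zero.mp this.symm).resolve_right hv0)
        simp [hv, this]
      · simp only [LieSubmodule.mem_comap] at hw ⊢
        rw [LieModuleHom.map_lie]
        refine hn x ?_ i _ hw
        obtain ⟨k, hk⟩ := hx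
        refine ⟨k, ?_⟩
        ext u
        obtain ⟨u, rfl⟩ := LieSubmodule.Quotient.surjective_mk' N u
        have hp : ∀ k, ((LieModule.toEnd K L (V ⧸ N) x) ^ k) (LieSubmodule.Quotient.mk' N u) =
          LieSubmodule.Quotient.mk' N (((LieModule.toEnd K L V x) ^ k) u) := by
            intro k
            induction k with
            | zero => simp
            | succ k ih => rw [pow_succ', Module.End.mul_apply, ih, pow_succ', Module.End.mul_apply]; simp
        rw [hp, hk]; simp

open TensorProduct in
theorem JC.exists_filtration {F L V : Type*} [Field F] [CharZero F] [LieRing L]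
    [LieAlgebra F L] [LieAlgebra.IsSolvable L] [AddCommGroup V] [Module F V] [LieRingModule L V]
    [LieModule F L V] [Module.Finite F V] :
    ∃ (U : ℕ → Submodule F (Module.End F V)) (m : ℕ), (∀ k, U (k+1) ≤ U k) ∧ U m = ⊥ ∧
      (∀ k l, ∀ x ∈ U k, ∀ y ∈ U l, x * y ∈ U (k + l)) ∧
      (∀ x : L, LieModule.toEnd F L V x ∈ U 0) ∧
      (∀ x : L, IsNilpotent (LieModule.toEnd F L V x) → LieModule.toEnd F L V x ∈ U 1) := by
  let K := AlgebraicClosure F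
  have : CharZero K := charZero_of_injective_algebraMap (algebraMap F K).injective
  have : LieAlgebra.IsSolvable (K ⊗[F] L) := inferInstance
  obtain ⟨W, h0, hd, hm, hn⟩ := JC.exists_flag (K := K) (L := K ⊗[F] L) _ (K ⊗[F] V) rfl
  have hmono : Monotone W := monotone_nat_of_le_succ hm
  refine ⟨fun k => 
    { carrier := {x | ∀ i, ∀ v ∈ W i, x.baseChange K v ∈ W (i - k)}
      add_mem' := fun {a b} ha hb i v hv => by
        rw [LinearMap.baseChange_add]; exact add_mem (ha i v hv) (hb i v hv)
      zero_mem' := fun i v hv => by simp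
      smul_mem' := fun c a ha i v hv => by
        rw [LinearMap.baseChange_smul, LinearMap.smul_apply, ← algebraMap_smul K c]
        exact (W _).smul_mem _ (ha i v hv) }, Module.finrank K (K ⊗[F] V), ?_, ?_, ?_, ?_, ?_⟩
  · intro k x hx i v hv
    exact hmono (by omega) (hx i v hv)
  · rw [eq_bot_iff]
    intro x hx
    have h1 : ∀ v, x.baseChange K v = 0 := fun v => by
      have := hx (Module.finrank K (K ⊗[F] V)) v (by rw [hd]; trivial)
      simpa [h0] using this
    rw [Submodule.mem_bot]
    ext v
    have h2 := h1 (1 ⊗ₜ v)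
    rw [LinearMap.baseChange_tmul] at h2
    have := (Module.FaithfullyFlat.tensorProduct_mk_injective (A := F) (B := K) V)
    exact this (by simpa using h2)
  · intro k l x hx y hy i v hv
    have := hx _ _ (hy i v hv)
    rw [Module.End.mul_eq_comp, LinearMap.baseChange_comp]
    rw [show i - (k + l) = i - l - k by omega]
    exact this
  · intro x i v hv
    rw [← LieModule.toEnd_baseChange]
    exact (W i).lie_mem hv
  · intro x hx i v hv
    rw [← LieModule.toEnd_baseChange]
    rcases i with _ | i
    · exact (W 0).lie_mem hv
    · refine hn _ ?_ i v hv
      rw [LieModule.toEnd_baseChange]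
      exact hx.map (Module.End.baseChangeHom F K V)

theorem JC.exp_mem {F M : Type*} [Field F] [CharZero F] [AddCommGroup M] [Module F M] [Module ℚ M]
    [SMulCommClass F ℚ M] [SMulCommClass ℚ F M]
    (p : Submodule F M) (D : Module.End F M) (hD : IsNilpotent D) (hp : ∀ z ∈ p, D z ∈ p) (z : M) (hz : D (D z) ∈ p) :
    IsNilpotent.exp D z - z - D z ∈ p := by
  obtain ⟨k, hk⟩ := hD
  have hk2 : D ^ (k+2) = 0 := by rw [pow_add, hk, zero_mul]
  rw [IsNilpotent.exp_eq_sum hk2, Finset.sum_range_succ', Finset.sum_range_succ']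
  have : ((∑ i ∈ Finset.range k, ((i + 1 + 1).factorial : ℚ)⁻¹ • D ^ (i + 1 + 1)) : Module.End F M) z ∈ p := by
    rw [LinearMap.sum_apply]
    refine Submodule.sum_mem _ fun i _ => ?_
    rw [LinearMap.smul_apply, ← Rat.cast_smul_eq_qsmul F]
    refine p.smul_mem _ ?_
    rw [pow_add, pow_add, pow_one, mul_assoc, Module.End.mul_apply]
    generalize hw : (D * D) z = w
    have hw : w ∈ p := by rw [← hw]; exact hz
    clear * - hw hp
    induction i with
    | zero => simpa
    | succ i ih => rw [pow_succ', Module.End.mul_apply]; exact hp _ ih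
  convert this using 1
  simp

theorem JC.exp_mem' {F M : Type*} [Field F] [CharZero F] [AddCommGroup M] [Module F M] [Module ℚ M]
    [SMulCommClass F ℚ M] [SMulCommClass ℚ F M]
    (p : Submodule F M) (D : Module.End F M) (hD : IsNilpotent D) (hp : ∀ z ∈ p, D z ∈ p) (z : M) (hz : z ∈ p) :
    IsNilpotent.exp D z ∈ p := by
  have := p.add_mem (p.add_mem (JC.exp_mem p D hD hp z (hp _ (hp _ hz))) (hp _ hz)) hz
  simpa using this

theorem JC.semisimple_decomp {F M : Type*} [Field F] [AddCommGroup M] [Module F M] [Module.Finite F M]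
    (T : Module.End F M) (hT : T.IsSemisimple) (p : Submodule F M) (hp : ∀ x ∈ p, T x ∈ p) (x : M) (hx : x ∈ p) :
    ∃ a ∈ p, ∃ y ∈ p, T a = 0 ∧ x = a + T y := by
  have hR := hT.restrict (p := p) hp
  set R := T.restrict hp with hRdef
  obtain ⟨q, hq, hc⟩ := Module.End.isSemisimple_iff.mp hR (LinearMap.ker R) (by
    intro z hz
    simp only [Submodule.mem_comap, LinearMap.mem_ker] at hz ⊢
    rw [hz, map_zero])
  have hq' : ∀ z ∈ q, R z ∈ q := hq
  have hinj : Function.Injective (R.restrict hq') := by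
    rw [injective_iff_map_eq_zero]
    intro z hz
    have h1 : (z : p) ∈ LinearMap.ker R := by
      have := congrArg Subtype.val hz
      simpa using this
    have := (Submodule.disjoint_def.mp hc.disjoint) _ h1 z.2
    exact Subtype.ext this
  have hsurj := LinearMap.injective_iff_surjective.mp hinj
  obtain ⟨a, ha, b, hb, hab⟩ := Submodule.mem_sup.mp
    (show (⟨x, hx⟩ : p) ∈ LinearMap.ker R ⊔ q by rw [hc.sup_eq_top]; trivial)
  obtain ⟨y, hy⟩ := hsurj ⟨b, hb⟩
  refine ⟨a, a.2, y.1, y.1.2, congrArg Subtype.val (LinearMap.mem_ker.mp ha), ?_⟩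
  have h2 := congrArg Subtype.val (congrArg Subtype.val hy)
  have h3 := congrArg Subtype.val hab
  simp [hRdef] at h2 h3
  rw [h2, h3]

theorem JC.ad_semisimple {F : Type*} [Field F] [CharZero F] {n : ℕ} (S : Matrix (Fin n) (Fin n) F)
    (hS : Squarefree (minpoly F S)) :
    Module.End.IsSemisimple (LinearMap.mulLeft F S - LinearMap.mulRight F S) := by
  apply Module.End.IsSemisimple.sub_of_commute
  · exact LinearMap.commute_mulLeft_right S S
  · apply Module.End.isSemisimple_of_squarefree_aeval_eq_zero hS
    have := Polynomial.aeval_algHom_apply (Algebra.lmul F (Matrix (Fin n) (Fin n) F)) S (minpoly F S)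
    rw [minpoly.aeval, map_zero] at this
    exact this
  · apply Module.End.isSemisimple_of_squarefree_aeval_eq_zero hS
    ext1 z
    have h : ∀ p : Polynomial F, (Polynomial.aeval (LinearMap.mulRight F S) p) z = z * Polynomial.aeval S p := by
      intro p
      induction p using Polynomial.induction_on' with
      | add p q hp hq => simp [hp, hq, mul_add]
      | monomial k c => simp [Polynomial.aeval_monomial, ← Algebra.smul_def]
    rw [h, minpoly.aeval]; simp

theorem JC.main {F : Type*} [Field F] [CharZero F] {n : ℕ}
    (s : LieSubalgebra F (Matrix (Fin n) (Fin n) F))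
    (U : ℕ → Submodule F (Matrix (Fin n) (Fin n) F)) (m : ℕ) (hU : ∀ k, U (k+1) ≤ U k)
    (hm : U m = ⊥) (hmul : ∀ k l, ∀ x ∈ U k, ∀ y ∈ U l, x * y ∈ U (k + l))
    (hs : ∀ x ∈ s, x ∈ U 0) (j : ℕ) : ∀ k, m ≤ k + j → ∀ S N X : Matrix (Fin n) (Fin n) F,
    S ∈ s → N ∈ s → X ∈ s → N ∈ U 1 → X ∈ U (k+1) → S * N = N * S → Squarefree (minpoly F S) →
    ∃ As An : Matrix (Fin n) (Fin n) F,
        S + N + X = As + An ∧ Squarefree (minpoly F As) ∧ IsNilpotent An ∧ Commute As An ∧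
        As ∈ s ∧ An ∈ s := by
  have hanti : Antitone U := antitone_nat_of_succ_le hU
  have hnil : ∀ x ∈ U 1, IsNilpotent x := by
    intro x hx
    have hp : ∀ i, x ^ (i+1) ∈ U (i+1) := by
      intro i
      induction i with
      | zero => simpa using hx
      | succ i ih => rw [pow_succ]; exact hmul _ _ _ ih _ hx
    refine ⟨m+1, ?_⟩
    have := hU m (hp m)
    simpa [hm] using this
  have hbr : ∀ k l, ∀ x ∈ U k, ∀ y ∈ U l, x * y - y * x ∈ U (k + l) := by
    intro k l x hx y hy
    refine sub_mem (hmul _ _ _ hx _ hy) ?_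
    rw [add_comm]; exact hmul _ _ _ hy _ hx
  have hsbr : ∀ x ∈ s, ∀ y ∈ s, x * y - y * x ∈ s := fun x hx y hy => s.lie_mem hx hy
  induction j with
  | zero =>
    intro k hk S N X hS hN hX hN1 hXk hc hsq
    have : X = 0 := by
      have := hanti (show m ≤ k+1 by omega) hXk
      simpa [hm] using this
    subst this
    exact ⟨S, N, by simp, hsq, hnil _ hN1, hc, hS, hN⟩
  | succ j ih =>
    intro k hk S N X hS hN hX hN1 hXk hc hsq
    obtain ⟨X0, hX0, Y, hY, hTX0, hXeq⟩ := JC.semisimple_decomp _ (JC.ad_semisimple S hsq)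
      (s.toSubmodule ⊓ U (k+1)) (fun x hx => ⟨hsbr _ hS _ hx.1, by
        have := hbr 0 (k+1) S (hs _ hS) x hx.2
        rw [zero_add] at this
        exact this⟩) X ⟨hX, hXk⟩
    simp only [LinearMap.sub_apply, LinearMap.mulLeft_apply, LinearMap.mulRight_apply] at hTX0 hXeq
    have hXs : X0 ∈ s := hX0.1
    have hYs : Y ∈ s := hY.1
    have hXU : X0 ∈ U (k+1) := hX0.2
    have hYU : Y ∈ U (k+1) := hY.2
    have hYn : IsNilpotent Y := hnil _ (hanti (by omega) hYU)
    let D : Module.End F (Matrix (Fin n) (Fin n) F) := LinearMap.mulLeft F Y - LinearMap.mulRight F Y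
    have hDa : ∀ z, D z = Y * z - z * Y := fun z => rfl
    have hD : IsNilpotent D := by
      apply Commute.isNilpotent_sub (LinearMap.commute_mulLeft_right Y Y)
      · exact (LinearMap.isNilpotent_mulLeft_iff F Y).mpr hYn
      · exact (LinearMap.isNilpotent_mulRight_iff F Y).mpr hYn
    have hmulE : ∀ E : Module.End F (Matrix (Fin n) (Fin n) F), IsNilpotent E →
        (∀ a b, E (a * b) = a * E b + E a * b) → ∀ a b,
        IsNilpotent.exp E (a * b) = IsNilpotent.exp E a * IsNilpotent.exp E b :=
      fun E hE h a b => Module.End.exp_mul_of_derivation F _ E h hE a b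
    have hder : ∀ a b, D (a * b) = a * D b + D a * b := by
      intro a b; simp only [hDa]; noncomm_ring
    have hE1 : ∀ z, IsNilpotent.exp (-D) (IsNilpotent.exp D z) = z := fun z => by
      rw [← Module.End.mul_apply, IsNilpotent.exp_neg_mul_exp_self hD]; rfl
    have hsD : ∀ z ∈ s.toSubmodule, D z ∈ s.toSubmodule := fun z hz => hsbr _ hYs _ hz
    have hUD : ∀ l, ∀ z ∈ U l, D z ∈ U (l + 1) := fun l z hz =>
      hanti (by omega) (hbr _ _ _ hYU _ hz)
    set A := S + N + X with hA
    have hAs : A ∈ s := add_mem (add_mem hS hN) hX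
    -- the transformed matrix
    let Z := IsNilpotent.exp D A - S - (N + X0)
    have hZs : Z ∈ s := sub_mem (sub_mem (JC.exp_mem' s.toSubmodule D hD hsD A hAs) hS)
      (add_mem hN hXs)
    have hZU : Z ∈ U (k+1+1) := by
      have h1 := JC.exp_mem (U (k+1+1)) D hD (fun z hz => hU _ (hUD _ z hz)) A (by
        apply hUD
        have := hbr (k+1) 0 Y hYU A (hs _ hAs)
        exact this)
      have h2 : D N ∈ U (k+1+1) := hbr _ _ _ hYU _ hN1
      have h3 : D X ∈ U (k+1+1) := hUD _ _ hXk
      have : Z = (IsNilpotent.exp D A - A - D A) + D N + D X := by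
        have h4 : D A = D S + D N + D X := by simp [hA]
        have h5 : A = S + N + (X0 + (S * Y - Y * S)) := by rw [hA, hXeq]
        rw [h4, hDa S]
        simp only [Z]
        nth_rewrite 3 [h5]
        abel
      rw [this]
      exact add_mem (add_mem h1 h2) h3
    obtain ⟨As, An, hsum, hsemi, hn, hcomm, hAs', hAn'⟩ := ih (k+1) (by omega) S (N + X0) Z hS
      (add_mem hN hXs) hZs (add_mem hN1 (hanti (by omega) hXU)) hZU
      (by rw [mul_add, add_mul, hc, sub_eq_zero.mp hTX0]) hsq
    have hexp : IsNilpotent.exp D A = As + An := by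
      rw [← hsum]; simp only [Z]; abel
    have hderneg : ∀ a b, (-D) (a * b) = a * (-D) b + (-D) a * b := by
      intro a b; simp only [LinearMap.neg_apply, hDa]; noncomm_ring
    have hDs' : ∀ z ∈ s.toSubmodule, (-D) z ∈ s.toSubmodule := fun z hz => neg_mem (hsD z hz)
    let φ : Matrix (Fin n) (Fin n) F →ₐ[F] Matrix (Fin n) (Fin n) F :=
      AlgHom.ofLinearMap (IsNilpotent.exp (-D)) (by
        have := JC.exp_mem ⊥ (-D) hD.neg (by simp) 1 (by simp [hDa])
        simpa [hDa, sub_eq_zero] using this) (hmulE _ hD.neg hderneg)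
    have hφ : ∀ z, φ z = IsNilpotent.exp (-D) z := fun z => rfl
    have hφinj : Function.Injective φ := by
      refine Function.LeftInverse.injective (g := ⇑(IsNilpotent.exp D : Module.End F _)) fun z => ?_
      rw [hφ, ← Module.End.mul_apply, IsNilpotent.exp_mul_exp_neg_self hD]; rfl
    refine ⟨φ As, φ An, ?_, ?_, hn.map φ, hcomm.map φ, ?_, ?_⟩
    · rw [← map_add, ← hexp, hφ, hE1]
    · rwa [minpoly.algHom_eq φ hφinj]
    · exact JC.exp_mem' s.toSubmodule _ hD.neg hDs' _ hAs'
    · exact JC.exp_mem' s.toSubmodule _ hD.neg hDs' _ hAn'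


/-- Let `s` be a solvable Lie subalgebra of `gl(n, F)` (where `F` has characteristic `0`) and let
`A ∈ s`.  Then the semisimple and nilpotent summands of the Jordan–Chevalley decomposition of `A`
belong to `s` if and only if there exist `S, N ∈ s` with `S` semisimple, `N` nilpotent and
`A = S + N`. -/
theorem jordan_chevalley_summands_mem_iff
    {F : Type*} [Field F] [CharZero F] {n : ℕ}
    (s : LieSubalgebra F (Matrix (Fin n) (Fin n) F))
    [LieAlgebra.IsSolvable s]
    (A : Matrix (Fin n) (Fin n) F) (hA : A ∈ s) :
    (∃ As An : Matrix (Fin n) (Fin n) F,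
        A = As + An ∧ As.IsSemisimpleJC ∧ IsNilpotent An ∧ Commute As An ∧
        As ∈ s ∧ An ∈ s) ↔
    (∃ S N : Matrix (Fin n) (Fin n) F,
        S ∈ s ∧ N ∈ s ∧ S.IsSemisimpleJC ∧ IsNilpotent N ∧ A = S + N) := by
  constructor
  · rintro ⟨As, An, h, h1, h2, -, h3, h4⟩
    exact ⟨As, An, h3, h4, h1, h2, h⟩
  · rintro ⟨S, N, hS, hN, hS', hN', rfl⟩
    let f : s →ₗ⁅F⁆ Module.End F (Fin n → F) :=
      (lieEquivMatrix' (R := F) (n := Fin n)).symm.toLieHom.comp s.incl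
    letI : LieRingModule s (Fin n → F) := LieRingModule.compLieHom (Fin n → F) f
    haveI : LieModule F s (Fin n → F) := LieModule.compLieHom (Fin n → F) f
    obtain ⟨U, m, h1, h2, h3, h4, h5⟩ := JC.exists_filtration (F := F) (L := s) (V := Fin n → F)
    let e : Matrix (Fin n) (Fin n) F ≃ₐ[F] Module.End F (Fin n → F) := Matrix.toLinAlgEquiv'
    have he : ∀ x : s, LieModule.toEnd F s (Fin n → F) x = e x := fun x => rfl
    obtain ⟨As, An, h⟩ := JC.main s (fun k => (U k).comap e.toLinearMap) m
      (fun k x hx => h1 k hx)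
      (by
        rw [eq_bot_iff]
        intro x hx
        have hx : e x ∈ U m := hx
        rw [h2, Submodule.mem_bot] at hx
        exact (map_eq_zero_iff e e.injective).mp hx)
      (fun k l x hx y hy => by
        have : e x * e y ∈ U (k + l) := h3 k l _ hx _ hy
        rw [← map_mul] at this
        exact this)
      (fun x hx => h4 ⟨x, hx⟩) m 0 (by omega) S 0 N hS (zero_mem _) hN (zero_mem _)
      (h5 ⟨N, hN⟩ (by rw [he]; exact hN'.map e)) (by simp) hS'
    rw [add_zero] at h
    exact ⟨As, An, h⟩
end

section
/- Let F be an algebraically closed field of characteristic 0 and let A ∈ gl(n,F) be written as A = S + N with S semisimple and N nilpotent (not necessarily commuting). If the Lie subalgebra s of gl(n,F) generated by the set {S, N} is solvable, then the semisimple summand and the nilpotent summand of the Jordan–Chevalley decomposition of A both belong to s. -/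
/-- A square matrix is *diagonalizable* over `F` if it is similar over `F` to a diagonal
matrix. -/
def Matrix.IsDiagonalizable {F : Type*} [Field F] {n : ℕ}
    (A : Matrix (Fin n) (Fin n) F) : Prop :=
  ∃ (P : GL (Fin n) F) (d : Fin n → F),
    A = (P : Matrix (Fin n) (Fin n) F) * Matrix.diagonal d * ((P⁻¹ : GL (Fin n) F) : Matrix (Fin n) (Fin n) F)

attribute [local instance 100] LieRing.ofAssociativeRing

namespace JCAux

open Finset

/-- The exponential conjugation formula. -/
lemma exp_conj {R : Type*} [Ring R] [Algebra ℚ R] (M : R) (hM : IsNilpotent M) :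
    ∃ k : ℕ, 2 ≤ k ∧ ∀ x : R,
      IsNilpotent.exp M * x * IsNilpotent.exp (-M) =
        ∑ i ∈ range k, (i.factorial : ℚ)⁻¹ • (((fun y => M * y - y * M)^[i]) x) := by
  obtain ⟨m, hm⟩ := hM
  have hm' : (-M) ^ m = 0 := by rw [neg_pow, hm, mul_zero]
  have hL : (LinearMap.mulLeft ℚ M) ^ m = 0 := by
    rw [LinearMap.pow_mulLeft, hm, LinearMap.mulLeft_zero_eq_zero]
  have hR : (LinearMap.mulRight ℚ (-M)) ^ m = 0 := by
    rw [LinearMap.pow_mulRight, hm', LinearMap.mulRight_zero_eq_zero]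
  have hc : Commute (LinearMap.mulLeft ℚ M) (LinearMap.mulRight ℚ (-M)) :=
    LinearMap.commute_mulLeft_right M (-M)
  have hadd := IsNilpotent.exp_add_of_commute hc ⟨m, hL⟩ ⟨m, hR⟩
  obtain ⟨k, hk⟩ := hc.isNilpotent_add ⟨m, hL⟩ ⟨m, hR⟩
  have hk2 := pow_eq_zero_of_le (show k ≤ k + 2 by omega) hk
  refine ⟨k + 2, by omega, fun x => ?_⟩
  have h1 : IsNilpotent.exp M * x * IsNilpotent.exp (-M) =
      (IsNilpotent.exp (LinearMap.mulLeft ℚ M) * IsNilpotent.exp (LinearMap.mulRight ℚ (-M))) x := by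
    rw [IsNilpotent.exp_eq_sum hL, IsNilpotent.exp_eq_sum hR, IsNilpotent.exp_eq_sum hm,
      IsNilpotent.exp_eq_sum hm']
    simp [LinearMap.pow_mulLeft, LinearMap.pow_mulRight, mul_sum, sum_mul, mul_assoc]
  rw [h1, ← hadd, IsNilpotent.exp_eq_sum hk2, LinearMap.sum_apply]
  refine sum_congr rfl fun i _ => ?_
  rw [LinearMap.smul_apply, Module.End.pow_apply]
  congr 2
  funext y
  simp [sub_eq_add_neg]

lemma core {F R : Type*} [Field F] [CharZero F] [Ring R] [Algebra F R] [Algebra ℚ R]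
    (s : Submodule F R) (hs : ∀ x ∈ s, ∀ y ∈ s, x * y - y * x ∈ s)
    (J : ℕ → Submodule F R) (hJ : ∀ k l x y, x ∈ J k → y ∈ J l → x * y ∈ J (k + l))
    (hanti : Antitone J) (m : ℕ) (hm : J m = ⊥) (h0 : s ≤ J 0)
    (S : R) (hS : S ∈ s)
    (hdec : ∀ W : Submodule F R, (∀ x ∈ W, S * x - x * S ∈ W) → ∀ x ∈ W,
      ∃ M ∈ W, S * (x - (S * M - M * S)) = (x - (S * M - M * S)) * S) :
    ∀ d k, m ≤ k + d → 1 ≤ k → ∀ N₀ ∈ s ⊓ J 1, S * N₀ = N₀ * S → ∀ N₂ ∈ s ⊓ J k,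
      ∃ g : Rˣ, (∀ x ∈ s, (g : R) * x * (↑g⁻¹ : R) ∈ s) ∧
        ∃ N' ∈ s ⊓ J 1, S * N' = N' * S ∧ S + N₀ + N₂ = g * (S + N') * (↑g⁻¹ : R) := by
  have hJs : ∀ k l x y, x ∈ s ⊓ J k → y ∈ s ⊓ J l → x * y - y * x ∈ s ⊓ J (k + l) := by
    intro k l x y hx hy
    refine ⟨hs x hx.1 y hy.1, sub_mem (hJ _ _ _ _ hx.2 hy.2) ?_⟩
    rw [add_comm]
    exact hJ _ _ _ _ hy.2 hx.2
  have hq : ∀ (W : Submodule F R) (q : ℚ) (x : R), x ∈ W → q • x ∈ W := by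
    intro W q x hx
    rw [← Rat.cast_smul_eq_qsmul F q x]
    exact W.smul_mem _ hx
  intro d
  induction d with
  | zero =>
    intro k hk hk1 N₀ hN₀ hc N₂ hN₂
    have : N₂ = 0 := by
      have := hanti (show m ≤ k by omega) hN₂.2
      rwa [hm, Submodule.mem_bot] at this
    exact ⟨1, by simp, N₀, hN₀, hc, by simp [this]⟩
  | succ d ih =>
    intro k hk hk1 N₀ hN₀ hc N₂ hN₂
    have hSJ : S ∈ s ⊓ J 0 := ⟨hS, h0 hS⟩
    obtain ⟨M, hM, hMc⟩ := hdec (s ⊓ J k)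
      (fun x hx => by simpa using hJs 0 k S x hSJ hx) N₂ hN₂
    set Z := N₂ - (S * M - M * S) with hZ
    have hZmem : Z ∈ s ⊓ J k := sub_mem hN₂ (by simpa using hJs 0 k S M hSJ hM)
    have hMpow : ∀ j, M ^ (j + 1) ∈ J (j + 1) := by
      intro j
      induction j with
      | zero => simpa using hanti hk1 hM.2
      | succ j ihj =>
        rw [pow_succ]
        exact hJ _ _ _ _ ihj (hanti hk1 hM.2)
    have hMnil : IsNilpotent M := by
      refine ⟨m + 1, ?_⟩
      have := hanti (show m ≤ m + 1 by omega) (hMpow m)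
      rwa [hm, Submodule.mem_bot] at this
    obtain ⟨K, hK2, hK⟩ := exp_conj M hMnil
    obtain ⟨K', hK2', hK'⟩ := exp_conj (-M) hMnil.neg
    have hit : ∀ M ∈ s, ∀ i, ∀ x ∈ s, ((fun y => M * y - y * M)^[i]) x ∈ s := by
      intro M hM i
      induction i with
      | zero => intro x hx; simpa using hx
      | succ i ihi =>
        intro x hx
        rw [Function.iterate_succ_apply]
        exact ihi _ (hs _ hM _ hx)
    let g : Rˣ := ⟨IsNilpotent.exp M, IsNilpotent.exp (-M),
      IsNilpotent.exp_mul_exp_neg_self hMnil, IsNilpotent.exp_neg_mul_exp_self hMnil⟩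
    have hgi : ∀ x ∈ s, (↑g⁻¹ : R) * x * (g : R) ∈ s := by
      intro x hx
      have := hK' x
      rw [neg_neg] at this
      change IsNilpotent.exp (-M) * x * IsNilpotent.exp M ∈ s
      rw [this]
      exact sum_mem fun i _ => hq _ _ _ (hit _ (neg_mem hM.1) _ _ hx)
    -- the remainder term
    set A := S + N₀ + N₂ with hA
    have hAs : A ∈ s ⊓ J 0 := add_mem (add_mem hSJ ⟨hN₀.1, h0 hN₀.1⟩) ⟨hN₂.1, h0 hN₂.1⟩
    have hit2 : ∀ i, ((fun y => M * y - y * M)^[i + 2]) A ∈ s ⊓ J (k + 1) := by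
      intro i
      induction i with
      | zero =>
        have h1 := hJs _ _ _ _ hM (hJs _ _ _ _ hM hAs)
        exact ⟨h1.1, hanti (by omega) h1.2⟩
      | succ i ihi =>
        rw [show i + 1 + 2 = (i + 2) + 1 by ring, Function.iterate_succ_apply']
        have h1 := hJs _ _ _ _ hM ihi
        exact ⟨h1.1, hanti (by omega) h1.2⟩
    obtain ⟨E, hE, hgA⟩ : ∃ E ∈ s ⊓ J (k + 1), (g : R) * A * (↑g⁻¹ : R) = A + (M * A - A * M) + E := by
      obtain ⟨r, rfl⟩ := Nat.exists_eq_add_of_le hK2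
      refine ⟨∑ i ∈ range r, ((i + 2).factorial : ℚ)⁻¹ • (((fun y => M * y - y * M)^[i + 2]) A),
        sum_mem fun i _ => hq _ _ _ (hit2 i), ?_⟩
      change IsNilpotent.exp M * A * IsNilpotent.exp (-M) = _
      rw [hK A, add_comm 2 r, sum_range_succ', sum_range_succ']
      simp
      abel
    have hB : (M * N₀ - N₀ * M) + (M * N₂ - N₂ * M) + E ∈ s ⊓ J (k + 1) := by
      refine add_mem (add_mem (hJs _ _ _ _ hM hN₀) ?_) hE
      have h1 := hJs _ _ _ _ hM hN₂
      exact ⟨h1.1, hanti (by omega) h1.2⟩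
    have hZ1 : N₀ + Z ∈ s ⊓ J 1 := add_mem hN₀ ⟨hZmem.1, hanti hk1 hZmem.2⟩
    obtain ⟨h, hh, N', hN', hcN', heq⟩ := ih (k + 1) (by omega) (by omega) (N₀ + Z) hZ1
      (by rw [mul_add, add_mul, hc, hMc]) _ hB
    refine ⟨g⁻¹ * h, ?_, N', hN', hcN', ?_⟩
    · intro x hx
      have := hgi _ (hh x hx)
      simpa [mul_assoc] using this
    · have h2 : (g : R) * A * (↑g⁻¹ : R) = h * (S + N') * (↑h⁻¹ : R) := by
        rw [← heq, hgA, hZ, hA]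
        noncomm_ring
      have h3 : A = (↑g⁻¹ : R) * ((g : R) * A * (↑g⁻¹ : R)) * g := by
        simp [mul_assoc]
      rw [h3, h2]
      simp [mul_assoc]

lemma flag (F : Type*) [Field F] [CharZero F] [IsAlgClosed F] (L : Type*) [LieRing L]
    [LieAlgebra F L] [LieAlgebra.IsSolvable L] (N : L) : ∀ (d : ℕ) (V : Type*) [AddCommGroup V]
    [Module F V] [FiniteDimensional F V] [LieRingModule L V] [LieModule F L V],
    Module.finrank F V ≤ d → (∃ k : ℕ, ∀ v : V, ((fun w => ⁅N, w⁆)^[k]) v = 0) →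
    ∃ U : ℕ → LieSubmodule F L V, Monotone U ∧ U 0 = ⊥ ∧ (∃ m, U m = ⊤) ∧
      ∀ i, ∀ v ∈ U (i + 1), ⁅N, v⁆ ∈ U i := by
  intro d
  induction d with
  | zero =>
    intro V _ _ _ _ _ hd _
    have : Subsingleton V := Module.finrank_zero_iff (R := F).mp (by omega)
    refine ⟨fun _ => ⊥, fun _ _ _ => le_rfl, rfl, ⟨0, ?_⟩, ?_⟩
    · exact Subsingleton.elim _ _
    · intro i v hv
      rw [Subsingleton.elim v 0]
      simp
  | succ d ih =>
    intro V _ _ _ _ _ hd hN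
    rcases subsingleton_or_nontrivial V with hV | hV
    · exact ih V (by rw [Module.finrank_zero_of_subsingleton]; omega) hN
    obtain ⟨χ, hχ⟩ := LieModule.exists_nontrivial_weightSpace_of_isSolvable F L V
    obtain ⟨⟨v, hv⟩, hv0⟩ := exists_ne (0 : LieModule.weightSpace V χ)
    have hv0 : v ≠ 0 := fun h => hv0 (by ext; exact h)
    rw [LieModule.mem_weightSpace] at hv
    obtain ⟨k, hk⟩ := hN
    have hit : ∀ j, ((fun w => ⁅N, w⁆)^[j]) v = (χ N) ^ j • v := by
      intro j
      induction j with
      | zero => simp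
      | succ j ihj => rw [Function.iterate_succ_apply', ihj, lie_smul, hv, smul_smul, pow_succ]
    have hχN : χ N = 0 := by
      have := hk v
      rw [hit, smul_eq_zero] at this
      exact eq_zero_of_pow_eq_zero (this.resolve_right hv0)
    let P : LieSubmodule F L V :=
      { F ∙ v with
        lie_mem := by
          intro x w hw
          obtain ⟨c, rfl⟩ := Submodule.mem_span_singleton.mp hw
          rw [lie_smul, hv]
          exact Submodule.smul_mem _ _ (Submodule.smul_mem _ _ (Submodule.mem_span_singleton_self v)) }
    have hP : ∀ w ∈ P, ⁅N, w⁆ = 0 := by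
      intro w hw
      obtain ⟨c, rfl⟩ := Submodule.mem_span_singleton.mp hw
      rw [lie_smul, hv, hχN]
      simp
    have hfr : Module.finrank F (V ⧸ P) ≤ d := by
      have h1 := Submodule.finrank_quotient_add_finrank P.toSubmodule
      have h2 : Module.finrank F P.toSubmodule = 1 := finrank_span_singleton hv0
      have h3 : Module.finrank F (V ⧸ P) = Module.finrank F (V ⧸ P.toSubmodule) := rfl
      omega
    have : FiniteDimensional F (V ⧸ P) := inferInstanceAs (FiniteDimensional F (V ⧸ P.toSubmodule))
    let π := LieSubmodule.Quotient.mk' P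
    obtain ⟨U, hU, hU0, ⟨m, hUm⟩, hUN⟩ := ih (V ⧸ P) hfr ⟨k, by
      intro w
      obtain ⟨w, rfl⟩ := LieSubmodule.Quotient.surjective_mk' P w
      have : ∀ j, ((fun w => ⁅N, w⁆)^[j]) (π w) = π (((fun w => ⁅N, w⁆)^[j]) w) := by
        intro j
        induction j with
        | zero => rfl
        | succ j ihj => rw [Function.iterate_succ_apply', Function.iterate_succ_apply', ihj,
            LieModuleHom.map_lie]
      rw [this, hk, map_zero]⟩
    refine ⟨fun i => Nat.casesOn i ⊥ (fun i => (U i).comap π), ?_, rfl, ⟨m + 1, ?_⟩, ?_⟩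
    · refine monotone_nat_of_le_succ fun i => ?_
      cases i with
      | zero => exact bot_le
      | succ i => 
        intro w hw
        exact hU (Nat.le_succ i) hw
    · rw [eq_top_iff]
      intro w _
      change π w ∈ U m
      rw [hUm]
      trivial
    · intro i w hw
      cases i with
      | zero =>
        change π w ∈ U 0 at hw
        rw [hU0, LieSubmodule.mem_bot] at hw
        change ⁅N, w⁆ ∈ (⊥ : LieSubmodule F L V)
        rw [LieSubmodule.mem_bot]
        exact hP w ((LieSubmodule.Quotient.mk_eq_zero P).mp hw)
      | succ i =>
        change π ⁅N, w⁆ ∈ U i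
        rw [LieModuleHom.map_lie]
        exact hUN i _ hw

lemma decomp {F : Type*} [Field F] {n : ℕ} (S : Matrix (Fin n) (Fin n) F)
    (hS : S.IsDiagonalizable) (W : Submodule F (Matrix (Fin n) (Fin n) F))
    (hW : ∀ x ∈ W, S * x - x * S ∈ W) (x : Matrix (Fin n) (Fin n) F) (hx : x ∈ W) :
    ∃ M ∈ W, S * (x - (S * M - M * S)) = (x - (S * M - M * S)) * S := by
  classical
  obtain ⟨P, d, rfl⟩ := hS
  set S := (P : Matrix (Fin n) (Fin n) F) * Matrix.diagonal d *
    ((P⁻¹ : GL (Fin n) F) : Matrix (Fin n) (Fin n) F) with hSdef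
  let f : Module.End F (Matrix (Fin n) (Fin n) F) :=
    LinearMap.mulLeft F S - LinearMap.mulRight F S
  have hf : ∀ y, f y = S * y - y * S := fun y => rfl
  let T : Finset F := (univ : Finset (Fin n × Fin n)).image (fun p => d p.1 - d p.2)
  let a : Polynomial F := Lagrange.interpolate T id (fun c => c⁻¹)
  have ha : ∀ i j, a.eval (d i - d j) = (d i - d j)⁻¹ := by
    intro i j
    exact Lagrange.eval_interpolate_at_node (s := T) (v := id) (fun c => c⁻¹)
      (Function.injective_id.injOn) (mem_image.mpr ⟨(i, j), mem_univ _, rfl⟩)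
  have hmem : ∀ (q : Polynomial F), ∀ y ∈ W, Polynomial.aeval f q y ∈ W := by
    intro q
    induction q using Polynomial.induction_on' with
    | add p q hp hq => intro y hy; rw [map_add]; exact add_mem (hp y hy) (hq y hy)
    | monomial k c =>
      intro y hy
      have hk : ∀ k, (f ^ k) y ∈ W := by
        intro k
        induction k with
        | zero => simpa using hy
        | succ k ihk => rw [pow_succ', Module.End.mul_apply, hf]; exact hW _ ihk
      rw [Polynomial.aeval_monomial, Module.End.mul_apply, Module.algebraMap_end_apply]
      exact W.smul_mem _ (hk k)
  have key : ∀ y, f (y - f (Polynomial.aeval f a y)) = 0 := by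
    have key' : ∀ z : Matrix (Fin n) (Fin n) F, 
        (f ∘ₗ (LinearMap.id - f ∘ₗ Polynomial.aeval f a)) (P * z * (↑P⁻¹ : Matrix (Fin n) (Fin n) F)) = 0 := by
      intro z
      induction z using Matrix.induction_on' with
      | h_zero => simp
      | h_add p q hp hq => rw [mul_add, add_mul, map_add, hp, hq, add_zero]
      | h_std_basis i j c =>
        set v := (P : Matrix (Fin n) (Fin n) F) * Matrix.single i j c * (↑P⁻¹ : Matrix (Fin n) (Fin n) F)
        have hv : f v = (d i - d j) • v := by
          have h1 : Matrix.diagonal d * Matrix.single i j c = d i • Matrix.single i j c := by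
            ext p q
            simp only [Matrix.diagonal_mul, Matrix.mul_diagonal, Matrix.smul_apply, smul_eq_mul, Matrix.single_apply]
            split_ifs with h
            · rw [h.1]
            · simp
          have h2 : Matrix.single i j c * Matrix.diagonal d = d j • Matrix.single i j c := by
            ext p q
            simp only [Matrix.diagonal_mul, Matrix.mul_diagonal, Matrix.smul_apply, smul_eq_mul, Matrix.single_apply]
            split_ifs with h
            · rw [h.2, mul_comm]
            · simp
          have h3 : S * v = P * (Matrix.diagonal d * Matrix.single i j c) * (↑P⁻¹ : Matrix (Fin n) (Fin n) F) := by
            simp only [hSdef, v, mul_assoc, Units.inv_mul_cancel_left]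
          have h4 : v * S = P * (Matrix.single i j c * Matrix.diagonal d) * (↑P⁻¹ : Matrix (Fin n) (Fin n) F) := by
            simp only [hSdef, v, mul_assoc, Units.inv_mul_cancel_left]
          rw [hf, h3, h4, h1, h2]
          rw [mul_smul_comm, mul_smul_comm, smul_mul_assoc, smul_mul_assoc, sub_smul]
        have hav := Module.End.aeval_apply_of_mem_apply_eq_smul (p := a) hv
        simp only [LinearMap.comp_apply, LinearMap.sub_apply, LinearMap.id_apply, hav, map_sub,
          map_smul, hv, ha, smul_smul]
        rw [← sub_smul]
        by_cases h : d i - d j = 0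
        · simp [h]
        · field_simp
          simp
    intro y
    have := key' ((↑P⁻¹ : Matrix (Fin n) (Fin n) F) * y * P)
    simpa [mul_assoc] using this
  refine ⟨Polynomial.aeval f a x, hmem a x hx, ?_⟩
  have := key x
  rw [hf (Polynomial.aeval f a x), hf, sub_eq_zero] at this
  exact this

end JCAux

/-- **Theorem 2 (Cagliero–Szechtman).**
Over an algebraically closed field of characteristic `0`, if `A = S + N` with `S` semisimple
(i.e. diagonalizable) and `N` nilpotent (not necessarily commuting), and the Lie subalgebra
generated by `{S, N}` is solvable, then both summands of the Jordan–Chevalley decomposition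
of `A` belong to this Lie subalgebra. -/
theorem jordan_chevalley_summands_mem_lieSpan
    {F : Type*} [Field F] [CharZero F] [IsAlgClosed F] {n : ℕ}
    (S N : Matrix (Fin n) (Fin n) F)
    (hS : S.IsDiagonalizable) (hN : IsNilpotent N)
    (hsolv : LieAlgebra.IsSolvable
      (LieSubalgebra.lieSpan F (Matrix (Fin n) (Fin n) F) {S, N})) :
    ∃ As An : Matrix (Fin n) (Fin n) F,
      S + N = As + An ∧ As.IsDiagonalizable ∧ IsNilpotent An ∧ Commute As An ∧
      As ∈ LieSubalgebra.lieSpan F (Matrix (Fin n) (Fin n) F) {S, N} ∧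
      An ∈ LieSubalgebra.lieSpan F (Matrix (Fin n) (Fin n) F) {S, N} := by
  set s := LieSubalgebra.lieSpan F (Matrix (Fin n) (Fin n) F) {S, N} with hs
  have hSs : S ∈ s := LieSubalgebra.subset_lieSpan (by simp)
  have hNs : N ∈ s := LieSubalgebra.subset_lieSpan (by simp)
  have hbr : ∀ (x : s) (v : Fin n → F), ⁅x, v⁆ = (x : Matrix (Fin n) (Fin n) F).mulVec v :=
    fun x v => rfl
  obtain ⟨U, hU, hU0, ⟨m, hUm⟩, hUN⟩ := JCAux.flag F s ⟨N, hNs⟩ _ (Fin n → F) le_rfl (by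
    obtain ⟨k, hk⟩ := hN
    refine ⟨k, fun v => ?_⟩
    have : ∀ j, ((fun w => ⁅(⟨N, hNs⟩ : s), w⁆)^[j]) v = (N ^ j).mulVec v := by
      intro j
      induction j with
      | zero => simp
      | succ j ihj => rw [Function.iterate_succ_apply', ihj, hbr, Matrix.mulVec_mulVec, pow_succ']
    rw [this, hk, Matrix.zero_mulVec])
  let J : ℕ → Submodule F (Matrix (Fin n) (Fin n) F) := fun k =>
    { carrier := {x | ∀ i, ∀ v ∈ U (i + k), x.mulVec v ∈ U i}
      add_mem' := by
        intro x y hx hy i v hv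
        rw [Matrix.add_mulVec]
        exact add_mem (hx i v hv) (hy i v hv)
      zero_mem' := by
        intro i v hv
        rw [Matrix.zero_mulVec]
        exact zero_mem _
      smul_mem' := by
        intro c x hx i v hv
        rw [Matrix.smul_mulVec]
        exact (U i).smul_mem c (hx i v hv) }
  have hJ : ∀ k l x y, x ∈ J k → y ∈ J l → x * y ∈ J (k + l) := by
    intro k l x y hx hy i v hv
    rw [← Matrix.mulVec_mulVec]
    exact hx i _ (hy (i + k) v (by rwa [add_assoc]))
  have hanti : Antitone J := by
    intro k l hkl x hx i v hv
    exact hx i v (hU (by omega) hv)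
  have hm : J m = ⊥ := by
    rw [eq_bot_iff]
    intro x hx
    rw [Submodule.mem_bot]
    refine Matrix.ext_of_mulVec_single fun j => ?_
    have := hx 0 (Pi.single j 1) (by rw [zero_add, hUm]; trivial)
    rw [hU0, LieSubmodule.mem_bot] at this
    rw [this, Matrix.zero_mulVec]
  have h0 : s.toSubmodule ≤ J 0 := by
    intro x hx i v hv
    exact (U i).lie_mem (x := (⟨x, hx⟩ : s)) hv
  have hN1 : N ∈ s.toSubmodule ⊓ J 1 := ⟨hNs, fun i v hv => hUN i v hv⟩
  obtain ⟨g, hg, N', hN', hc, heq⟩ := JCAux.core s.toSubmodule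
    (fun x hx y hy => s.lie_mem hx hy) J hJ hanti m hm h0 S hSs
    (fun W hW x hx => JCAux.decomp S hS W hW x hx) m 1 (by omega) le_rfl 0 (zero_mem _) (by simp)
    N hN1
  have hpow : ∀ j, N' ^ (j + 1) ∈ J (j + 1) := by
    intro j
    induction j with
    | zero => simpa using hN'.2
    | succ j ihj =>
      rw [pow_succ]
      exact hJ _ _ _ _ ihj hN'.2
  have hN'nil : N' ^ (m + 1) = 0 := by
    have := hanti (show m ≤ m + 1 by omega) (hpow m)
    rwa [hm, Submodule.mem_bot] at this
  refine ⟨g * S * (↑g⁻¹ : Matrix (Fin n) (Fin n) F), g * N' * (↑g⁻¹ : Matrix (Fin n) (Fin n) F),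
    ?_, ?_, ?_, ?_, hg _ hSs, hg _ hN'.1⟩
  · rw [add_zero] at heq
    rw [heq, mul_add, add_mul]
  · obtain ⟨P, d, hP⟩ := hS
    refine ⟨g * P, d, ?_⟩
    rw [hP, mul_inv_rev, Units.val_mul, Units.val_mul]
    simp only [mul_assoc]
  · refine ⟨m + 1, ?_⟩
    rw [Units.conj_pow, hN'nil, mul_zero, zero_mul]
  · rw [Commute, SemiconjBy]
    simp only [mul_assoc, Units.inv_mul_cancel_left]
    rw [← mul_assoc S, hc, mul_assoc]
end

section
/- Let F be a field of characteristic 0, let t denote the Lie algebra of upper triangular n×n matrices over F, and let s be a Lie subalgebra of t. Let S, X, N ∈ s, let λ, μ ∈ F with μ ≠ 0, and assume [S,N] = λN and [S,X] = μX (so that X is strictly upper triangular and ad(X) is nilpotent). Then the matrix E = Σ_{j=0}^{n-1} (μ^{-j}/j!) · ad(X)^j(N) belongs to s and satisfies [S − X, E] = λE. -/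
attribute [local instance 100] LieRing.ofAssociativeRing

theorem upper_band_lie {F : Type*} [Field F] {n : ℕ} (X Y : Matrix (Fin n) (Fin n) F) (j : ℕ)
    (hX : ∀ a b : Fin n, (b : ℕ) < a + 1 → X a b = 0)
    (hY : ∀ a b : Fin n, (b : ℕ) < a + j → Y a b = 0) :
    ∀ a b : Fin n, (b : ℕ) < a + (j + 1) → ⁅X, Y⁆ a b = 0 := by
  intro a b hab
  rw [Ring.lie_def, Matrix.sub_apply, Matrix.mul_apply, Matrix.mul_apply,
    Finset.sum_eq_zero, Finset.sum_eq_zero, sub_zero]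
  · intro c _
    by_cases h : (c : ℕ) < a + j
    · rw [hY a c h, zero_mul]
    · rw [hX c b (by omega), mul_zero]
  · intro c _
    by_cases h : (c : ℕ) < a + 1
    · rw [hX a c h, zero_mul]
    · rw [hY c b (by omega), mul_zero]

theorem lie_diag_zero {F : Type*} [Field F] {n : ℕ} (A B : Matrix (Fin n) (Fin n) F)
    (hA : A.BlockTriangular (id : Fin n → Fin n)) (hB : B.BlockTriangular (id : Fin n → Fin n))
    (a : Fin n) : ⁅A, B⁆ a a = 0 := by
  have key : ∀ A B : Matrix (Fin n) (Fin n) F, A.BlockTriangular (id : Fin n → Fin n) →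
      B.BlockTriangular (id : Fin n → Fin n) → (A * B) a a = A a a * B a a := by
    intro A B hA hB
    rw [Matrix.mul_apply]
    apply Finset.sum_eq_single a
    · intro c _ hc
      rcases lt_or_gt_of_ne hc with h | h
      · rw [hA (i := a) (j := c) h, zero_mul]
      · rw [hB (i := c) (j := a) h, mul_zero]
    · simp
  rw [Ring.lie_def, Matrix.sub_apply, key A B hA hB, key B A hB hA, mul_comm, sub_self]

open Finset in
/-- **Lemma 2.1 (Cagliero–Szechtman).**
Let `s` be a Lie subalgebra of the Lie algebra of upper triangular `n × n` matrices over a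
field `F` of characteristic `0`.  Let `S, X, N ∈ s` with `[S, N] = λ • N` and `[S, X] = μ • X`
for some `μ ≠ 0`.  Then `E = ∑_{j=0}^{n-1} (μ⁻ʲ / j!) • ad(X)ʲ(N)` belongs to `s` and satisfies
`[S - X, E] = λ • E`. -/
theorem exp_ad_eigenmatrix
    {F : Type*} [Field F] [CharZero F] {n : ℕ}
    (s : LieSubalgebra F (Matrix (Fin n) (Fin n) F))
    (hs : ∀ A ∈ s, A.BlockTriangular (id : Fin n → Fin n))
    (S X N : Matrix (Fin n) (Fin n) F)
    (hS : S ∈ s) (hX : X ∈ s) (hN : N ∈ s)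
    (lam mu : F) (hmu : mu ≠ 0)
    (hadN : ⁅S, N⁆ = lam • N) (hadX : ⁅S, X⁆ = mu • X) :
    (∑ j ∈ range n, ((mu⁻¹ ^ j / (j.factorial : F)) •
        (fun Y => ⁅X, Y⁆)^[j] N)) ∈ s ∧
    ⁅S - X, ∑ j ∈ range n, ((mu⁻¹ ^ j / (j.factorial : F)) •
        (fun Y => ⁅X, Y⁆)^[j] N)⁆ =
      lam • ∑ j ∈ range n, ((mu⁻¹ ^ j / (j.factorial : F)) •
        (fun Y => ⁅X, Y⁆)^[j] N) := by
  have hYs : ∀ j, (fun Y => ⁅X, Y⁆)^[j] N ∈ s := by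
    intro j
    induction j with
    | zero => exact hN
    | succ j ih =>
      rw [Function.iterate_succ_apply']
      exact s.lie_mem hX ih
  refine ⟨sum_mem fun j _ => s.smul_mem _ (hYs j), ?_⟩
  have hXs : ∀ a b : Fin n, (b : ℕ) < a + 1 → X a b = 0 := by
    intro a b hab
    rcases (Nat.lt_succ_iff.mp hab).lt_or_eq with h | h
    · exact hs X hX (i := a) (j := b) h
    · have h' : b = a := Fin.ext h
      subst h'
      have h1 := lie_diag_zero S X (hs S hS) (hs X hX) b
      rw [hadX, Matrix.smul_apply, smul_eq_mul] at h1
      exact (mul_eq_zero.mp h1).resolve_left hmu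
  have hband : ∀ j, ∀ a b : Fin n, (b : ℕ) < a + j → ((fun Y => ⁅X, Y⁆)^[j] N) a b = 0 := by
    intro j
    induction j with
    | zero => exact fun a b h => hs N hN (i := a) (j := b) h
    | succ j ih =>
      rw [Function.iterate_succ_apply']
      exact upper_band_lie X _ j hXs ih
  have hnil : (fun Y => ⁅X, Y⁆)^[n] N = 0 := by
    ext a b
    exact hband n a b (by omega)
  have heig : ∀ j : ℕ, ⁅S, (fun Y => ⁅X, Y⁆)^[j] N⁆
      = (lam + j * mu) • (fun Y => ⁅X, Y⁆)^[j] N := by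
    intro j
    induction j with
    | zero => simpa using hadN
    | succ j ih =>
      rw [Function.iterate_succ_apply']
      generalize (fun Y => ⁅X, Y⁆)^[j] N = Z at ih ⊢
      rw [leibniz_lie, ih, hadX, smul_lie, lie_smul, ← add_smul]
      congr 1
      push_cast
      ring
  have hsum : ∀ m : ℕ, ⁅S - X, ∑ j ∈ range m, ((mu⁻¹ ^ j / (j.factorial : F)) •
        (fun Y => ⁅X, Y⁆)^[j] N)⁆ =
      lam • (∑ j ∈ range m, ((mu⁻¹ ^ j / (j.factorial : F)) •
        (fun Y => ⁅X, Y⁆)^[j] N)) -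
      (mu * m * (mu⁻¹ ^ m / (m.factorial : F))) • (fun Y => ⁅X, Y⁆)^[m] N := by
    intro m
    induction m with
    | zero => simp
    | succ m ih =>
      have hc : mu * ((m + 1 : ℕ) : F) * (mu⁻¹ ^ (m + 1) / ((m + 1).factorial : F))
          = mu⁻¹ ^ m / (m.factorial : F) := by
        have h1 : ((m : F) + 1) ≠ 0 := by exact_mod_cast Nat.succ_ne_zero m
        have h2 : (m.factorial : F) ≠ 0 := by exact_mod_cast Nat.factorial_ne_zero m
        rw [Nat.factorial_succ, pow_succ]
        push_cast
        field_simp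
      rw [hc, sum_range_succ, lie_add, ih, lie_smul, sub_lie, heig,
        Function.iterate_succ_apply']
      module
  rw [hsum n, hnil, smul_zero, sub_zero]
end

section
/- Let F be a field of characteristic 0 and let g be a finite-dimensional Lie algebra over F. If x ∈ g has an abstract Jordan–Chevalley decomposition, then x ∈ [g,g]. -/
universe u v w

attribute [local instance 100] LieRing.ofAssociativeRing

/-- `(s, n)` is an *abstract Jordan–Chevalley decomposition* of `x` in the Lie algebra `g` if
`x = s + n`, `⁅s, n⁆ = 0` and, for every finite-dimensional representation `π : g → gl(V)`,
`π x = π s + π n` is the Jordan–Chevalley decomposition of `π x`: `π s` is semisimple (its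
minimal polynomial is squarefree), `π n` is nilpotent, and they commute. -/
def IsAbstractJCDPair (F : Type u) [Field F] {g : Type v} [LieRing g] [LieAlgebra F g]
    (x s n : g) : Prop :=
  x = s + n ∧ ⁅s, n⁆ = 0 ∧
    ∀ (V : Type w) [AddCommGroup V] [Module F V] [FiniteDimensional F V]
      (π : g →ₗ⁅F⁆ Module.End F V),
      Squarefree (minpoly F (π s)) ∧ IsNilpotent (π n) ∧ Commute (π s) (π n)

/-- `x` has an *abstract Jordan–Chevalley decomposition* if there exists a unique pair `(s, n)`
which is an abstract Jordan–Chevalley decomposition of `x`. -/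
def HasAbstractJCD (F : Type u) [Field F] {g : Type v} [LieRing g] [LieAlgebra F g]
    (x : g) : Prop :=
  ∃! p : g × g, IsAbstractJCDPair.{u, v, w} F x p.1 p.2

/-- One-dimensional-character-times-endomorphism representation. -/
def charRep {F : Type u} [Field F] {g : Type v} [LieRing g] [LieAlgebra F g]
    (f : g →ₗ[F] F) (hf : ∀ a b : g, f ⁅a, b⁆ = 0)
    {V : Type w} [AddCommGroup V] [Module F V] (A : Module.End F V) :
    g →ₗ⁅F⁆ Module.End F V :=
  { f.smulRight A with
    map_lie' := by
      intro a b
      simp [hf, Ring.lie_def, mul_comm, smul_smul] }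

theorem charRep_apply {F : Type u} [Field F] {g : Type v} [LieRing g] [LieAlgebra F g]
    (f : g →ₗ[F] F) (hf : ∀ a b : g, f ⁅a, b⁆ = 0)
    {V : Type w} [AddCommGroup V] [Module F V] (A : Module.End F V) (a : g) :
    charRep f hf A a = f a • A := rfl

theorem exists_nilp_aux (F : Type u) [Field F] (W : Type w) [AddCommGroup W] [Module F W]
    [Nontrivial W] : ∃ A : Module.End F (W × W), A ≠ 0 ∧ A * A = 0 := by
  refine ⟨LinearMap.inl F W W ∘ₗ LinearMap.snd F W W, ?_, ?_⟩
  · intro h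
    obtain ⟨v, hv⟩ := exists_ne (0 : W)
    have := LinearMap.congr_fun h (0, v)
    simp [hv] at this
  · ext <;> simp

theorem exists_nilp (F : Type u) [Field F] [Small.{w} F] :
    ∃ (V : Type w) (_ : AddCommGroup V) (_ : Module F V) (_ : FiniteDimensional F V)
      (A : Module.End F V), Nontrivial V ∧ A ≠ 0 ∧ A * A = 0 := by
  let e : Shrink.{w} F ≃ₗ[F] F := Shrink.linearEquiv F F
  have : Module.Finite F (Shrink.{w} F) := Module.Finite.equiv e.symm
  obtain ⟨A, hA, hAA⟩ := exists_nilp_aux F (Shrink.{w} F)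
  exact ⟨Shrink.{w} F × Shrink.{w} F, inferInstance, inferInstance, inferInstance,
    A, inferInstance, hA, hAA⟩

/-- If an element `x` of a finite-dimensional Lie algebra `g` over a field of characteristic
`0` has an abstract Jordan–Chevalley decomposition, then `x` lies in the derived algebra
`[g, g]`. -/
theorem mem_derived_of_hasAbstractJCD
    {F : Type u} [Field F] [CharZero F]
    {g : Type v} [LieRing g] [LieAlgebra F g] [Module.Finite F g]
    (x : g) (hx : HasAbstractJCD.{u, v, w} F x) :
    x ∈ LieAlgebra.derivedSeries F g 1 := by
  obtain ⟨⟨s, n⟩, h, huniq⟩ := hx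
  by_cases hF : Small.{w} F
  · obtain ⟨hxs, -, hV⟩ := h
    simp only at hxs hV
    by_contra hmem
    obtain ⟨f, hfx, hf⟩ := Submodule.exists_le_ker_of_notMem
      (p := (LieAlgebra.derivedSeries F g 1).toSubmodule) hmem
    have hf' : ∀ a b : g, f ⁅a, b⁆ = 0 := fun a b => by
      apply hf
      change ⁅a, b⁆ ∈ LieAlgebra.derivedSeries F g 1
      rw [LieAlgebra.derivedSeries_def, LieAlgebra.derivedSeriesOfIdeal_succ]
      exact LieSubmodule.lie_mem_lie (by simp) (by simp)
    obtain ⟨V, _, _, _, A, hnt, hA, hAA⟩ := exists_nilp.{u, w} F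
    have h1 := (hV V (charRep f hf' A)).1
    have h2 := (hV V (charRep f hf' 1)).2.1
    rw [charRep_apply] at h1 h2
    have hs : f s = 0 := by
      have hss := Module.End.isSemisimple_of_squarefree_aeval_eq_zero h1 (minpoly.aeval _ _)
      have hn : IsNilpotent (f s • A) := ⟨2, by rw [pow_two, smul_mul_smul_comm, hAA, smul_zero]⟩
      exact (smul_eq_zero.mp (Module.End.eq_zero_of_isNilpotent_isSemisimple hn hss)).resolve_right hA
    have hn : f n = 0 := by
      obtain ⟨k, hk⟩ := h2
      rw [smul_pow, one_pow] at hk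
      exact eq_zero_of_pow_eq_zero ((smul_eq_zero.mp hk).resolve_right one_ne_zero)
    apply hfx
    rw [hxs, map_add, hs, hn, add_zero]
  · have key : ∀ a b : g, x = a + b → ⁅a, b⁆ = 0 → IsAbstractJCDPair.{u, v, w} F x a b := by
      intro a b hab hl
      refine ⟨hab, hl, ?_⟩
      intro V _ _ _ π
      have : Subsingleton V := by
        by_contra hV
        rw [not_subsingleton_iff_nontrivial] at hV
        obtain ⟨v, hv⟩ := exists_ne (0 : V)
        exact hF (small_of_injective (smul_left_injective F hv))
      refine ⟨?_, ⟨1, Subsingleton.elim _ _⟩, Subsingleton.elim _ _⟩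
      rw [minpoly.subsingleton]
      exact squarefree_one
    have h1 := huniq (x, 0) (key x 0 (by simp) (by simp))
    have h2 := huniq (0, x) (key 0 x (by simp) (by simp))
    have h3 := congrArg Prod.fst (h1.trans h2.symm)
    simp only at h3
    rw [h3]
    exact zero_mem _
end

section
/- Let F be a field of characteristic 0 and let g be a finite-dimensional Lie algebra over F. If x ∈ [g,g], then there exist s, n ∈ [g,g] with x = s + n and [s,n] = 0 such that for every finite-dimensional representation π : g → gl(V), π(s) is semisimple, π(n) is nilpotent, and π(s)π(n) = π(n)π(s); that is, π(x) = π(s) + π(n) is the Jordan–Chevalley decomposition of π(x). -/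
universe u v w

attribute [local instance 100] LieRing.ofAssociativeRing

namespace AJCD

open Module Polynomial LinearMap

set_option linter.unusedSectionVars false

section LinAlg

variable {F : Type*} [Field F] [CharZero F] {W : Type*} [AddCommGroup W] [Module F W]
  [FiniteDimensional F W]

/-- An endomorphism all of whose positive powers have trace zero is nilpotent. -/
theorem isNilpotent_of_trace_pow (y : End F W)
    (h : ∀ k : ℕ, trace F W (y ^ k * y) = 0) : IsNilpotent y := by
  have hq : ∀ q : F[X], trace F W (aeval y q * y) = 0 := by
    intro q
    induction q using Polynomial.induction_on' with
    | add p q hp hq => simp [add_mul, hp, hq]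
    | monomial n a => simp [aeval_monomial, Algebra.algebraMap_eq_smul_one, h]
  have hm0 : minpoly F y ≠ 0 := minpoly.ne_zero_of_finite F y
  obtain ⟨r, hr, hr'⟩ := Polynomial.exists_eq_pow_rootMultiplicity_mul_and_not_dvd (minpoly F y) hm0 0
  set a := (minpoly F y).rootMultiplicity 0
  simp only [map_zero, sub_zero] at hr hr'
  have hcop : IsCoprime (X ^ (a + 1) : F[X]) r :=
    IsCoprime.pow_left ((Polynomial.irreducible_X.coprime_iff_not_dvd).2 hr')
  obtain ⟨p, q, hpq⟩ := hcop
  have hpq' := congrArg (aeval y) hpq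
  simp only [map_add, map_mul, map_pow, aeval_X, map_one] at hpq'
  have hmin : aeval y (X ^ a * r) = 0 := by rw [← hr]; exact minpoly.aeval F y
  set e : End F W := aeval y (p * X ^ (a + 1)) with he
  have he1 : 1 - e = aeval y (q * r) := by
    rw [he]; simp only [map_mul, map_pow, aeval_X]; rw [← hpq']; abel
  have hee : e * (1 - e) = 0 := by
    rw [he1, he, ← map_mul,
      show p * X ^ (a + 1) * (q * r) = (p * X * q) * (X ^ a * r) by ring, map_mul, hmin, mul_zero]
  have hid : IsIdempotentElem e := by
    have : e - e * e = 0 := by rw [← hee]; noncomm_ring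
    exact (sub_eq_zero.1 this).symm
  have htr : trace F W e = 0 := by
    have := hq (p * X ^ a)
    have h2 : e = aeval y (p * X ^ a) * y := by
      rw [he, show p * X ^ (a + 1) = p * X ^ a * X by ring, map_mul _ _ X, aeval_X]
    rw [h2]; exact this
  have e0 : e = 0 := IsIdempotentElem.eq_zero_of_trace_eq_zero hid htr
  refine ⟨a, ?_⟩
  rw [e0, sub_zero] at he1
  have h3 : aeval y (X ^ a * (q * r)) = 0 := by
    rw [show X ^ a * (q * r) = q * (X ^ a * r) by ring, map_mul, hmin, mul_zero]
  rw [map_mul, ← he1, mul_one, map_pow, aeval_X] at h3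
  exact h3

theorem trace_eq_zero_of_isNilpotent {y : End F W} (h : IsNilpotent y) : trace F W y = 0 :=
  (LinearMap.isNilpotent_trace_of_isNilpotent h).eq_zero

end LinAlg

section Perfect

variable {F : Type*} [Field F] [CharZero F] {S : Type*} [LieRing S] [LieAlgebra F S]
  [FiniteDimensional F S] [LieAlgebra.HasTrivialRadical F S]

theorem ideal_perfect (I : LieIdeal F S) : ⁅I, I⁆ = I := by
  set P : LieIdeal F S := ⁅I, I⁆
  have hPI : P ≤ I := LieSubmodule.lie_le_left I I
  have hc := LieIdeal.isCompl_killingCompl P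
  have hQ : I ⊓ LieIdeal.killingCompl F S P = ⊥ := by
    have : IsLieAbelian (I ⊓ LieIdeal.killingCompl F S P : LieIdeal F S) := by
      rw [LieSubmodule.lie_abelian_iff_lie_self_eq_bot, LieSubmodule.lie_eq_bot_iff]
      rintro x ⟨hx1, hx2⟩ y ⟨hy1, hy2⟩
      have h1 : ⁅x, y⁆ ∈ P := LieSubmodule.lie_mem_lie hx1 hy1
      have h2 : ⁅x, y⁆ ∈ LieIdeal.killingCompl F S P := LieSubmodule.lie_mem _ hy2
      have := hc.disjoint.le_bot (show ⁅x, y⁆ ∈ P ⊓ LieIdeal.killingCompl F S P from ⟨h1, h2⟩)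
      simpa using this
    exact LieAlgebra.IsKilling.ideal_eq_bot_of_isLieAbelian _
  apply le_antisymm hPI
  calc I = (P ⊔ LieIdeal.killingCompl F S P) ⊓ I := by rw [hc.sup_eq_top, top_inf_eq]
    _ ≤ P ⊔ (LieIdeal.killingCompl F S P ⊓ I) := sup_inf_le_assoc_of_le _ hPI
    _ = P := by rw [inf_comm, hQ, sup_bot_eq]

end Perfect

section TraceForm

variable {F : Type*} [Field F] [CharZero F] {S : Type*} [LieRing S] [LieAlgebra F S]
  [FiniteDimensional F S] [LieAlgebra.HasTrivialRadical F S]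

variable {W : Type*} [AddCommGroup W] [Module F W] [FiniteDimensional F W]

theorem traceForm_aux [LieRingModule S W] [LieModule F S W] (x : S)
    (hx : ∀ y : S, LieModule.traceForm F S W x y = 0) (m : W) : ⁅x, m⁆ = 0 := by
  let I : LieIdeal F S :=
    { LinearMap.ker (LieModule.traceForm F S W) with
      lie_mem := by
        intro a b hb
        have hb' : LieModule.traceForm F S W b = 0 := hb
        change LieModule.traceForm F S W ⁅a, b⁆ = 0
        ext c
        rw [← lie_skew, map_neg, LinearMap.neg_apply, LieModule.traceForm_apply_lie_apply, hb']
        simp }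
  have hI : ∀ z, z ∈ I → ∀ y, LieModule.traceForm F S W z y = 0 := by
    intro z hz y
    have hz' : LieModule.traceForm F S W z = 0 := hz
    rw [hz']; rfl
  have hxI : x ∈ I := by
    change LieModule.traceForm F S W x = 0
    ext y; simpa using hx y
  have h0 : LieModule.traceForm F I W = 0 := by
    ext ⟨z, hz⟩ ⟨y, hy⟩
    exact hI z hz y
  have hnil := LieModule.isNilpotent_derivedSeries_of_traceForm_eq_zero h0
  have htop : LieAlgebra.derivedSeries F I 1 = ⊤ := by
    rw [LieIdeal.derivedSeries_eq_derivedSeriesOfIdeal_comap]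
    rw [LieAlgebra.derivedSeriesOfIdeal_succ, LieAlgebra.derivedSeriesOfIdeal_zero, ideal_perfect]
    ext z; simp
  have hnil' : LieModule.IsNilpotent I W := by
    rw [LieModule.isNilpotent_iff_forall' (R := F)] at hnil ⊢
    intro z
    exact hnil ⟨z, by rw [htop]; trivial⟩
  have key : ∀ k : ℕ, ∀ z ∈ I, ∀ j, ∀ m ∈ LieModule.lowerCentralSeries F I W j,
      ⁅z, m⁆ ∈ LieModule.lowerCentralSeries F I W (j + k + 1) := by
    intro k
    induction k with
    | zero =>
      intro z hz j m hm
      rw [add_zero, LieModule.lowerCentralSeries_succ]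
      exact LieSubmodule.lie_mem_lie (x := (⟨z, hz⟩ : I)) (LieSubmodule.mem_top _) hm
    | succ k ih =>
      intro z hz j m hm
      rw [← ideal_perfect I, ← LieSubmodule.mem_toSubmodule,
        LieSubmodule.lieIdeal_oper_eq_linear_span'] at hz
      induction hz using Submodule.span_induction with
      | mem z hz =>
        obtain ⟨a, ha, b, hb, rfl⟩ := hz
        rw [lie_lie]
        have hle : LieModule.lowerCentralSeries F I W (j + k + 1 + k + 1) ≤
          LieModule.lowerCentralSeries F I W (j + (k + 1) + 1) :=
          LieModule.antitone_lowerCentralSeries F I W (by omega)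
        exact sub_mem (hle (ih a ha _ _ (ih b hb _ _ hm))) (hle (ih b hb _ _ (ih a ha _ _ hm)))
      | zero => simp
      | add a b _ _ ha hb => rw [add_lie]; exact add_mem ha hb
      | smul c a _ ha => rw [smul_lie]; exact Submodule.smul_mem _ _ ha
  obtain ⟨k, hk⟩ := LieModule.IsNilpotent.nilpotent F I W
  have := key k x hxI 0 m (by simp)
  have h2 := LieModule.antitone_lowerCentralSeries F I W (show k ≤ 0 + k + 1 by omega) this
  rw [hk] at h2
  simpa using h2

/-- The trace form of a representation of a semisimple Lie algebra is nondegenerate modulo the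
kernel. -/
theorem traceForm_rep (ρ : S →ₗ⁅F⁆ End F W) (x : S)
    (hx : ∀ y : S, trace F W (ρ x * ρ y) = 0) : ρ x = 0 := by
  let _ : LieRingModule S W := LieRingModule.compLieHom W ρ
  have : LieModule F S W := LieModule.compLieHom W ρ
  ext m
  exact traceForm_aux x (fun y => hx y) m

end TraceForm

end AJCD

namespace AJCD

open Module Polynomial LinearMap

set_option linter.unusedSectionVars false

section Casimir

variable {F : Type*} [Field F] [CharZero F] {S : Type*} [LieRing S] [LieAlgebra F S]
  [FiniteDimensional F S] [LieAlgebra.HasTrivialRadical F S]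

variable {W : Type*} [AddCommGroup W] [Module F W] [FiniteDimensional F W]

theorem exists_casimir (ρ : S →ₗ⁅F⁆ End F W) (hρ : ∃ y, ρ y ≠ 0) :
    ∃ Γ : End F W, (∀ y, Commute (ρ y) Γ) ∧ trace F W Γ ≠ 0 ∧
      ∀ ε : W →ₗ[F] F, (∀ y m, ε (ρ y m) = 0) → ∀ m, ε (Γ m) = 0 := by
  classical
  let R : Submodule F (End F W) := LinearMap.range (ρ : S →ₗ[F] End F W)
  let B : LinearMap.BilinForm F R :=
    LinearMap.mk₂ F (fun a b : R => trace F W ((a : End F W) * (b : End F W)))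
      (by intros; simp [add_mul]) (by intros; simp) (by intros; simp [mul_add])
      (by intros; simp)
  have hB : ∀ a b : R, B a b = trace F W ((a : End F W) * (b : End F W)) := fun a b => rfl
  have hsymm : B.IsSymm := ⟨fun a b => by
    simp only [hB]; exact LinearMap.trace_mul_comm _ _ _⟩
  have hker : ∀ a : R, (∀ b, B a b = 0) → a = 0 := by
    rintro ⟨_, x, rfl⟩ ha
    apply Subtype.ext
    exact traceForm_rep ρ x (fun y => ha ⟨ρ y, y, rfl⟩)
  have hnd : B.Nondegenerate := by
    refine ⟨fun a ha => hker a ha, fun a ha => hker a fun b => ?_⟩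
    rw [hB, LinearMap.trace_mul_comm]; exact ha b
  let b := Module.finBasis F R
  let b' := B.dualBasis hnd b
  have hb : ∀ a : R, a = ∑ j, B a (b' j) • b j := by
    intro a
    conv_lhs => rw [← b.sum_repr a]
    refine Finset.sum_congr rfl fun j _ => ?_
    congr 1
    conv_rhs => rw [← b.sum_repr a]
    rw [map_sum, LinearMap.sum_apply, Finset.sum_eq_single j]
    · rw [map_smul, LinearMap.smul_apply, LinearMap.BilinForm.apply_dualBasis_right hnd hsymm,
        if_pos rfl, smul_eq_mul, mul_one]
    · intro i _ hij
      rw [map_smul, LinearMap.smul_apply, LinearMap.BilinForm.apply_dualBasis_right hnd hsymm,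
        if_neg hij, smul_zero]
    · simp
  have hb' : ∀ a : R, a = ∑ j, B a (b j) • b' j := by
    intro a
    conv_lhs => rw [← b'.sum_repr a]
    refine Finset.sum_congr rfl fun j _ => ?_
    rw [LinearMap.BilinForm.dualBasis_repr_apply]
  let Γ : End F W := ∑ i, (b i : End F W) * (b' i : End F W)
  refine ⟨Γ, ?_, ?_, ?_⟩
  · intro y
    have hmem : ∀ a : R, ρ y * (a : End F W) - (a : End F W) * ρ y ∈ R := by
      rintro ⟨_, x, rfl⟩
      exact ⟨⁅y, x⁆, by simp [LieRing.of_associative_ring_bracket]⟩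
    let D : R → R := fun a => ⟨_, hmem a⟩
    have hD : ∀ a, (D a : End F W) = ρ y * (a : End F W) - (a : End F W) * ρ y := fun a => rfl
    have hinv : ∀ a c, B (D a) c = - B (D c) a := by
      intro a c
      simp only [hB, hD, sub_mul, map_sub]
      rw [LinearMap.trace_mul_comm F (ρ y * (c : End F W)) a,
        LinearMap.trace_mul_comm F ((c : End F W) * ρ y) a, mul_assoc, 
        LinearMap.trace_mul_comm F (ρ y) _, mul_assoc, mul_assoc]
      ring
    have hDb : ∀ a, (D a : End F W) = ∑ j, B (D a) (b' j) • (b j : End F W) := by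
      intro a
      conv_lhs => rw [hb (D a)]
      simp
    have hDb' : ∀ a, (D a : End F W) = ∑ j, B (D a) (b j) • (b' j : End F W) := by
      intro a
      conv_lhs => rw [hb' (D a)]
      simp
    have : ρ y * Γ - Γ * ρ y = 0 := by
      have h1 : ρ y * Γ - Γ * ρ y =
          ∑ i, (D (b i) : End F W) * b' i + ∑ i, (b i : End F W) * D (b' i) := by
        simp only [Γ, Finset.mul_sum, Finset.sum_mul, ← Finset.sum_add_distrib,
          ← Finset.sum_sub_distrib, hD]
        refine Finset.sum_congr rfl fun i _ => ?_
        noncomm_ring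
      rw [h1]
      have h2 : ∑ i, (D (b i) : End F W) * b' i =
          ∑ i, ∑ j, B (D (b i)) (b' j) • ((b j : End F W) * b' i) := by
        refine Finset.sum_congr rfl fun i _ => ?_
        rw [hDb (b i), Finset.sum_mul]
        simp
      have h3 : ∑ i, (b i : End F W) * D (b' i) =
          ∑ i, ∑ j, B (D (b' i)) (b j) • ((b i : End F W) * b' j) := by
        refine Finset.sum_congr rfl fun i _ => ?_
        rw [hDb' (b' i), Finset.mul_sum]
        simp
      rw [h2, h3, Finset.sum_comm, ← Finset.sum_add_distrib]
      refine Finset.sum_eq_zero fun i _ => ?_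
      rw [← Finset.sum_add_distrib]
      refine Finset.sum_eq_zero fun j _ => ?_
      rw [hinv (b j) (b' i), neg_smul, neg_add_cancel]
    exact sub_eq_zero.1 this
  · have : trace F W Γ = ((finrank F R : ℕ) : F) := by
      simp only [Γ, map_sum]
      have : ∀ i, trace F W ((b i : End F W) * (b' i : End F W)) = 1 := by
        intro i
        rw [← hB, LinearMap.BilinForm.apply_dualBasis_right hnd hsymm, if_pos rfl]
      simp [this]
    rw [this, Nat.cast_ne_zero]
    obtain ⟨y, hy⟩ := hρ
    have : Nontrivial R := ⟨⟨⟨ρ y, y, rfl⟩, 0, fun h => hy (congrArg Subtype.val h)⟩⟩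
    exact Module.finrank_pos.ne'
  · intro ε hε m
    simp only [Γ, LinearMap.sum_apply, map_sum]
    refine Finset.sum_eq_zero fun i _ => ?_
    obtain ⟨y, hy⟩ := (b i).2
    change ε ((b i : End F W) ((b' i : End F W) m)) = 0
    rw [← hy]
    exact hε y _

/-- Restriction of a representation to an invariant subspace. -/
def subrep {F : Type*} [Field F] {S : Type*} [LieRing S] [LieAlgebra F S]
    {W : Type*} [AddCommGroup W] [Module F W]
    (ρ : S →ₗ⁅F⁆ End F W) (P : Submodule F W) (h : ∀ y, ∀ p ∈ P, ρ y p ∈ P) :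
    S →ₗ⁅F⁆ End F P where
  toFun y := (ρ y).restrict (h y)
  map_add' x y := by ext; simp
  map_smul' c x := by ext; simp
  map_lie' := by intro x y; ext; simp [LieRing.of_associative_ring_bracket]

/-- First Whitehead lemma / codimension one case of the theorem of Weyl. -/
theorem weyl_codim_one (ρ : S →ₗ⁅F⁆ End F W) (ε : W →ₗ[F] F) (hε : ε ≠ 0)
    (h : ∀ y m, ε (ρ y m) = 0) : ∃ m, ε m = 1 ∧ ∀ y, ρ y m = 0 := by
  induction hn : finrank F W using Nat.strong_induction_on generalizing W with
  | _ n ih =>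
  by_cases hρ : ∃ y, ρ y ≠ 0
  · obtain ⟨Γ, hc, htr, hΓ⟩ := exists_casimir ρ hρ
    obtain ⟨N, hN⟩ := Filter.eventually_atTop.1 (LinearMap.eventually_isCompl_ker_pow_range_pow Γ)
    have hcompl := hN (N + 1) (by omega)
    set P := LinearMap.ker (Γ ^ (N + 1))
    have hP : ∀ y, ∀ p ∈ P, ρ y p ∈ P := by
      intro y p hp
      have h1 : (ρ y) * Γ ^ (N + 1) = Γ ^ (N + 1) * ρ y := (hc y).pow_right _
      have h2 := LinearMap.congr_fun h1 p
      have h3 : (Γ ^ (N + 1)) p = 0 := hp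
      simp only [Module.End.mul_apply, h3, map_zero] at h2
      exact h2.symm
    have hlt : finrank F P < n := by
      rw [← hn]
      apply Submodule.finrank_lt
      intro htop
      apply htr
      apply trace_eq_zero_of_isNilpotent
      exact ⟨N + 1, LinearMap.ker_eq_top.1 htop⟩
    have hεP : ε.comp P.subtype ≠ 0 := by
      intro h0
      apply hε
      ext m
      have hm : m ∈ P ⊔ LinearMap.range (Γ ^ (N + 1)) := by rw [hcompl.sup_eq_top]; trivial
      obtain ⟨p, hp, _, ⟨q, rfl⟩, rfl⟩ := Submodule.mem_sup.1 hm
      have h1 : ε p = 0 := LinearMap.congr_fun h0 ⟨p, hp⟩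
      have h2 : ε ((Γ ^ (N + 1)) q) = 0 := by
        rw [pow_succ']; exact hΓ ε h _
      simp [h1, h2]
    obtain ⟨m, hm1, hm2⟩ := ih (finrank F P) hlt (subrep ρ P hP) (ε.comp P.subtype) hεP
      (fun y m => h y m) rfl
    exact ⟨m, hm1, fun y => congrArg Subtype.val (hm2 y)⟩
  · push Not at hρ
    obtain ⟨m, hm⟩ : ∃ m, ε m ≠ 0 := by
      by_contra hcon
      push Not at hcon
      exact hε (LinearMap.ext hcon)
    exact ⟨(ε m)⁻¹ • m, by simp [hm], fun y => by simp [hρ y]⟩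

/-- Complete reducibility: every subrepresentation is the range of an equivariant projection. -/
theorem weyl_complement (ρ : S →ₗ⁅F⁆ End F W) (P : Submodule F W)
    (hP : ∀ y, ∀ p ∈ P, ρ y p ∈ P) :
    ∃ φ : End F W, (∀ m, φ m ∈ P) ∧ (∀ p ∈ P, φ p = p) ∧ ∀ y, Commute (ρ y) φ := by
  by_cases hP0 : P = ⊥
  · refine ⟨0, by simp, ?_, fun y => Commute.zero_right _⟩
    rw [hP0]; rintro p hp; simpa using ((Submodule.mem_bot F).1 hp).symm
  obtain ⟨p₀, hp₀, hp₀0⟩ := (Submodule.ne_bot_iff _).1 hP0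
  -- the space of maps into `P` which are scalar on `P`
  let A : Submodule F (End F W) :=
    { carrier := {φ | (∀ m, φ m ∈ P) ∧ ∃ c : F, ∀ p ∈ P, φ p = c • p}
      add_mem' := by
        rintro φ ψ ⟨h1, c, hc⟩ ⟨h2, d, hd⟩
        refine ⟨fun m => P.add_mem (h1 m) (h2 m), c + d, fun p hp => ?_⟩
        simp [hc p hp, hd p hp, add_smul]
      zero_mem' := ⟨fun m => P.zero_mem, 0, fun p _ => by simp⟩
      smul_mem' := by
        rintro a φ ⟨h1, c, hc⟩
        refine ⟨fun m => P.smul_mem _ (h1 m), a * c, fun p hp => ?_⟩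
        simp [hc p hp, mul_smul] }
  obtain ⟨f, hf⟩ : ∃ f : W →ₗ[F] F, f p₀ = 1 := by
    have : ¬ ∀ f : Module.Dual F W, f p₀ = 0 := fun h =>
      hp₀0 ((Module.forall_dual_apply_eq_zero_iff F p₀).1 h)
    push Not at this
    obtain ⟨f, hf⟩ := this
    exact ⟨(f p₀)⁻¹ • f, by simp [hf]⟩
  let σ : S →ₗ⁅F⁆ End F (End F W) := (LieAlgebra.ad F (End F W)).comp ρ
  have hσ : ∀ y φ m, σ y φ m = ρ y (φ m) - φ (ρ y m) := fun y φ m => rfl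
  have hA : ∀ y, ∀ φ ∈ A, σ y φ ∈ A := by
    rintro y φ ⟨h1, c, hc⟩
    refine ⟨fun m => ?_, 0, fun p hp => ?_⟩
    · rw [hσ]; exact P.sub_mem (hP y _ (h1 _)) (h1 _)
    · rw [hσ, hc p hp, hc _ (hP y p hp)]; simp
  let ε : A →ₗ[F] F := (f.comp (LinearMap.applyₗ p₀)).comp A.subtype
  have hε : ∀ φ : A, ε φ = f ((φ : End F W) p₀) := fun φ => rfl
  obtain ⟨Q, hQ⟩ := Submodule.exists_isCompl P
  have hproj : (P.subtype.comp (P.projectionOnto Q hQ)) ∈ A := by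
    refine ⟨fun m => ?_, 1, fun p hp => ?_⟩
    · simp
    · have := Submodule.projectionOnto_apply_left hQ ⟨p, hp⟩
      simp only [LinearMap.comp_apply, Submodule.subtype_apply, one_smul]
      rw [this]
  have hε0 : ε ≠ 0 := by
    intro h0
    have h1 := LinearMap.congr_fun h0 ⟨_, hproj⟩
    have := Submodule.projectionOnto_apply_left hQ ⟨p₀, hp₀⟩
    rw [hε] at h1
    simp only [LinearMap.comp_apply, Submodule.subtype_apply] at h1
    rw [this] at h1
    simp [hf] at h1
  obtain ⟨φ, hφ1, hφ2⟩ := weyl_codim_one (subrep σ A hA) ε hε0 (by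
    rintro y ⟨φ, h1, c, hc⟩
    rw [hε]
    change f (ρ y (φ p₀) - φ (ρ y p₀)) = 0
    rw [hc p₀ hp₀, hc _ (hP y _ hp₀)]; simp)
  obtain ⟨φ, h1, c, hc⟩ := φ
  rw [hε] at hφ1
  simp only [hc p₀ hp₀, map_smul, hf, smul_eq_mul, mul_one] at hφ1
  subst hφ1
  refine ⟨φ, h1, fun p hp => by rw [hc p hp, one_smul], fun y => ?_⟩
  have h2 : ⁅ρ y, φ⁆ = 0 := congrArg Subtype.val (hφ2 y)
  rw [LieRing.of_associative_ring_bracket] at h2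
  exact sub_eq_zero.1 h2

end Casimir
end AJCD

namespace AJCD
open Module Polynomial LinearMap
set_option linter.unusedSectionVars false

section Aux
variable {F : Type*} [Field F] [CharZero F]

/-- A semisimple endomorphism `T` satisfies `T r(T) = 0` with `r(0) ≠ 0`. -/
theorem exists_r_of_isSemisimple {W : Type*} [AddCommGroup W] [Module F W] [FiniteDimensional F W]
    {T : End F W} (hT : T.IsSemisimple) :
    ∃ r : F[X], r.coeff 0 ≠ 0 ∧ T * aeval T r = 0 := by
  have hsq := hT.minpoly_squarefree
  have hne : minpoly F T ≠ 0 := minpoly.ne_zero (Algebra.IsIntegral.isIntegral T)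
  by_cases h0 : (minpoly F T).coeff 0 = 0
  · obtain ⟨r, hr⟩ := X_dvd_iff.2 h0
    refine ⟨r, fun hr0 => ?_, ?_⟩
    · obtain ⟨q, hq⟩ := X_dvd_iff.2 hr0
      have : IsUnit (X : F[X]) := hsq X ⟨q, by rw [hr, hq, mul_assoc]⟩
      exact not_isUnit_X this
    · have := minpoly.aeval F T
      rw [hr, map_mul, aeval_X] at this
      exact this
  · exact ⟨minpoly F T, h0, by rw [minpoly.aeval, mul_zero]⟩

theorem aeval_intertwine {A B : Type*} [AddCommGroup A] [Module F A] [AddCommGroup B] [Module F B]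
    (π : A →ₗ[F] B) (a : End F A) (b : End F B) (h : ∀ x, b (π x) = π (a x)) (q : F[X]) (x : A) :
    aeval b q (π x) = π (aeval a q x) := by
  induction q using Polynomial.induction_on generalizing x with
  | C a => simp [Algebra.algebraMap_eq_smul_one]
  | add p q hp hq => simp [hp, hq]
  | monomial n c ih =>
    rw [pow_succ, ← mul_assoc, map_mul (aeval b) _ X, aeval_X, map_mul (aeval a) _ X, aeval_X,
      Module.End.mul_apply, h, ih, Module.End.mul_apply]

theorem lie_factor {g S M : Type*} [LieRing g] [LieAlgebra F g] [LieRing S] [LieAlgebra F S]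
    [LieRing M] [LieAlgebra F M] (p : g →ₗ⁅F⁆ S) (hp : Function.Surjective p)
    (ρ : g →ₗ⁅F⁆ M) (h : ∀ x, p x = 0 → ρ x = 0) :
    ∃ ρ' : S →ₗ⁅F⁆ M, ∀ x, ρ' (p x) = ρ x := by
  obtain ⟨t, ht⟩ := LinearMap.exists_rightInverse_of_surjective (p : g →ₗ[F] S)
    (LinearMap.range_eq_top.2 hp)
  have ht' : ∀ y, p (t y) = y := fun y => LinearMap.congr_fun ht y
  have key : ∀ x y, p x = p y → ρ x = ρ y := fun x y hxy => by
    have := h (x - y) (by rw [map_sub, hxy, sub_self])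
    rwa [map_sub, sub_eq_zero] at this
  refine ⟨{ (ρ : g →ₗ[F] M).comp t with map_lie' := ?_ }, fun x => key _ _ (ht' _)⟩
  intro x y
  change ρ (t ⁅x, y⁆) = ⁅ρ (t x), ρ (t y)⁆
  rw [← LieHom.map_lie]
  exact key _ _ (by rw [ht', LieHom.map_lie, ht', ht'])

end Aux

section Levi
variable {F : Type*} [Field F] [CharZero F] {S : Type*} [LieRing S] [LieAlgebra F S]
  [FiniteDimensional F S] [LieAlgebra.HasTrivialRadical F S]

theorem bracket_self_ne {g : Type*} [LieRing g] [LieAlgebra F g] (K : LieIdeal F g)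
    (hK : LieAlgebra.IsSolvable K) (h0 : K ≠ ⊥) : ¬ K ≤ ⁅K, K⁆ := by
  intro h
  have h1 : ⁅K, K⁆ = K := le_antisymm (LieSubmodule.lie_le_left _ _) h
  have h2 : ∀ k, LieAlgebra.derivedSeriesOfIdeal F g k K = K := by
    intro k
    induction k with
    | zero => rfl
    | succ k ih => rw [LieAlgebra.derivedSeriesOfIdeal_succ, ih, h1]
  obtain ⟨k, hk⟩ := (LieAlgebra.isSolvable_iff F _).1 hK
  rw [LieIdeal.derivedSeries_eq_bot_iff, h2] at hk
  exact h0 hk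

set_option maxHeartbeats 1600000 in
theorem levi_step {g : Type*} [LieRing g] [LieAlgebra F g] [FiniteDimensional F g]
    (p : g →ₗ⁅F⁆ S) (hp : Function.Surjective p) (hK : LieAlgebra.IsSolvable p.ker)
    (δ : End F g) (hδ : δ.IsSemisimple) (hder : ∀ x y, δ ⁅x, y⁆ = ⁅δ x, y⁆ + ⁅x, δ y⁆)
    (hδK : ∀ x, p x = 0 → p (δ x) = 0) (h0 : p.ker ≠ ⊥) :
    ∃ L : LieSubalgebra F g, L ≠ ⊤ ∧ (∀ x ∈ L, δ x ∈ L) ∧ ∀ y, ∃ x ∈ L, p x = y := by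
  set K : LieIdeal F g := p.ker with hKdef
  have memK : ∀ x, x ∈ K ↔ p x = 0 := fun x => LieHom.mem_ker (f := p) (x := x)
  set K' : LieIdeal F g := ⁅K, K⁆ with hK'
  obtain ⟨k₀, hk₀, hk₀'⟩ := SetLike.not_le_iff_exists.1 (bracket_self_ne K hK h0)
  let π : g →ₗ[F] (g ⧸ K') := LieSubmodule.Quotient.mk' K'
  have hπ : ∀ x y : g, ⁅x, π y⁆ = π ⁅x, y⁆ := fun x y => rfl
  have hπ0 : ∀ x, π x = 0 ↔ x ∈ K' := fun x => LieSubmodule.Quotient.mk_eq_zero'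
  have hKK : ∀ r ∈ K, ∀ k ∈ K, π ⁅r, k⁆ = 0 := fun r hr k hk =>
    (hπ0 _).2 (LieSubmodule.lie_mem_lie hr hk)
  have hδK' : ∀ x ∈ K', δ x ∈ K' := by
    intro x hx
    rw [hK', ← LieSubmodule.mem_toSubmodule, LieSubmodule.lieIdeal_oper_eq_linear_span'] at hx
    induction hx using Submodule.span_induction with
    | mem x h =>
      obtain ⟨a, ha, b, hb, rfl⟩ := h
      rw [hder]
      exact K'.add_mem (LieSubmodule.lie_mem_lie ((memK _).2 (hδK a ((memK _).1 ha))) hb)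
        (LieSubmodule.lie_mem_lie ha ((memK _).2 (hδK b ((memK _).1 hb))))
    | zero => rw [map_zero]; exact K'.zero_mem
    | add x y _ _ h1 h2 => rw [map_add]; exact K'.add_mem h1 h2
    | smul c x _ h1 => rw [map_smul]; exact K'.smul_mem c h1
  let δ' : End F (g ⧸ K') := K'.toSubmodule.mapQ K'.toSubmodule δ hδK'
  have hδ' : ∀ x, δ' (π x) = π (δ x) := fun x => rfl
  have hπs : Function.Surjective π := LieSubmodule.Quotient.surjective_mk' K'
  have hδ's : δ'.IsSemisimple := by
    refine Module.End.isSemisimple_of_squarefree_aeval_eq_zero hδ.minpoly_squarefree ?_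
    ext x
    obtain ⟨x, rfl⟩ := hπs x
    rw [aeval_intertwine π δ δ' hδ', minpoly.aeval]; simp
  let Tl : End F (g →ₗ[F] (g ⧸ K')) :=
    { toFun := fun φ => δ'.comp φ
      map_add' := fun φ ψ => by ext; simp
      map_smul' := fun c φ => by ext; simp }
  let Tr : End F (g →ₗ[F] (g ⧸ K')) :=
    { toFun := fun φ => φ.comp δ
      map_add' := fun φ ψ => by ext; simp
      map_smul' := fun c φ => by ext; simp }
  have hTl : Tl.IsSemisimple := by
    refine Module.End.isSemisimple_of_squarefree_aeval_eq_zero hδ's.minpoly_squarefree ?_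
    ext φ y
    have := aeval_intertwine (LinearMap.applyₗ y : (g →ₗ[F] (g ⧸ K')) →ₗ[F] _) Tl δ'
      (fun φ => rfl) (minpoly F δ') φ
    rw [minpoly.aeval] at this
    simpa using this.symm
  have hTr : Tr.IsSemisimple := by
    refine Module.End.isSemisimple_of_squarefree_aeval_eq_zero hδ.minpoly_squarefree ?_
    have hq : ∀ q : F[X], ∀ φ y, aeval Tr q φ y = φ (aeval δ q y) := by
      intro q
      induction q using Polynomial.induction_on with
      | C a => intro φ y; simp [Algebra.algebraMap_eq_smul_one]
      | add p q hp hq => intro φ y; simp [hp, hq]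
      | monomial n a h =>
        intro φ y
        rw [pow_succ, ← mul_assoc, map_mul (aeval Tr) _ X, aeval_X, Module.End.mul_apply, h,
          mul_comm _ X, map_mul (aeval δ) X _, aeval_X, Module.End.mul_apply]
        rfl
    ext φ y
    rw [hq, minpoly.aeval]; simp
  let T : End F (g →ₗ[F] (g ⧸ K')) := Tl - Tr
  have hT : ∀ φ y, T φ y = δ' (φ y) - φ (δ y) := fun φ y => rfl
  have hTs : T.IsSemisimple := hTl.sub_of_commute
    (by ext φ y; rfl) hTr
  obtain ⟨r, hr0, hr⟩ := exists_r_of_isSemisimple hTs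
  have hact : ∀ (x : g) (φ : g →ₗ[F] (g ⧸ K')) (y : g), ⁅x, φ⁆ y = ⁅x, φ y⁆ - φ ⁅x, y⁆ :=
    fun x φ y => LieHom.lie_apply φ x y
  have hδact : ∀ (x : g) (q : g ⧸ K'), δ' ⁅x, q⁆ = ⁅δ x, q⁆ + ⁅x, δ' q⁆ := by
    intro x q
    obtain ⟨y, rfl⟩ := hπs q
    rw [hπ, hδ', hδ', hπ, hπ, hder, map_add]
  have hTact : ∀ x φ, T ⁅x, φ⁆ = ⁅δ x, φ⁆ + ⁅x, T φ⁆ := by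
    intro x φ
    ext y
    simp only [hT, hact, LinearMap.add_apply, map_sub, hδact, hder, map_add, lie_sub]
    abel
  let A : LieSubmodule F g (g →ₗ[F] (g ⧸ K')) :=
    { carrier := {φ | (∀ y, ∃ k ∈ K, φ y = π k) ∧ ∃ c : F, ∀ k ∈ K, φ k = c • π k}
      add_mem' := by
        rintro φ ψ ⟨h1, c, hc⟩ ⟨h2, d, hd⟩
        refine ⟨fun m => ?_, c + d, fun p hp => ?_⟩
        · obtain ⟨k, hk, hk'⟩ := h1 m
          obtain ⟨l, hl, hl'⟩ := h2 m
          exact ⟨k + l, K.add_mem hk hl, by simp [hk', hl']⟩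
        · simp [hc p hp, hd p hp, add_smul]
      zero_mem' := ⟨fun m => ⟨0, K.zero_mem, by simp⟩, 0, fun p _ => by simp⟩
      smul_mem' := by
        rintro a φ ⟨h1, c, hc⟩
        refine ⟨fun m => ?_, a * c, fun p hp => ?_⟩
        · obtain ⟨k, hk, hk'⟩ := h1 m
          exact ⟨a • k, K.smul_mem _ hk, by simp [hk']⟩
        · simp [hc p hp, mul_smul]
      lie_mem := by
        rintro x φ ⟨h1, c, hc⟩
        refine ⟨fun m => ?_, 0, fun p hp => ?_⟩
        · obtain ⟨k, hk, hk'⟩ := h1 m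
          obtain ⟨l, hl, hl'⟩ := h1 ⁅x, m⁆
          exact ⟨⁅x, k⁆ - l, K.sub_mem (K.lie_mem hk) hl, by rw [hact, hk', hl', hπ, map_sub]⟩
        · rw [hact, hc p hp, hc _ (K.lie_mem hp), lie_smul, hπ]; simp }
  have memA : ∀ φ, φ ∈ A ↔ (∀ y, ∃ k ∈ K, φ y = π k) ∧ ∃ c : F, ∀ k ∈ K, φ k = c • π k :=
    fun φ => Iff.rfl
  let C : LieSubmodule F g (g →ₗ[F] (g ⧸ K')) :=
    { carrier := {φ | ∃ r ∈ K, ∀ y, φ y = π ⁅r, y⁆}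
      add_mem' := by
        rintro φ ψ ⟨r, hr, h⟩ ⟨r', hr', h'⟩
        exact ⟨r + r', K.add_mem hr hr', fun y => by simp [h, h']⟩
      zero_mem' := ⟨0, K.zero_mem, fun y => by simp⟩
      smul_mem' := by
        rintro a φ ⟨r, hr, h⟩
        exact ⟨a • r, K.smul_mem a hr, fun y => by simp [h]⟩
      lie_mem := by
        rintro x φ ⟨r, hr, h⟩
        refine ⟨⁅x, r⁆, K.lie_mem hr, fun y => ?_⟩
        rw [hact, h, h, hπ, ← map_sub, lie_lie] }
  have memC : ∀ φ, φ ∈ C ↔ ∃ r ∈ K, ∀ y, φ y = π ⁅r, y⁆ := fun φ => Iff.rfl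
  have hKact : ∀ (s : g) (_ : s ∈ K) (φ : g →ₗ[F] (g ⧸ K')) (c : F) (_ : ∀ y, ∃ k ∈ K, φ y = π k)
      (_ : ∀ k ∈ K, φ k = c • π k) (y : g), ⁅s, φ⁆ y = - (c • π ⁅s, y⁆) := by
    intro s hs φ c h1 h2 y
    obtain ⟨k, hk, hk'⟩ := h1 y
    rw [hact, hk', hπ, hKK s hs k hk, h2 _ (lie_mem_left _ _ _ _ _ hs), zero_sub]
  have hTA : ∀ φ ∈ A, T φ ∈ A := by
    rintro φ ⟨h1, c, hc⟩
    refine ⟨fun y => ?_, 0, fun k hk => ?_⟩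
    · obtain ⟨k, hk, hk'⟩ := h1 y
      obtain ⟨l, hl, hl'⟩ := h1 (δ y)
      refine ⟨δ k - l, K.sub_mem ((memK _).2 (hδK k ((memK _).1 hk))) hl, ?_⟩
      rw [hT, hk', hl', hδ', map_sub]
    · rw [hT, hc k hk, hc _ ((memK _).2 (hδK k ((memK _).1 hk))), map_smul, hδ']; simp
  have hTC : ∀ φ ∈ C, T φ ∈ C := by
    rintro φ ⟨r, hr, h⟩
    refine ⟨δ r, (memK _).2 (hδK r ((memK _).1 hr)), fun y => ?_⟩
    rw [hT, h, h, hδ', hder, map_add, add_sub_cancel_right]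
  -- a functional detecting the scalar
  have hπk₀ : π k₀ ≠ 0 := fun h => hk₀' ((hπ0 _).1 h)
  obtain ⟨f, hf⟩ : ∃ f : (g ⧸ K') →ₗ[F] F, f (π k₀) = 1 := by
    have : ¬ ∀ f : Module.Dual F (g ⧸ K'), f (π k₀) = 0 := fun h =>
      hπk₀ ((Module.forall_dual_apply_eq_zero_iff F (π k₀)).1 h)
    push Not at this
    obtain ⟨f, hf⟩ := this
    exact ⟨(f (π k₀))⁻¹ • f, by simp [hf]⟩
  let ε : (g →ₗ[F] (g ⧸ K')) →ₗ[F] F := f.comp (LinearMap.applyₗ k₀)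
  have hε : ∀ φ, ε φ = f (φ k₀) := fun φ => rfl
  have hεC : ∀ φ ∈ C, ε φ = 0 := by
    rintro φ ⟨r, hr, h⟩
    rw [hε, h, hKK r hr k₀ hk₀, map_zero]
  have hεT : ∀ φ ∈ A, ε (T φ) = 0 := by
    rintro φ ⟨h1, c, hc⟩
    rw [hε, hT, hc _ hk₀, hc _ ((memK _).2 (hδK _ ((memK _).1 hk₀))), map_smul, hδ', sub_self,
      map_zero]
  have hεact : ∀ x : g, ∀ φ ∈ A, ε ⁅x, φ⁆ = 0 := by
    rintro x φ ⟨h1, c, hc⟩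
    rw [hε, hact, hc _ hk₀, hc _ (K.lie_mem hk₀), lie_smul, hπ, sub_self, map_zero]
  obtain ⟨φ₀, hφ₀A, hφ₀ε, hφ₀C⟩ : ∃ φ ∈ A, ε φ = 1 ∧ ∀ x : g, ⁅x, φ⁆ ∈ C := by
    let C' : LieSubmodule F g A := C.comap A.incl
    have memC' : ∀ φ : A, φ ∈ C' ↔ (φ : g →ₗ[F] (g ⧸ K')) ∈ C := fun φ => Iff.rfl
    let q : A →ₗ[F] (A ⧸ C') := LieSubmodule.Quotient.mk' C'
    have hq0 : ∀ φ : A, q φ = 0 ↔ (φ : g →ₗ[F] (g ⧸ K')) ∈ C :=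
      fun φ => LieSubmodule.Quotient.mk_eq_zero'
    have hqs : Function.Surjective q := LieSubmodule.Quotient.surjective_mk' C'
    have hqact : ∀ (x : g) (φ : A), ⁅x, q φ⁆ = q ⁅x, φ⁆ := fun x φ => rfl
    obtain ⟨ρ, hρ⟩ := lie_factor p hp (LieModule.toEnd F g (A ⧸ C')) (by
      intro x hx
      ext φ
      obtain ⟨φ, rfl⟩ := hqs φ
      rw [LieModule.toEnd_apply_apply, hqact, LinearMap.zero_apply, hq0]
      obtain ⟨φ, h1, c, hc⟩ := φ
      refine ⟨- (c • x), K.neg_mem (K.smul_mem c ((memK x).2 hx)), fun y => ?_⟩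
      have := hKact x ((memK x).2 hx) φ c h1 hc y
      rw [neg_lie, smul_lie, map_neg, map_smul]
      exact this)
    let ε' : (A ⧸ C') →ₗ[F] F := C'.toSubmodule.liftQ (ε.comp A.toSubmodule.subtype)
      (fun φ hφ => hεC _ hφ)
    have hε' : ∀ φ : A, ε' (q φ) = ε φ := fun φ => rfl
    obtain ⟨Q, hQ⟩ := Submodule.exists_isCompl K.toSubmodule
    have hproj : π.comp (K.toSubmodule.subtype.comp (K.toSubmodule.projectionOnto Q hQ)) ∈ A := by
      refine ⟨fun m => ⟨_, (K.toSubmodule.projectionOnto Q hQ m).2, rfl⟩, 1, fun k hk => ?_⟩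
      have := Submodule.projectionOnto_apply_left hQ ⟨k, hk⟩
      simp only [LinearMap.comp_apply, Submodule.subtype_apply, one_smul]
      rw [this]
    have hε'0 : ε' ≠ 0 := by
      intro h0
      have h1 := LinearMap.congr_fun h0 (q ⟨_, hproj⟩)
      have := Submodule.projectionOnto_apply_left hQ ⟨k₀, hk₀⟩
      rw [hε', hε] at h1
      simp only [LinearMap.comp_apply, Submodule.subtype_apply] at h1
      rw [this] at h1
      simp [hf] at h1
    obtain ⟨m, hm1, hm2⟩ := weyl_codim_one ρ ε' hε'0 (by
      intro y m
      obtain ⟨x, rfl⟩ := hp y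
      obtain ⟨φ, rfl⟩ := hqs m
      rw [hρ, LieModule.toEnd_apply_apply, hqact, hε']
      exact hεact x φ φ.2)
    obtain ⟨φ, rfl⟩ := hqs m
    refine ⟨φ, φ.2, by rw [← hε', hm1], fun x => ?_⟩
    have := hm2 (p x)
    rw [hρ, LieModule.toEnd_apply_apply, hqact, hq0] at this
    exact this
  -- correct `φ₀` so that it is killed by `T`
  let N : Submodule F (g →ₗ[F] (g ⧸ K')) :=
    { carrier := {φ | φ ∈ A ∧ ∀ x : g, ⁅x, φ⁆ ∈ C}
      add_mem' := fun {φ ψ} h h' => ⟨A.add_mem h.1 h'.1, fun x => by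
        rw [lie_add]; exact C.add_mem (h.2 x) (h'.2 x)⟩
      zero_mem' := ⟨A.zero_mem, fun x => by rw [lie_zero]; exact C.zero_mem⟩
      smul_mem' := fun c φ h => ⟨A.smul_mem c h.1, fun x => by
        rw [lie_smul]; exact C.smul_mem c (h.2 x)⟩ }
  have hTN : ∀ φ ∈ N, T φ ∈ N := fun φ h => ⟨hTA φ h.1, fun x => by
    have h1 : ⁅x, T φ⁆ = T ⁅x, φ⁆ - ⁅δ x, φ⁆ := by rw [hTact]; abel
    rw [h1]; exact C.sub_mem (hTC _ (h.2 x)) (h.2 _)⟩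
  obtain ⟨φ, hφN, hφε, hφT⟩ : ∃ φ ∈ N, ε φ = 1 ∧ T φ = 0 := by
    have hq : ∀ q : F[X], aeval T q φ₀ ∈ N ∧ ε (aeval T q φ₀) = q.coeff 0 := by
      intro q
      induction q using Polynomial.induction_on with
      | C a =>
        simp only [aeval_C, Algebra.algebraMap_eq_smul_one, LinearMap.smul_apply,
          Module.End.one_apply, map_smul, hφ₀ε, coeff_C_zero, smul_eq_mul, mul_one, and_true]
        exact N.smul_mem _ ⟨hφ₀A, hφ₀C⟩
      | add p q hp hq =>
        simp only [map_add, LinearMap.add_apply, coeff_add, hp.2, hq.2, and_true]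
        exact N.add_mem hp.1 hq.1
      | monomial n a h =>
        rw [pow_succ, ← mul_assoc, mul_comm _ X, map_mul (aeval T) X _, aeval_X,
          Module.End.mul_apply, mul_coeff_zero, coeff_X_zero, zero_mul]
        exact ⟨hTN _ h.1, hεT _ h.1.1⟩
    refine ⟨(r.coeff 0)⁻¹ • aeval T r φ₀, N.smul_mem _ (hq r).1, ?_, ?_⟩
    · rw [map_smul, (hq r).2, smul_eq_mul, inv_mul_cancel₀ hr0]
    · rw [map_smul, ← Module.End.mul_apply, hr]; simp
  obtain ⟨⟨hφ1, c, hc⟩, hφC⟩ := hφN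
  have hc1 : c = 1 := by
    rw [hε, hc _ hk₀, map_smul, hf] at hφε
    simpa using hφε
  subst hc1
  have hc' : ∀ k ∈ K, φ k = π k := fun k hk => by rw [hc k hk, one_smul]
  have hφδ : ∀ y, φ (δ y) = δ' (φ y) := fun y => by
    have := hT φ y
    rw [hφT] at this
    exact (sub_eq_zero.1 this.symm).symm
  let L : LieSubalgebra F g :=
    { carrier := {x | ⁅x, φ⁆ = 0}
      add_mem' := fun {x y} h h' => by
        change ⁅x + y, φ⁆ = 0
        rw [add_lie, h, h', add_zero]
      zero_mem' := zero_lie _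
      smul_mem' := fun c x h => by
        change ⁅c • x, φ⁆ = 0
        rw [smul_lie, h, smul_zero]
      lie_mem' := fun {x y} h h' => by
        change ⁅⁅x, y⁆, φ⁆ = 0
        rw [lie_lie, h, h', lie_zero, lie_zero, sub_zero] }
  have memL : ∀ x, x ∈ L ↔ ⁅x, φ⁆ = 0 := fun x => Iff.rfl
  by_cases hL : L = ⊤
  · let L' : LieSubalgebra F g :=
      { LinearMap.ker φ with
        lie_mem' := fun {x y} _ h' => by
          have h1 : ⁅x, φ⁆ y = 0 := by
            rw [(memL x).1 (hL ▸ LieSubalgebra.mem_top x)]; rfl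
          rw [hact, LinearMap.mem_ker.1 h', lie_zero, zero_sub, neg_eq_zero] at h1
          exact h1 }
    have memL' : ∀ x, x ∈ L' ↔ φ x = 0 := fun x => Iff.rfl
    refine ⟨L', fun h => hπk₀ ?_, fun x hx => ?_, fun y => ?_⟩
    · rw [← hc' _ hk₀]
      exact (memL' _).1 (h ▸ LieSubalgebra.mem_top _)
    · rw [memL', hφδ, (memL' _).1 hx, map_zero]
    · obtain ⟨x, rfl⟩ := hp y
      obtain ⟨k, hk, hk'⟩ := hφ1 x
      refine ⟨x - k, ?_, ?_⟩
      · rw [memL', map_sub, hk', hc' k hk, sub_self]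
      · rw [map_sub, (memK k).1 hk, sub_zero]
  · refine ⟨L, hL, fun x hx => ?_, fun y => ?_⟩
    · have := hTact x φ
      rw [(memL x).1 hx, hφT, lie_zero, map_zero, add_zero] at this
      exact (memL _).2 this.symm
    · obtain ⟨x, rfl⟩ := hp y
      obtain ⟨s, hs, hs'⟩ := hφC x
      refine ⟨x + s, ?_, ?_⟩
      · rw [memL, add_lie]
        ext z
        rw [LinearMap.add_apply, hs', hKact s hs φ 1 hφ1 hc]; simp
      · rw [map_add, (memK s).1 hs, add_zero]

theorem isSolvable_of_le {g : Type*} [LieRing g] [LieAlgebra F g] {h : Type*} [LieRing h]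
    [LieAlgebra F h] (p : g →ₗ⁅F⁆ S) (i : h →ₗ⁅F⁆ g) (hi : Function.Injective i)
    (hK : LieAlgebra.IsSolvable p.ker) : LieAlgebra.IsSolvable (p.comp i).ker := by
  let j : (p.comp i).ker →ₗ⁅F⁆ p.ker :=
    { toFun := fun x => ⟨i x, by
        have := x.2
        rw [LieHom.mem_ker] at this ⊢
        exact this⟩
      map_add' := fun x y => by ext; simp
      map_smul' := fun c x => by ext; simp
      map_lie' := fun {x y} => by ext; simp }
  have hj : Function.Injective j := fun x y h => by
    have : i x = i y := congrArg Subtype.val h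
    exact Subtype.ext (hi this)
  exact hj.lieAlgebra_isSolvable

/-- Levi decomposition stable under a semisimple derivation. -/
theorem levi {g : Type*} [LieRing g] [LieAlgebra F g] [FiniteDimensional F g]
    (p : g →ₗ⁅F⁆ S) (hp : Function.Surjective p) (hK : LieAlgebra.IsSolvable p.ker)
    (δ : End F g) (hδ : δ.IsSemisimple) (hder : ∀ x y, δ ⁅x, y⁆ = ⁅δ x, y⁆ + ⁅x, δ y⁆)
    (hδK : ∀ x, p x = 0 → p (δ x) = 0) :
    ∃ L : LieSubalgebra F g, (∀ x ∈ L, δ x ∈ L) ∧ (∀ y, ∃ x ∈ L, p x = y) ∧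
      ∀ x ∈ L, p x = 0 → x = 0 := by
  classical
  let P : ℕ → Prop := fun n => ∃ L : LieSubalgebra F g, finrank F L = n ∧
    (∀ x ∈ L, δ x ∈ L) ∧ (∀ y, ∃ x ∈ L, p x = y)
  have hP : ∃ n, P n := ⟨_, ⊤, rfl, fun x _ => LieSubalgebra.mem_top _, fun y => by
    obtain ⟨x, rfl⟩ := hp y
    exact ⟨x, LieSubalgebra.mem_top _, rfl⟩⟩
  obtain ⟨L, hLn, hLδ, hLs⟩ := Nat.find_spec hP
  refine ⟨L, hLδ, hLs, ?_⟩
  by_contra hcon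
  push Not at hcon
  obtain ⟨x₀, hx₀, hpx₀, hx₀0⟩ := hcon
  let p' : L →ₗ⁅F⁆ S := p.comp L.incl
  have hp' : ∀ x : L, p' x = p x := fun x => rfl
  let δ' : End F L := δ.restrict (p := L.toSubmodule) (q := L.toSubmodule) hLδ
  have hδ' : ∀ x : L, (δ' x : g) = δ x := fun x => rfl
  obtain ⟨M, hM1, hM2, hM3⟩ := levi_step p' (fun y => by
      obtain ⟨x, hx, rfl⟩ := hLs y
      exact ⟨⟨x, hx⟩, rfl⟩) (isSolvable_of_le p L.incl Subtype.val_injective hK) δ'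
      (hδ.restrict hLδ) (fun x y => by ext; simp [hδ', hder])
      (fun x hx => hδK x hx) (fun h => hx₀0 (by
        have : (⟨x₀, hx₀⟩ : L) ∈ p'.ker := LieHom.mem_ker.2 hpx₀
        rw [h, LieSubmodule.mem_bot] at this
        exact congrArg Subtype.val this))
  have hlt : finrank F M < finrank F L :=
    Submodule.finrank_lt (s := M.toSubmodule)
      (fun h : M.toSubmodule = ⊤ =>
      hM1 (by rw [← LieSubalgebra.toSubmodule_inj, h]; rfl))
  refine Nat.find_min hP (m := finrank F M) (hLn ▸ hlt) ⟨M.map L.incl, ?_, ?_, ?_⟩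
  · exact (LinearEquiv.finrank_eq (Submodule.equivMapOfInjective (L.incl : L →ₗ[F] g)
      Subtype.val_injective M.toSubmodule)).symm
  · rintro x ⟨y, hy, rfl⟩
    exact ⟨δ' y, hM2 y hy, rfl⟩
  · intro y
    obtain ⟨x, hx, rfl⟩ := hM3 y
    exact ⟨x, ⟨x, hx, rfl⟩, rfl⟩

end Levi
end AJCD

namespace AJCD
open Module Polynomial LinearMap
set_option linter.unusedSectionVars false

section Jac
variable {F : Type*} [Field F] [CharZero F] {V : Type*} [AddCommGroup V] [Module F V]
  [FiniteDimensional F V]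

/-- The trace-radical of a subalgebra of `End V`. -/
def jac (𝒜 : Subalgebra F (End F V)) : Submodule F (End F V) where
  carrier := {b | b ∈ 𝒜 ∧ ∀ c ∈ 𝒜, trace F V (c * b) = 0}
  add_mem' := fun {a b} ha hb => ⟨𝒜.add_mem ha.1 hb.1, fun c hc => by
    rw [mul_add, map_add, ha.2 c hc, hb.2 c hc, add_zero]⟩
  zero_mem' := ⟨𝒜.zero_mem, fun c _ => by simp⟩
  smul_mem' := fun t b hb => ⟨𝒜.smul_mem hb.1 t, fun c hc => by
    rw [mul_smul_comm, map_smul, hb.2 c hc, smul_zero]⟩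

variable {𝒜 : Subalgebra F (End F V)}

theorem mem_jac {b : End F V} : b ∈ jac 𝒜 ↔ b ∈ 𝒜 ∧ ∀ c ∈ 𝒜, trace F V (c * b) = 0 := Iff.rfl

theorem jac_mul_left {a b : End F V} (ha : a ∈ 𝒜) (hb : b ∈ jac 𝒜) : a * b ∈ jac 𝒜 :=
  ⟨𝒜.mul_mem ha hb.1, fun c hc => by rw [← mul_assoc]; exact hb.2 _ (𝒜.mul_mem hc ha)⟩

theorem jac_mul_right {a b : End F V} (ha : a ∈ 𝒜) (hb : b ∈ jac 𝒜) : b * a ∈ jac 𝒜 :=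
  ⟨𝒜.mul_mem hb.1 ha, fun c hc => by
    rw [← mul_assoc, trace_mul_comm, ← mul_assoc]; exact hb.2 _ (𝒜.mul_mem ha hc)⟩

theorem jac_nilp {b : End F V} (hb : b ∈ jac 𝒜) : IsNilpotent b :=
  isNilpotent_of_trace_pow b fun k => hb.2 _ (𝒜.pow_mem hb.1 k)

theorem jac_lie_pow {q y : End F V} (hy : y ∈ 𝒜) (h : q * y - y * q ∈ jac 𝒜) (k : ℕ) :
    q * y ^ k - y ^ k * q ∈ jac 𝒜 := by
  induction k with
  | zero => simp
  | succ k ih =>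
    have : q * y ^ (k + 1) - y ^ (k + 1) * q =
        (q * y ^ k - y ^ k * q) * y + y ^ k * (q * y - y * q) := by
      rw [pow_succ]; noncomm_ring
    rw [this]
    exact add_mem (jac_mul_right hy ih) (jac_mul_left (𝒜.pow_mem hy k) h)

variable {G : Type*} [LieRing G] [LieAlgebra F G] [FiniteDimensional F G]
  [LieRingModule G V] [LieModule F G V]

variable (F G V) in
/-- The associative algebra generated by a representation. -/
def env : Subalgebra F (End F V) :=
  Algebra.adjoin F (Set.range (LieModule.toEnd F G V))

theorem toEnd_mem_env (x : G) : LieModule.toEnd F G V x ∈ env F V G :=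
  Algebra.subset_adjoin ⟨x, rfl⟩

theorem env_stable (N : LieSubmodule F G V) {c : End F V} (hc : c ∈ env F V G) :
    ∀ v ∈ N, c v ∈ N := by
  induction hc using Algebra.adjoin_induction with
  | mem x hx => obtain ⟨y, rfl⟩ := hx; exact fun v hv => N.lie_mem hv
  | algebraMap r => exact fun v hv => N.smul_mem r hv
  | add x y _ _ h1 h2 => exact fun v hv => N.add_mem (h1 v hv) (h2 v hv)
  | mul x y _ _ h1 h2 => exact fun v hv => h1 _ (h2 v hv)

theorem engel_step (I : LieIdeal F G) (h : ∀ u ∈ I, IsNilpotent (LieModule.toEnd F G V u)) :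
    ∀ u ∈ I, LieModule.toEnd F G V u ∈ jac (env F V G) := by
  intro u hu
  refine ⟨toEnd_mem_env u, fun c hc => trace_eq_zero_of_isNilpotent ?_⟩
  have hnil : LieModule.IsNilpotent I V := by
    rw [LieModule.isNilpotent_iff_forall' (R := F)]
    exact fun x => h x x.2
  obtain ⟨k, hk⟩ := (LieModule.isNilpotent_iff F I V).1 hnil
  refine ⟨k, ?_⟩
  have key : ∀ k v, ((c * LieModule.toEnd F G V u) ^ k) v ∈ I.lcs V k := by
    intro k
    induction k with
    | zero => intro v; simp
    | succ k ih =>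
      intro v
      rw [pow_succ', Module.End.mul_apply, Module.End.mul_apply, LieIdeal.lcs_succ]
      exact env_stable _ hc _ (LieSubmodule.lie_mem_lie hu (ih v))
  ext v
  have h1 := key k v
  rw [← LieSubmodule.mem_toSubmodule, LieIdeal.coe_lcs_eq, hk] at h1
  simpa using h1

theorem key_step (I P Q : LieIdeal F G) (hI : I ≤ ⁅P, Q⁆)
    (h : ∀ q ∈ Q, ∀ a ∈ I, LieModule.toEnd F G V ⁅q, a⁆ ∈ jac (env F V G)) :
    ∀ u ∈ I, LieModule.toEnd F G V u ∈ jac (env F V G) := by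
  refine engel_step I fun u hu => isNilpotent_of_trace_pow _ fun k => ?_
  have key : ∀ z ∈ ⁅P, Q⁆, trace F V
      (LieModule.toEnd F G V u ^ k * LieModule.toEnd F G V z) = 0 := by
    intro z hz
    rw [← LieSubmodule.mem_toSubmodule, LieSubmodule.lieIdeal_oper_eq_linear_span'] at hz
    induction hz using Submodule.span_induction with
    | mem x hx =>
      obtain ⟨p, hp, q, hq, rfl⟩ := hx
      have h1 := h q hq u hu
      rw [LieHom.map_lie, LieRing.of_associative_ring_bracket] at h1
      have h2 := (jac_lie_pow (toEnd_mem_env u) h1 k).2 _ (toEnd_mem_env p)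
      rw [LieHom.map_lie, LieRing.of_associative_ring_bracket]
      generalize LieModule.toEnd F G V u ^ k = y at *
      generalize LieModule.toEnd F G V p = p at *
      generalize LieModule.toEnd F G V q = q at *
      rw [mul_sub, map_sub] at h2 ⊢
      rw [trace_mul_comm F y (p * q), ← mul_assoc y q p, trace_mul_comm F (y * q) p, mul_assoc]
      exact h2
    | zero => simp
    | add x y _ _ h1 h2 => rw [map_add, mul_add, map_add, h1, h2, add_zero]
    | smul c x _ h1 => rw [map_smul, mul_smul_comm, map_smul, h1, smul_zero]
  exact key u (hI hu)

theorem solv_step : ∀ u ∈ LieAlgebra.radical F G, u ∈ LieAlgebra.derivedSeries F G 1 →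
    LieModule.toEnd F G V u ∈ jac (env F V G) := by
  set R := LieAlgebra.radical F G
  let D : ℕ → LieIdeal F G := fun i => LieAlgebra.derivedSeriesOfIdeal F G i R
  have hD0 : D 0 = R := rfl
  have hDs : ∀ i, D (i + 1) = ⁅D i, D i⁆ := fun i =>
    LieAlgebra.derivedSeriesOfIdeal_succ F G R i
  obtain ⟨k, hk⟩ : ∃ k, D k = ⊥ := by
    obtain ⟨k, hk⟩ := (LieAlgebra.isSolvable_iff F _).1
      (inferInstance : LieAlgebra.IsSolvable (LieAlgebra.radical F G))
    rw [LieIdeal.derivedSeries_eq_bot_iff] at hk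
    exact ⟨k, hk⟩
  -- if `[a,a] ⊆ J` then `[G,a] ⊆ J`
  have hA : ∀ I : LieIdeal F G,
      (∀ u ∈ ⁅I, I⁆, LieModule.toEnd F G V u ∈ jac (env F V G)) →
      ∀ u ∈ ⁅(⊤ : LieIdeal F G), I⁆, LieModule.toEnd F G V u ∈ jac (env F V G) := by
    intro I hI
    refine key_step _ ⊤ I le_rfl fun q hq a ha => hI _ (LieSubmodule.lie_mem_lie hq ?_)
    exact LieSubmodule.lie_le_right _ _ ha
  have hB : ∀ i, ∀ u ∈ D (i + 1), LieModule.toEnd F G V u ∈ jac (env F V G) := by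
    have hDle : ∀ i, D i ≤ R := by
      intro i
      induction i with
      | zero => exact le_rfl
      | succ i ih => rw [hDs]; exact (LieSubmodule.lie_le_right _ _).trans ih
    have hstep : ∀ i, (∀ u ∈ D (i + 2), LieModule.toEnd F G V u ∈ jac (env F V G)) →
        ∀ u ∈ D (i + 1), LieModule.toEnd F G V u ∈ jac (env F V G) := by
      intro i hi
      refine key_step _ R R ?_ fun q hq a ha => hA (D (i + 1)) (hDs (i + 1) ▸ hi) _
        (LieSubmodule.lie_mem_lie (LieSubmodule.mem_top q) ha)
      rw [hDs]; exact LieSubmodule.mono_lie (hDle i) (hDle i)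
    have hdown : ∀ j i, k ≤ i + 1 + j →
        ∀ u ∈ D (i + 1), LieModule.toEnd F G V u ∈ jac (env F V G) := by
      intro j
      induction j with
      | zero =>
        intro i hi u hu
        have : D (i + 1) ≤ D k := LieAlgebra.derivedSeriesOfIdeal_antitone R hi
        have := this hu
        rw [hk, LieSubmodule.mem_bot] at this
        rw [this, map_zero]; exact zero_mem _
      | succ j ih => exact fun i hi => hstep i (ih (i + 1) (by omega))
    exact fun i => hdown k i (by omega)
  have hC := hA R (hB 0)
  have hE := key_step (V := V) (LieAlgebra.derivedSeries F G 1 ⊓ R) ⊤ ⊤ inf_le_left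
    (fun q hq a ha => hC _ (LieSubmodule.lie_mem_lie hq ha.2))
  exact fun u hu hu' => hE u ⟨hu', hu⟩

end Jac
end AJCD

namespace AJCD
open Module Polynomial LinearMap
set_option linter.unusedSectionVars false

section CoreA
variable {F : Type*} [Field F] [CharZero F] {V : Type*} [AddCommGroup V] [Module F V]
  [FiniteDimensional F V] {S : Type*} [LieRing S] [LieAlgebra F S]
  [FiniteDimensional F S] [LieAlgebra.HasTrivialRadical F S]

theorem lie_End (a b : End F V) : ⁅a, b⁆ = a * b - b * a := rfl

theorem adjoin_stable {W : Type*} [AddCommGroup W] [Module F W] {a b : End F W}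
    (hb : b ∈ Algebra.adjoin F {a}) (N : Submodule F W) (h : ∀ v ∈ N, a v ∈ N) :
    ∀ v ∈ N, b v ∈ N := by
  induction hb using Algebra.adjoin_induction with
  | mem x hx => rw [Set.mem_singleton_iff.1 hx]; exact h
  | algebraMap r => exact fun v hv => N.smul_mem r hv
  | add x y _ _ h1 h2 => exact fun v hv => N.add_mem (h1 v hv) (h2 v hv)
  | mul x y _ _ h1 h2 => exact fun v hv => h1 _ (h2 v hv)

theorem commute_adjoin {A : Type*} [Ring A] [Algebra F A] {a b c : A}
    (hb : b ∈ Algebra.adjoin F {a}) (h : Commute a c) : Commute b c := by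
  induction hb using Algebra.adjoin_induction with
  | mem x hx => rw [Set.mem_singleton_iff.1 hx]; exact h
  | algebraMap r => exact Algebra.commutes r c
  | add x y _ _ h1 h2 => exact h1.add_left h2
  | mul x y _ _ h1 h2 => exact h1.mul_left h2

theorem trace_commute_rep (τ : S →ₗ⁅F⁆ End F V) (z : End F V) (hz : ∀ y, Commute z (τ y))
    (y : S) : trace F V (z * τ y) = 0 := by
  have hy : y ∈ ⁅(⊤ : LieIdeal F S), (⊤ : LieIdeal F S)⁆ := by
    rw [ideal_perfect]; exact LieSubmodule.mem_top y
  rw [← LieSubmodule.mem_toSubmodule, LieSubmodule.lieIdeal_oper_eq_linear_span'] at hy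
  induction hy using Submodule.span_induction with
  | mem x hx =>
    obtain ⟨p, -, q, -, rfl⟩ := hx
    rw [LieHom.map_lie, lie_End, mul_sub, map_sub, ← mul_assoc, (hz p).eq, mul_assoc,
      trace_mul_comm F (τ p), mul_assoc, sub_self]
  | zero => simp
  | add x y _ _ h1 h2 => rw [map_add, mul_add, map_add, h1, h2, add_zero]
  | smul c x _ h1 => rw [map_smul, mul_smul_comm, map_smul, h1, smul_zero]

/-- If `ad d` is semisimple on the image of a semisimple Lie algebra, and `d` is in the image,
then `d` is semisimple. -/
theorem semisimple_of_rep (τ : S →ₗ⁅F⁆ End F V) (s : End F V) (hs : s.IsSemisimple) (d₀ : S)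
    (hd : ∀ y, ⁅s, τ y⁆ = ⁅τ d₀, τ y⁆) : (τ d₀).IsSemisimple := by
  obtain ⟨n, hn, t, ht, hnn, hts, hnt⟩ := (τ d₀).exists_isNilpotent_isSemisimple
  have hnτ : Commute (τ d₀) n := (commute_adjoin hn (Commute.refl _)).symm
  have hcnt : Commute n t := commute_adjoin hn (commute_adjoin ht (Commute.refl _)).symm
  let N : Submodule F (End F V) := LinearMap.range (τ : S →ₗ[F] End F V)
  have hNd : ∀ v ∈ N, LieAlgebra.ad F _ (τ d₀) v ∈ N := by
    rintro _ ⟨y, rfl⟩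
    exact ⟨⁅d₀, y⁆, LieHom.map_lie _ _ _⟩
  have hNs : ∀ v ∈ N, LieAlgebra.ad F _ s v ∈ N := by
    rintro _ ⟨y, rfl⟩
    exact ⟨⁅d₀, y⁆, (LieHom.map_lie _ _ _).trans (hd y).symm⟩
  have hadn := LieAlgebra.ad_mem_adjoin_of_isNilpotent hcnt hnn hts
  have hadt := LieAlgebra.ad_mem_adjoin_of_isSemisimple hcnt hnn hts
  rw [← hnt] at hadn hadt
  have hNn := adjoin_stable hadn N hNd
  have hNt := adjoin_stable hadt N hNd
  have h1 : ((LieAlgebra.ad F _ n).restrict hNn) = 0 := by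
    refine Module.End.eq_zero_of_isNilpotent_isSemisimple ?_ ?_
    · obtain ⟨k, hk⟩ := LieAlgebra.ad_nilpotent_of_nilpotent (R := F) hnn
      refine ⟨k, ?_⟩
      rw [Module.End.pow_restrict]
      ext v
      simp [hk]
    · have h2 : ((LieAlgebra.ad F _ n).restrict hNn) =
          ((LieAlgebra.ad F _ s).restrict hNs) - ((LieAlgebra.ad F _ t).restrict hNt) := by
        ext1 ⟨v, y, hy⟩
        apply Subtype.ext
        change ⁅n, v⁆ = ⁅s, v⁆ - ⁅t, v⁆
        have : v = τ y := hy.symm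
        rw [this, hd, hnt, add_lie, add_sub_cancel_right]
      have h3 : ((LieAlgebra.ad F _ s).restrict hNs) = (LieAlgebra.ad F _ (τ d₀)).restrict hNd := by
        ext1 ⟨v, y, hy⟩
        apply Subtype.ext
        change ⁅s, v⁆ = ⁅τ d₀, v⁆
        have : v = τ y := hy.symm
        rw [this, hd]
      rw [h2]
      refine Module.End.IsSemisimple.sub_of_commute ?_ ?_ ?_
      · rw [h3]
        ext1 v
        apply Subtype.ext
        have := commute_adjoin hadt (Commute.refl _)
        exact (LinearMap.congr_fun this.eq v).symm
      · exact (LieAlgebra.ad_isSemisimple_of_isSemisimple hs).restrict hNs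
      · exact (LieAlgebra.ad_isSemisimple_of_isSemisimple hts).restrict hNt
  have hcomm : ∀ y, Commute n (τ y) := by
    intro y
    have := congrArg Subtype.val (LinearMap.congr_fun h1 ⟨τ y, y, rfl⟩)
    exact sub_eq_zero.1 this
  obtain ⟨φ, hφ1, hφ2, hφ3⟩ := weyl_complement τ (LinearMap.ker n) (by
    intro y v hv
    rw [LinearMap.mem_ker] at hv ⊢
    rw [← Module.End.mul_apply, (hcomm y).eq, Module.End.mul_apply, hv, map_zero])
  have hφn : ∀ v, φ (n v) = 0 := by
    intro v
    rw [← Module.End.mul_apply, ← (commute_adjoin hn (hφ3 d₀)).eq, Module.End.mul_apply]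
    exact hφ1 v
  have hker : ∀ v, n (n v) = 0 → n v = 0 := fun v hv => by
    rw [← hφ2 (n v) hv, hφn]
  have hn0 : n = 0 := by
    obtain ⟨k, hk⟩ := hnn
    induction k with
    | zero =>
      rw [pow_zero] at hk
      rw [← mul_one n, hk, mul_zero]
    | succ k ih =>
      rcases k with _ | k
      · simpa using hk
      · refine ih ?_
        ext v
        rw [pow_succ', Module.End.mul_apply]
        apply hker
        have := LinearMap.congr_fun hk v
        rwa [pow_succ', pow_succ'] at this
  rw [hnt, hn0, zero_add]; exact hts

theorem jac_mul_pow {𝒜 : Subalgebra F (End F V)} {a b : End F V} (ha : a ∈ 𝒜) (hb : b ∈ 𝒜)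
    (h : a * b - b * a ∈ jac 𝒜) (j : ℕ) : (a * b) ^ j - a ^ j * b ^ j ∈ jac 𝒜 := by
  induction j with
  | zero => simp
  | succ j ih =>
    have : (a * b) ^ (j + 1) - a ^ (j + 1) * b ^ (j + 1) =
        ((a * b) ^ j - a ^ j * b ^ j) * (a * b) + - (a ^ j * (a * b ^ j - b ^ j * a) * b) := by
      rw [pow_succ, pow_succ, pow_succ]; noncomm_ring
    rw [this]
    exact add_mem (jac_mul_right (𝒜.mul_mem ha hb) ih) (neg_mem
      (jac_mul_right hb (jac_mul_left (𝒜.pow_mem ha j) (jac_lie_pow hb h j))))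

/-- The core of the argument. -/
theorem coreA (𝒜 : Subalgebra F (End F V)) (τ : S →ₗ⁅F⁆ End F V) (hτ : ∀ y, τ y ∈ 𝒜)
    (x s n u : End F V) (a : S) (hx : x = τ a + u) (hu : u ∈ jac 𝒜) (hxs : x = n + s)
    (hs𝒜 : s ∈ 𝒜) (hs : s.IsSemisimple) (hn : IsNilpotent n)
    (D : LieDerivation F S S) (hD : ∀ y, ⁅s, τ y⁆ = τ (D y)) : ∃ d, τ d = s := by
  obtain ⟨d, hd⟩ := LieDerivation.IsKilling.exists_eq_ad D
  have hsd : ∀ y, ⁅s, τ y⁆ = ⁅τ d, τ y⁆ := by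
    intro y
    rw [hD, ← hd, LieDerivation.ad_apply_apply, LieHom.map_lie]
  have hdss := semisimple_of_rep τ s hs d hsd
  refine ⟨d, ?_⟩
  obtain ⟨m, hm⟩ : ∃ m, m = s - τ d := ⟨_, rfl⟩
  have hmτ : ∀ y, Commute m (τ y) := by
    intro y
    have : ⁅m, τ y⁆ = 0 := by rw [hm, sub_lie, hsd, sub_self]
    exact sub_eq_zero.1 this
  have hsm : s = m + τ d := by rw [hm]; abel
  have hms : Commute m s := by
    rw [hsm]; exact (Commute.refl m).add_right (hmτ d)
  have hm𝒜 : m ∈ 𝒜 := hm ▸ 𝒜.sub_mem hs𝒜 (hτ d)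
  have hx𝒜 : x ∈ 𝒜 := hx ▸ 𝒜.add_mem (hτ a) hu.1
  have hnx : n = x - s := by rw [hxs]; abel
  have hn𝒜 : n ∈ 𝒜 := hnx ▸ 𝒜.sub_mem hx𝒜 hs𝒜
  have hnm : n * m - m * n ∈ jac 𝒜 := by
    have : n * m - m * n = u * m - m * u := by
      have h1 := (hmτ a).eq
      have h2 := hms.eq
      rw [hnx, hx, sub_mul, mul_sub, add_mul, mul_add, h1, h2]; abel
    rw [this]
    exact sub_mem (jac_mul_right hm𝒜 hu) (jac_mul_left hm𝒜 hu)
  have hmnil : IsNilpotent m := by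
    refine isNilpotent_of_trace_pow m fun k => ?_
    have h1 : trace F V (m ^ k * τ d) = 0 :=
      trace_commute_rep τ _ (fun y => (hmτ y).pow_left k) d
    have h2 : trace F V (m ^ k * x) = 0 := by
      rw [hx, mul_add, map_add, trace_commute_rep τ _ (fun y => (hmτ y).pow_left k) a,
        hu.2 _ (𝒜.pow_mem hm𝒜 k), add_zero]
    have h3 : trace F V (m ^ k * n) = 0 := by
      have h4 := jac_lie_pow hm𝒜 hnm k
      have h5 : m ^ k * n - n * m ^ k ∈ jac 𝒜 := by
        rw [← neg_sub]; exact neg_mem h4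
      obtain ⟨j, hj⟩ := hn
      have h6 := jac_mul_pow (𝒜.pow_mem hm𝒜 k) hn𝒜 h5 j
      rw [hj, mul_zero, sub_zero] at h6
      obtain ⟨i, hi⟩ := jac_nilp h6
      exact trace_eq_zero_of_isNilpotent ⟨j * i, by rw [pow_mul, hi]⟩
    have h7 : m ^ k * m = m ^ k * x - m ^ k * n - m ^ k * τ d := by
      rw [← mul_sub, ← mul_sub, hnx, hm]; congr 1; abel
    rw [h7, map_sub, map_sub, h1, h2, h3]; simp
  have hmss : m.IsSemisimple := hm ▸ hs.sub_of_commute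
    (by
      have : τ d = s - m := by rw [hm]; abel
      rw [this]; exact (Commute.refl s).sub_right hms.symm) hdss
  have := Module.End.eq_zero_of_isNilpotent_isSemisimple hmnil hmss
  rw [hm, sub_eq_zero] at this
  exact this.symm

end CoreA
end AJCD

namespace AJCD
open Module Polynomial LinearMap
set_option linter.unusedSectionVars false

section LeviSection
variable {F : Type*} [Field F] [CharZero F] {S : Type*} [LieRing S] [LieAlgebra F S]
  [FiniteDimensional F S] [LieAlgebra.HasTrivialRadical F S]

theorem levi_section {g : Type*} [LieRing g] [LieAlgebra F g] [FiniteDimensional F g]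
    (p : g →ₗ⁅F⁆ S) (hp : Function.Surjective p) (hK : LieAlgebra.IsSolvable p.ker)
    (δ : End F g) (hδ : δ.IsSemisimple) (hder : ∀ x y, δ ⁅x, y⁆ = ⁅δ x, y⁆ + ⁅x, δ y⁆)
    (hδK : ∀ x, p x = 0 → p (δ x) = 0) :
    ∃ σ : S →ₗ⁅F⁆ g, (∀ y, p (σ y) = y) ∧
      ∃ D : LieDerivation F S S, ∀ y, δ (σ y) = σ (D y) := by
  obtain ⟨L, hL1, hL2, hL3⟩ := levi p hp hK δ hδ hder hδK
  let e : L ≃ₗ⁅F⁆ S := LieEquiv.ofBijective (p.comp L.incl) ⟨by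
      intro x y hxy
      have : p ((x : g) - y) = 0 := by rw [map_sub, sub_eq_zero]; exact hxy
      have := hL3 _ (L.sub_mem x.2 y.2) this
      exact Subtype.ext (sub_eq_zero.1 this), fun y => by
      obtain ⟨x, hx, rfl⟩ := hL2 y
      exact ⟨⟨x, hx⟩, rfl⟩⟩
  have he : ∀ x : L, e x = p x := fun x => rfl
  let σ : S →ₗ⁅F⁆ g := L.incl.comp e.symm.toLieHom
  have hσ : ∀ y, σ y = (e.symm y : g) := fun y => rfl
  have hpσ : ∀ y, p (σ y) = y := fun y => by
    rw [hσ, ← he]; exact e.apply_symm_apply y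
  have hσp : ∀ x ∈ L, σ (p x) = x := fun x hx => by
    have : (σ (p x) - x) = 0 := hL3 _ (L.sub_mem (e.symm (p x)).2 hx) (by
      rw [map_sub, hpσ, sub_self])
    exact sub_eq_zero.1 this
  have hδσ : ∀ y, σ (p (δ (σ y))) = δ (σ y) := fun y => hσp _ (hL1 _ (e.symm y).2)
  refine ⟨σ, hpσ, ⟨(p : g →ₗ[F] S).comp (δ.comp (σ : S →ₗ[F] g)), fun a b => ?_⟩,
    fun y => (hδσ y).symm⟩
  change p (δ (σ ⁅a, b⁆)) = ⁅a, p (δ (σ b))⁆ - ⁅b, p (δ (σ a))⁆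
  rw [LieHom.map_lie, hder, map_add, LieHom.map_lie, LieHom.map_lie, hpσ, hpσ,
    ← lie_skew b]
  abel

end LeviSection

section ThmA
variable {F : Type*} [Field F] [CharZero F]

/-- The quotient homomorphism. -/
def quotHom {G : Type*} [LieRing G] [LieAlgebra F G] (I : LieIdeal F G) : G →ₗ⁅F⁆ G ⧸ I :=
  { (LieSubmodule.Quotient.mk' I : G →ₗ[F] G ⧸ I) with map_lie' := fun {_ _} => rfl }

theorem quotHom_surj {G : Type*} [LieRing G] [LieAlgebra F G] (I : LieIdeal F G) :
    Function.Surjective (quotHom I) := LieSubmodule.Quotient.surjective_mk' I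

theorem quotHom_eq_zero {G : Type*} [LieRing G] [LieAlgebra F G] (I : LieIdeal F G) (x : G) :
    quotHom I x = 0 ↔ x ∈ I := LieSubmodule.Quotient.mk_eq_zero'

theorem quot_trivialRadical (G : Type*) [LieRing G] [LieAlgebra F G] [FiniteDimensional F G] :
    LieAlgebra.HasTrivialRadical F (G ⧸ LieAlgebra.radical F G) := by
  set R := LieAlgebra.radical F G with hR
  refine LieAlgebra.hasTrivialRadical_of_no_solvable_ideals fun I hI => ?_
  let J : LieIdeal F G := I.comap (quotHom R)
  have h1 : ∀ k, LieAlgebra.derivedSeriesOfIdeal F G k J ≤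
      (LieAlgebra.derivedSeriesOfIdeal F (G ⧸ R) k I).comap (quotHom R) := by
    intro k
    induction k with
    | zero => exact le_rfl
    | succ k ih =>
      rw [LieAlgebra.derivedSeriesOfIdeal_succ, LieAlgebra.derivedSeriesOfIdeal_succ]
      exact (LieSubmodule.mono_lie ih ih).trans (LieIdeal.comap_bracket_le _)
  obtain ⟨k, hk⟩ := (LieAlgebra.isSolvable_iff F _).1 hI
  rw [LieIdeal.derivedSeries_eq_bot_iff] at hk
  obtain ⟨m, hm⟩ := (LieAlgebra.isSolvable_iff F _).1
      (inferInstance : LieAlgebra.IsSolvable (LieAlgebra.radical F G))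
  rw [LieIdeal.derivedSeries_eq_bot_iff] at hm
  have h2 : LieAlgebra.derivedSeriesOfIdeal F G k J ≤ R := by
    intro x hx
    have := h1 k hx
    rw [hk, LieIdeal.mem_comap, LieSubmodule.mem_bot, quotHom_eq_zero] at this
    exact this
  have h3 : LieAlgebra.IsSolvable J := by
    refine (LieAlgebra.isSolvable_iff F _).2 ⟨m + k, ?_⟩
    rw [LieIdeal.derivedSeries_eq_bot_iff, LieAlgebra.derivedSeriesOfIdeal_add, eq_bot_iff, ← hm]
    exact LieAlgebra.derivedSeriesOfIdeal_mono h2 m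
  have h4 : J ≤ R := (LieAlgebra.LieIdeal.solvable_iff_le_radical F G J).1 h3
  rw [eq_bot_iff]
  intro y hy
  obtain ⟨x, rfl⟩ := quotHom_surj R y
  rw [LieSubmodule.mem_bot, quotHom_eq_zero]
  exact h4 (LieIdeal.mem_comap.2 hy)

variable {V : Type*} [AddCommGroup V] [Module F V] [FiniteDimensional F V]

theorem ad_ss_mem {x s n : End F V} (hx : x = n + s) (hs : s.IsSemisimple) (hn : IsNilpotent n)
    (hc : Commute n s) (N N' : Submodule F (End F V)) (hle : N' ≤ N)
    (h : ∀ y ∈ N, ⁅x, y⁆ ∈ N') : ∀ y ∈ N, ⁅s, y⁆ ∈ N' := by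
  by_cases hx0 : x = 0
  · have h1 : s = 0 := by
      refine Module.End.eq_zero_of_isNilpotent_isSemisimple ?_ hs
      have : s = - n := by rw [eq_neg_iff_add_eq_zero, add_comm, ← hx, hx0]
      rw [this]; exact hn.neg
    intro y _
    rw [h1, zero_lie]; exact N'.zero_mem
  have had := LieAlgebra.ad_mem_adjoin_of_isSemisimple (K := F) hc hn hs
  rw [← hx, Algebra.adjoin_singleton_eq_range_aeval] at had
  obtain ⟨q, hq⟩ := had
  change aeval (LieAlgebra.ad F (End F V) x) q = _ at hq
  have key : ∀ q : F[X], ∀ y ∈ N,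
      aeval (LieAlgebra.ad F (End F V) x) q y - q.coeff 0 • y ∈ N' := by
    intro q
    induction q using Polynomial.induction_on with
    | C a => intro y _; simp [Algebra.algebraMap_eq_smul_one]
    | add p q hp hq =>
      intro y hy
      have := N'.add_mem (hp y hy) (hq y hy)
      simp only [map_add, LinearMap.add_apply, coeff_add, add_smul]
      convert this using 1
      abel
    | monomial k a ih =>
      intro y hy
      rw [pow_succ, ← mul_assoc, mul_coeff_zero, coeff_X_zero, mul_zero, zero_smul, sub_zero,
        map_mul _ _ X, aeval_X, Module.End.mul_apply]
      have h1 : LieAlgebra.ad F (End F V) x y ∈ N' := h y hy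
      have h2 := N'.add_mem (ih _ (hle h1)) (N'.smul_mem ((C a * X ^ k : F[X]).coeff 0) h1)
      rwa [sub_add_cancel] at h2
  have hq0 : q.coeff 0 = 0 := by
    have h1 : ∀ q : F[X], aeval (LieAlgebra.ad F (End F V) x) q x = q.coeff 0 • x := by
      intro q
      induction q using Polynomial.induction_on with
      | C a => simp [Algebra.algebraMap_eq_smul_one]
      | add p q hp hq => simp [hp, hq, add_smul]
      | monomial k a ih =>
        rw [pow_succ, ← mul_assoc, mul_coeff_zero, coeff_X_zero, mul_zero, zero_smul,
          map_mul _ _ X, aeval_X, Module.End.mul_apply, LieAlgebra.ad_apply, lie_self, map_zero]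
    have h2 := h1 q
    rw [hq, LieAlgebra.ad_apply, lie_End, hx, mul_add, add_mul, hc.eq, sub_self, ← hx] at h2
    exact (smul_eq_zero.1 h2.symm).resolve_right hx0
  intro y hy
  have := key q y hy
  rwa [hq, hq0, zero_smul, sub_zero] at this

theorem thmA (G : LieSubalgebra F (End F V)) (x : G) (hx : x ∈ LieAlgebra.derivedSeries F G 1)
    (s n : End F V) (hxs : (x : End F V) = n + s) (hs : s.IsSemisimple) (hn : IsNilpotent n)
    (hsx : s ∈ Algebra.adjoin F {(x : End F V)}) (hc : Commute n s) :
    ∃ d ∈ LieAlgebra.derivedSeries F G 1, (d : End F V) = s := by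
  set R := LieAlgebra.radical F G with hR
  set D := LieAlgebra.derivedSeries F G 1 with hD
  have : LieAlgebra.HasTrivialRadical F (G ⧸ R) := quot_trivialRadical G
  have hDb : ∀ a b : G, ⁅a, b⁆ ∈ D := fun a b =>
    LieSubmodule.lie_mem_lie (LieSubmodule.mem_top a) (LieSubmodule.mem_top b)
  -- stability of ideals under `ad s`
  have hst : ∀ I : LieIdeal F G, ∀ I' : LieIdeal F G, I' ≤ I → (∀ y ∈ I, ⁅x, y⁆ ∈ I') →
      ∀ y ∈ I, ∃ z ∈ I', (z : End F V) = ⁅s, (y : End F V)⁆ := by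
    intro I I' hle h y hy
    have := ad_ss_mem hxs hs hn hc (I.toSubmodule.map G.toSubmodule.subtype)
      (I'.toSubmodule.map G.toSubmodule.subtype) (Submodule.map_mono hle) (by
        rintro _ ⟨z, hz, rfl⟩
        exact ⟨⁅x, z⁆, h z hz, rfl⟩) y ⟨y, hy, rfl⟩
    obtain ⟨z, hz, hz'⟩ := this
    exact ⟨z, hz, hz'⟩
  have hGD : ∀ y : G, ∃ z ∈ D, (z : End F V) = ⁅s, (y : End F V)⁆ := fun y =>
    hst ⊤ D le_top (fun y _ => hDb x y) y (LieSubmodule.mem_top y)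
  have hG : ∀ y ∈ G.toSubmodule, LieAlgebra.ad F (End F V) s y ∈ G.toSubmodule := by
    intro y hy
    obtain ⟨z, -, hz⟩ := hGD ⟨y, hy⟩
    change ⁅s, y⁆ ∈ G
    rw [← hz]; exact z.2
  let δG : End F G := (LieAlgebra.ad F (End F V) s).restrict hG
  have hδG : ∀ y : G, (δG y : End F V) = ⁅s, (y : End F V)⁆ := fun y => rfl
  have hδGs : δG.IsSemisimple := (LieAlgebra.ad_isSemisimple_of_isSemisimple hs).restrict hG
  have hδI : ∀ I : LieIdeal F G, ∀ y ∈ I, δG y ∈ I := by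
    intro I y hy
    obtain ⟨z, hz, hz'⟩ := hst I I le_rfl (fun y hy => I.lie_mem hy) y hy
    have : δG y = z := Subtype.ext hz'.symm
    rw [this]; exact hz
  let δ : End F D := δG.restrict (p := D.toSubmodule) (q := D.toSubmodule) (hδI D)
  have hδ : ∀ y : D, (δ y : G) = δG y := fun y => rfl
  have hδs : δ.IsSemisimple := hδGs.restrict (hδI D)
  let q : G →ₗ⁅F⁆ G ⧸ R := quotHom R
  have hq0 : ∀ y : G, q y = 0 ↔ y ∈ R := quotHom_eq_zero R
  let p : D →ₗ⁅F⁆ G ⧸ R := q.comp D.incl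
  have hp : ∀ y : D, p y = q y := fun y => rfl
  have hps : Function.Surjective p := by
    intro y
    have hy : y ∈ ⁅(⊤ : LieIdeal F (G ⧸ R)), (⊤ : LieIdeal F (G ⧸ R))⁆ := by
      rw [ideal_perfect]; exact LieSubmodule.mem_top y
    rw [← LieSubmodule.mem_toSubmodule, LieSubmodule.lieIdeal_oper_eq_linear_span'] at hy
    induction hy using Submodule.span_induction with
    | mem x hx =>
      obtain ⟨a, -, b, -, rfl⟩ := hx
      obtain ⟨a, rfl⟩ := quotHom_surj R a
      obtain ⟨b, rfl⟩ := quotHom_surj R b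
      exact ⟨⟨⁅a, b⁆, hDb a b⟩, LieHom.map_lie (quotHom R) a b⟩
    | zero => exact ⟨0, map_zero _⟩
    | add x y _ _ h1 h2 =>
      obtain ⟨a, rfl⟩ := h1
      obtain ⟨b, rfl⟩ := h2
      exact ⟨a + b, map_add _ _ _⟩
    | smul c x _ h1 =>
      obtain ⟨a, rfl⟩ := h1
      exact ⟨c • a, map_smul _ _ _⟩
  have hqker : q.ker = R := by
    ext y; rw [LieHom.mem_ker, hq0]
  have hqs : LieAlgebra.IsSolvable q.ker := by
    rw [hqker, hR]; infer_instance
  have hpker : LieAlgebra.IsSolvable p.ker :=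
    isSolvable_of_le q D.incl Subtype.val_injective hqs
  obtain ⟨σ, hσ, D', hD'⟩ := levi_section p hps hpker δ hδs (by
      intro a b
      apply Subtype.ext
      apply Subtype.ext
      change ⁅s, ⁅((a : G) : End F V), ((b : G) : End F V)⁆⁆ =
        ⁅⁅s, ((a : G) : End F V)⁆, ((b : G) : End F V)⁆ +
          ⁅((a : G) : End F V), ⁅s, ((b : G) : End F V)⁆⁆
      exact leibniz_lie _ _ _) (by
      intro y hy
      rw [hp, hq0] at hy ⊢
      exact hδI R _ hy)
  let τ : (G ⧸ R) →ₗ⁅F⁆ End F V := G.incl.comp (D.incl.comp σ)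
  have hτ : ∀ y, τ y = ((σ y : G) : End F V) := fun y => rfl
  have htoEnd : ∀ y : G, LieModule.toEnd F G V y = (y : End F V) := fun y => rfl
  have henv : ∀ y : G, (y : End F V) ∈ env F V G := fun y => toEnd_mem_env y
  let u : D := ⟨x, hx⟩ - σ (p ⟨x, hx⟩)
  have hu : (u : G) ∈ R := by
    rw [← hq0, ← hp, map_sub, hσ, sub_self]
  have huj : ((u : G) : End F V) ∈ jac (env F V G) := solv_step (V := V) (u : G) hu u.2
  obtain ⟨d, hd⟩ := coreA (env F V G) τ (fun y => henv _) x s n ((u : G) : End F V)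
    (p ⟨x, hx⟩) (by
      rw [hτ]
      have : ((u : G) : End F V) = (x : End F V) - ((σ (p ⟨x, hx⟩) : G) : End F V) := rfl
      rw [this]; abel) huj hxs
    (Algebra.adjoin_le (Set.singleton_subset_iff.2 (henv x)) hsx) hs hn D' (fun y => by
      have := congrArg (fun z : D => ((z : G) : End F V)) (hD' y)
      exact this)
  exact ⟨(σ d : G), (σ d).2, hd⟩

end ThmA
end AJCD

namespace AJCD
open Module Polynomial LinearMap
set_option linter.unusedSectionVars false

section Final
variable {F : Type*} [Field F] [CharZero F] {g : Type*} [LieRing g] [LieAlgebra F g]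

/-- `π x = π s + π (x - s)` is a Jordan–Chevalley decomposition. -/
def JC {V : Type*} [AddCommGroup V] [Module F V] (π : g →ₗ⁅F⁆ End F V) (x s : g) : Prop :=
  (π s).IsSemisimple ∧ IsNilpotent (π (x - s)) ∧ Commute (π s) (π (x - s))

theorem lemmaB {V : Type*} [AddCommGroup V] [Module F V] [FiniteDimensional F V]
    (π : g →ₗ⁅F⁆ End F V) (x : g) (hx : x ∈ LieAlgebra.derivedSeries F g 1) :
    ∃ s ∈ LieAlgebra.derivedSeries F g 1, JC π x s := by
  obtain ⟨n, hn, t, ht, hnn, hts, hnt⟩ := (π x).exists_isNilpotent_isSemisimple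
  have hcnt : Commute n t := commute_adjoin hn (commute_adjoin ht (Commute.refl _)).symm
  have hsurj := π.surjective_rangeRestrict
  have hmap := LieIdeal.derivedSeries_map_eq 1 hsurj
  have hx' : π.rangeRestrict x ∈ LieAlgebra.derivedSeries F π.range 1 := by
    rw [← hmap]; exact LieIdeal.mem_map hx
  obtain ⟨d, hd, hd'⟩ := thmA π.range (π.rangeRestrict x) hx' t n hnt hts hnn ht hcnt
  rw [← hmap] at hd
  obtain ⟨⟨s, hs⟩, hs'⟩ := LieIdeal.mem_map_of_surjective hsurj hd
  have hst : π s = t := by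
    rw [← hd', ← hs']; rfl
  have hn' : π (x - s) = n := by rw [map_sub, hst, hnt]; abel
  refine ⟨s, hs, ?_, ?_, ?_⟩
  · rw [hst]; exact hts
  · rw [hn']; exact hnn
  · rw [hst, hn']; exact hcnt.symm

theorem JC_unique {V : Type*} [AddCommGroup V] [Module F V] [FiniteDimensional F V]
    (π : g →ₗ⁅F⁆ End F V) {x s s' : g} (h : JC π x s) (h' : JC π x s') : π s = π s' :=
  (Module.End.isNilpotent_isSemisimple_unique h.2.1 h.1 h'.2.1 h'.1 h.2.2.symm h'.2.2.symm
    (by rw [← map_add, ← map_add, sub_add_cancel, sub_add_cancel])).2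

theorem JC_intertwine {V W : Type*} [AddCommGroup V] [Module F V] [FiniteDimensional F V]
    [AddCommGroup W] [Module F W] [FiniteDimensional F W]
    (π : g →ₗ⁅F⁆ End F V) (ρ : g →ₗ⁅F⁆ End F W) (f : V →ₗ[F] W) (hf : Function.Surjective f)
    (h : ∀ y v, ρ y (f v) = f (π y v)) {x s : g} (hJ : JC π x s) : JC ρ x s := by
  refine ⟨?_, ?_, ?_⟩
  · refine Module.End.isSemisimple_of_squarefree_aeval_eq_zero hJ.1.minpoly_squarefree ?_
    ext w
    obtain ⟨v, rfl⟩ := hf w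
    rw [aeval_intertwine f (π s) (ρ s) (h s), minpoly.aeval]; simp
  · obtain ⟨k, hk⟩ := hJ.2.1
    refine ⟨k, ?_⟩
    ext w
    obtain ⟨v, rfl⟩ := hf w
    have := aeval_intertwine f (π (x - s)) (ρ (x - s)) (h _) (X ^ k) v
    rw [map_pow, map_pow, aeval_X, aeval_X, hk] at this
    rw [this]; simp
  · ext w
    obtain ⟨v, rfl⟩ := hf w
    have := LinearMap.congr_fun hJ.2.2.eq v
    rw [Module.End.mul_apply, Module.End.mul_apply] at this
    rw [Module.End.mul_apply, Module.End.mul_apply, h, h, h, h, this]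

/-- Direct sum of two representations. -/
def prodRep {V W : Type*} [AddCommGroup V] [Module F V] [AddCommGroup W] [Module F W]
    (π : g →ₗ⁅F⁆ End F V) (ρ : g →ₗ⁅F⁆ End F W) : g →ₗ⁅F⁆ End F (V × W) where
  toFun y := (π y).prodMap (ρ y)
  map_add' a b := by ext <;> simp
  map_smul' c a := by ext <;> simp
  map_lie' {a b} := by
    rw [LieHom.map_lie, LieHom.map_lie]
    ext <;> simp

variable [FiniteDimensional F g]

/-- Every representation can be transported to coordinate space. -/
theorem transport {V : Type*} [AddCommGroup V] [Module F V] [FiniteDimensional F V]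
    (π : g →ₗ⁅F⁆ End F V) : ∃ (k : ℕ) (ρ : g →ₗ⁅F⁆ End F (Fin k → F)),
      ∀ y, ρ y = 0 ↔ π y = 0 := by
  let e := (Module.finBasis F V).equivFun
  refine ⟨_, e.lieConj.toLieHom.comp π, fun y => ?_⟩
  change e.lieConj (π y) = 0 ↔ π y = 0
  exact map_eq_zero_iff e.lieConj e.lieConj.injective

variable (F g) in
/-- There is a representation whose kernel is contained in all others. -/
theorem exists_min_rep : ∃ (k : ℕ) (π₀ : g →ₗ⁅F⁆ End F (Fin k → F)),
    ∀ (m : ℕ) (ρ : g →ₗ⁅F⁆ End F (Fin m → F)) (y : g), π₀ y = 0 → ρ y = 0 := by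
  let P : Set (Submodule F g) := {N | ∃ (k : ℕ) (π : g →ₗ⁅F⁆ End F (Fin k → F)),
    ∀ y, y ∈ N ↔ π y = 0}
  have hker : ∀ (k : ℕ) (π : g →ₗ⁅F⁆ End F (Fin k → F)),
      LinearMap.ker (π : g →ₗ[F] End F (Fin k → F)) ∈ P :=
    fun k π => ⟨k, π, fun y => LinearMap.mem_ker⟩
  obtain ⟨N, ⟨k, π₀, hN⟩, hmin⟩ :=
    (wellFounded_lt (α := Submodule F g)).has_min P ⟨_, hker 0 0⟩
  refine ⟨k, π₀, fun m ρ y hy => ?_⟩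
  obtain ⟨l, τ, hτ⟩ := transport (prodRep π₀ ρ)
  have hτ' : ∀ z, τ z = 0 → π₀ z = 0 ∧ ρ z = 0 := by
    intro z hz
    have h := (hτ z).1 hz
    constructor
    · refine LinearMap.ext fun v => ?_
      exact congrArg Prod.fst (LinearMap.congr_fun h (v, 0))
    · refine LinearMap.ext fun v => ?_
      exact congrArg Prod.snd (LinearMap.congr_fun h (0, v))
  have hle : LinearMap.ker (τ : g →ₗ[F] End F (Fin l → F)) ≤ N :=
    fun z hz => (hN z).2 (hτ' z hz).1
  have heq : LinearMap.ker (τ : g →ₗ[F] End F (Fin l → F)) = N := by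
    by_contra hne
    exact hmin _ (hker l τ) (lt_of_le_of_ne hle hne)
  have hyN : y ∈ LinearMap.ker (τ : g →ₗ[F] End F (Fin l → F)) := heq ▸ (hN y).2 hy
  exact (hτ' y hyN).2

theorem JC_all {k : ℕ} {π₀ : g →ₗ⁅F⁆ End F (Fin k → F)}
    (hmin : ∀ (m : ℕ) (ρ : g →ₗ⁅F⁆ End F (Fin m → F)) (y : g), π₀ y = 0 → ρ y = 0)
    {x s : g} (hx : x ∈ LieAlgebra.derivedSeries F g 1) (hs : JC π₀ x s)
    {V : Type*} [AddCommGroup V] [Module F V] [FiniteDimensional F V]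
    (π : g →ₗ⁅F⁆ End F V) : JC π x s := by
  obtain ⟨s', -, h'⟩ := lemmaB (prodRep π₀ π) x hx
  have h1 : JC π₀ x s' := JC_intertwine (prodRep π₀ π) π₀ (LinearMap.fst F _ _)
    LinearMap.fst_surjective (fun _ _ => rfl) h'
  have h2 : JC π x s' := JC_intertwine (prodRep π₀ π) π (LinearMap.snd F _ _)
    LinearMap.snd_surjective (fun _ _ => rfl) h'
  obtain ⟨m, ρ, hρ⟩ := transport π
  have h3 : π (s' - s) = 0 := by
    refine (hρ _).1 (hmin m ρ _ ?_)
    rw [map_sub, JC_unique π₀ h1 hs, sub_self]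
  have h4 : π s' = π s := by rwa [map_sub, sub_eq_zero] at h3
  have h5 : π (x - s') = π (x - s) := by rw [map_sub, map_sub, h4]
  unfold JC at h2 ⊢
  rwa [h4, h5] at h2

theorem lie_zero_of_ad {x s : g} (h : JC (LieAlgebra.ad F g) x s) : ⁅s, x - s⁆ = 0 := by
  obtain ⟨hss, -, hc⟩ := h
  obtain ⟨r, hr0, hr⟩ := exists_r_of_isSemisimple hss
  generalize x - s = n at hc ⊢
  have hz : LieAlgebra.ad F g ⁅s, n⁆ = 0 := by
    rw [LieHom.map_lie, lie_End, hc.eq, sub_self]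
  have hsz : ⁅s, ⁅s, n⁆⁆ = 0 := by
    have := LinearMap.congr_fun hz s
    rw [LieAlgebra.ad_apply] at this
    rw [← lie_skew, this]; simp
  set T := LieAlgebra.ad F g s with hT
  have h1 : T (T n) = 0 := by simpa [hT] using hsz
  have h2 := LinearMap.congr_fun hr n
  have h3 : aeval T r = aeval T r.divX * T + algebraMap F _ (r.coeff 0) := by
    conv_lhs => rw [← divX_mul_X_add r]
    simp
  have hcomm : Commute T (aeval T r.divX) := by
    have := (Commute.all (X : F[X]) r.divX).map (aeval T)
    simpa using this
  rw [h3, mul_add, ← mul_assoc, hcomm.eq, mul_assoc] at h2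
  simp only [LinearMap.add_apply, Module.End.mul_apply, h1, map_zero, zero_add,
    Module.algebraMap_end_apply, map_smul, LinearMap.zero_apply] at h2
  exact (smul_eq_zero.1 h2).resolve_left hr0

end Final
end AJCD

/-- If `x` lies in the derived algebra `[g, g]` of a finite-dimensional Lie algebra `g` over a
field `F` of characteristic `0`, then there exist `s, n ∈ [g, g]` with `x = s + n` and
`⁅s, n⁆ = 0` such that for every finite-dimensional representation `π : g → gl(V)`, `π s` is
semisimple (its minimal polynomial is squarefree), `π n` is nilpotent, and `π s` commutes with
`π n`; that is, `π x = π s + π n` is the Jordan–Chevalley decomposition of `π x`. -/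
theorem abstractJCD_of_mem_derived
    {F : Type u} [Field F] [CharZero F]
    {g : Type v} [LieRing g] [LieAlgebra F g] [Module.Finite F g]
    (x : g) (hx : x ∈ LieAlgebra.derivedSeries F g 1) :
    ∃ s n : g,
      s ∈ LieAlgebra.derivedSeries F g 1 ∧ n ∈ LieAlgebra.derivedSeries F g 1 ∧
      x = s + n ∧ ⁅s, n⁆ = 0 ∧
      ∀ (V : Type w) [AddCommGroup V] [Module F V] [FiniteDimensional F V]
        (π : g →ₗ⁅F⁆ Module.End F V),
        Squarefree (minpoly F (π s)) ∧ IsNilpotent (π n) ∧ Commute (π s) (π n) := by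
  obtain ⟨k, π₀, hmin⟩ := AJCD.exists_min_rep F g
  obtain ⟨s, hs, hJ⟩ := AJCD.lemmaB π₀ x hx
  refine ⟨s, x - s, hs, sub_mem hx hs, (add_sub_cancel s x).symm,
    AJCD.lie_zero_of_ad (AJCD.JC_all hmin hx hJ (LieAlgebra.ad F g)), ?_⟩
  intro V _ _ _ π
  obtain ⟨h1, h2, h3⟩ := AJCD.JC_all hmin hx hJ π
  exact ⟨h1.minpoly_squarefree, h2, h3⟩
end
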